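/- Let Ω ⊆ ℂⁿ be a pseudoconvex open set and let φ: Ω → ℝ be a C² function satisfying i∂∂̄φ ≥ 5β. There exists a constant C (depending only on n) such that for every k ≥ 1, every a ∈ ℂⁿ, and every smooth ∂̄-closed (0,1)-form f on Ω with ∫_Ω |f|² e^{−kφ} dλ < ∞, the L²(Ω, e^{−kφ})-minimal solution v of ∂̄v = f satisfies ∫_Ω |v(z)|² e^{−kφ(z) − √k·|z−a|} dλ(z) ≤ (C/k) ∫_Ω |f(z)|² e^{−kφ(z) − √k·|z−a|} dλ(z). -/

import Mathlib

open MeasureTheory Complex Metric Set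
open scoped ComplexConjugate

noncomputable section

/-- `ℂⁿ` with the Euclidean norm. -/
abbrev Cn (n : ℕ) := EuclideanSpace ℂ (Fin n)

variable {n : ℕ}

instance : MeasurableSpace (Cn n) := borel _
instance : BorelSpace (Cn n) := ⟨rfl⟩

/-- The Levi form of `φ` at `z` applied to `w`:
`L_φ(z; w) = ¼ (D²φ(z)[w,w] + D²φ(z)[iw,iw])` where `D²φ` is the second real Fréchet
derivative. -/
def LeviForm (φ : Cn n → ℝ) (z w : Cn n) : ℝ :=
  (1 / 4) * (fderiv ℝ (fderiv ℝ φ) z w w +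
    fderiv ℝ (fderiv ℝ φ) z (Complex.I • w) (Complex.I • w))

/-- `Ω` is pseudoconvex: it admits a `C²` exhaustion function with nonnegative Levi form. -/
def Pseudoconvex (Ω : Set (Cn n)) : Prop :=
  ∃ ρ : Cn n → ℝ, ContDiffOn ℝ 2 ρ Ω ∧
    (∀ c : ℝ, IsCompact {z ∈ Ω | ρ z ≤ c}) ∧
    ∀ z ∈ Ω, ∀ w : Cn n, 0 ≤ LeviForm ρ z w

/-- The `j`-th standard basis vector of `ℂⁿ`. -/
def e (n : ℕ) (j : Fin n) : Cn n := EuclideanSpace.single j (1 : ℂ)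

/-- The components of `∂̄v`: `(∂̄v)_j = ½(∂v/∂x_j + i ∂v/∂y_j)`. -/
def dbar (v : Cn n → ℂ) (z : Cn n) (j : Fin n) : ℂ :=
  (1 / 2) * (fderiv ℝ v z (e n j) + Complex.I * fderiv ℝ v z (Complex.I • e n j))

/-- The pointwise squared norm `|f(z)|² = Σ_j |f_j(z)|²` of a `(0,1)`-form. -/
def formNormSq (f : Cn n → Fin n → ℂ) (z : Cn n) : ℝ := ∑ j, ‖f z j‖ ^ 2

/-- A `(0,1)`-form `f` is smooth on `Ω` if each component is. -/
def SmoothFormOn (Ω : Set (Cn n)) (f : Cn n → Fin n → ℂ) : Prop :=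
  ∀ j, ContDiffOn ℝ (⊤ : ℕ∞) (fun z => f z j) Ω

/-- A `(0,1)`-form `f` is `∂̄`-closed on `Ω` if `(∂̄f_j)_k = (∂̄f_k)_j` on `Ω`. -/
def DbarClosedOn (Ω : Set (Cn n)) (f : Cn n → Fin n → ℂ) : Prop :=
  ∀ z ∈ Ω, ∀ j k : Fin n, dbar (fun w => f w j) z k = dbar (fun w => f w k) z j

/-- `v` belongs to the weighted space `L²(Ω, e^{-w})`. -/
def MemL2 (Ω : Set (Cn n)) (w : Cn n → ℝ) (v : Cn n → ℂ) : Prop :=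
  AEStronglyMeasurable v (volume.restrict Ω) ∧
  IntegrableOn (fun z => ‖v z‖ ^ 2 * Real.exp (-w z)) Ω volume

/-- `v` is orthogonal to every holomorphic function in `L²(Ω, e^{-w})`. -/
def OrthToHolo (Ω : Set (Cn n)) (w : Cn n → ℝ) (v : Cn n → ℂ) : Prop :=
  ∀ h : Cn n → ℂ, DifferentiableOn ℂ h Ω → MemL2 Ω w h →
    ∫ z in Ω, v z * conj (h z) * (Real.exp (-w z) : ℂ) = 0

/-- `ψ` is a test function on `Ω`. -/
def IsTestOn (Ω : Set (Cn n)) (ψ : Cn n → ℂ) : Prop :=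
  ContDiff ℝ (⊤ : ℕ∞) ψ ∧ HasCompactSupport ψ ∧ tsupport ψ ⊆ Ω

/-- `∂̄v = f` on `Ω` in the sense of distributions. -/
def DbarEqOn (Ω : Set (Cn n)) (v : Cn n → ℂ) (f : Cn n → Fin n → ℂ) : Prop :=
  ∀ ψ : Cn n → ℂ, IsTestOn Ω ψ → ∀ j : Fin n,
    ∫ z in Ω, v z * dbar ψ z j = -∫ z in Ω, f z j * ψ z

/-- `v` is the `L²(Ω, e^{-w})`-minimal solution of `∂̄v = f`: it solves the equation in the
sense of distributions and is orthogonal to all holomorphic functions in `L²(Ω, e^{-w})`. -/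
def MinimalSolution (Ω : Set (Cn n)) (w : Cn n → ℝ) (f : Cn n → Fin n → ℂ) (v : Cn n → ℂ) :
    Prop :=
  MemL2 Ω w v ∧ DbarEqOn Ω v f ∧ OrthToHolo Ω w v

/-- The constant coefficient operators `½(∂/∂x_j + s ∂/∂y_j)`; `s = I` gives `∂/∂z̄_j` and
`s = -I` gives `∂/∂z_j`. -/
def wirt (s : ℂ) (w : Cn n → ℂ) (z : Cn n) (j : Fin n) : ℂ :=
  (1 / 2) * (fderiv ℝ w z (e n j) + s * fderiv ℝ w z (Complex.I • e n j))

lemma dbar_eq_wirt (w : Cn n → ℂ) (z : Cn n) (j : Fin n) : dbar w z j = wirt I w z j := rfl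

lemma wirt_mul (s : ℂ) {f g : Cn n → ℂ} {z : Cn n} (hf : DifferentiableAt ℝ f z)
    (hg : DifferentiableAt ℝ g z) (j : Fin n) :
    wirt s (fun y => f y * g y) z j = wirt s f z j * g z + f z * wirt s g z j := by
  simp only [wirt, fderiv_fun_mul hf hg, add_apply,
    smul_apply, smul_eq_mul]
  ring

lemma wirt_add (s : ℂ) {f g : Cn n → ℂ} {z : Cn n} (hf : DifferentiableAt ℝ f z)
    (hg : DifferentiableAt ℝ g z) (j : Fin n) :
    wirt s (fun y => f y + g y) z j = wirt s f z j + wirt s g z j := by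
  simp only [wirt, fderiv_fun_add hf hg, add_apply]
  ring

lemma wirt_sub (s : ℂ) {f g : Cn n → ℂ} {z : Cn n} (hf : DifferentiableAt ℝ f z)
    (hg : DifferentiableAt ℝ g z) (j : Fin n) :
    wirt s (fun y => f y - g y) z j = wirt s f z j - wirt s g z j := by
  simp only [wirt, fderiv_fun_sub hf hg, sub_apply]
  ring

lemma wirt_const_mul (s c : ℂ) {f : Cn n → ℂ} {z : Cn n} (hf : DifferentiableAt ℝ f z)
    (j : Fin n) : wirt s (fun y => c * f y) z j = c * wirt s f z j := by
  rw [wirt_mul s (differentiableAt_const c) hf]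
  simp [wirt]

lemma wirt_conj (s : ℂ) {f : Cn n → ℂ} {z : Cn n} (hf : DifferentiableAt ℝ f z) (j : Fin n) :
    wirt s (fun y => conj (f y)) z j = conj (wirt (conj s) f z j) := by
  have h : fderiv ℝ (fun y => conj (f y)) z = (conjCLE : ℂ →L[ℝ] ℂ).comp (fderiv ℝ f z) :=
    ((conjCLE : ℂ →L[ℝ] ℂ).hasFDerivAt.comp z hf.hasFDerivAt).fderiv
  simp only [wirt, h]
  simp [Complex.conj_ofNat]

lemma wirt_congr {s : ℂ} {f g : Cn n → ℂ} {z : Cn n} (h : f =ᶠ[nhds z] g) (j : Fin n) :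
    wirt s f z j = wirt s g z j := by
  simp [wirt, h.fderiv_eq]

lemma wirt_ofReal_comp {Y : ℝ → ℝ} {f : Cn n → ℝ} {z : Cn n} (s : ℂ) {Y' : ℝ}
    (hY : HasDerivAt Y Y' (f z)) (hf : DifferentiableAt ℝ f z) (j : Fin n) :
    wirt s (fun y => (Y (f y) : ℂ)) z j = Y' * wirt s (fun y => (f y : ℂ)) z j := by
  have h1 : fderiv ℝ (fun y => (f y : ℂ)) z = ofRealCLM.comp (fderiv ℝ f z) :=
    (ofRealCLM.hasFDerivAt.comp z hf.hasFDerivAt).fderiv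
  have h2 : fderiv ℝ (fun y => (Y (f y) : ℂ)) z = ofRealCLM.comp (Y' • fderiv ℝ f z) :=
    (ofRealCLM.hasFDerivAt.comp z (hY.comp_hasFDerivAt z hf.hasFDerivAt)).fderiv
  simp [wirt, h1, h2]
  ring

lemma wirt_neg_I_ofReal {f : Cn n → ℝ} {z : Cn n} (hf : DifferentiableAt ℝ f z) (j : Fin n) :
    wirt (-I) (fun y => (f y : ℂ)) z j = conj (wirt I (fun y => (f y : ℂ)) z j) := by
  have h := wirt_conj (-I) (f := fun y => (f y : ℂ)) (z := z)
    (ofRealCLM.differentiableAt.comp z hf) j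
  simpa using h

lemma contDiff_wirt (s : ℂ) {m : ℕ∞} {f : Cn n → ℂ} (hf : ContDiff ℝ (m + 1) f) (j : Fin n) :
    ContDiff ℝ m (fun z => wirt s f z j) := by
  have h : ContDiff ℝ m (fderiv ℝ f) := hf.fderiv_right le_rfl
  unfold wirt
  fun_prop

lemma continuous_wirt (s : ℂ) {f : Cn n → ℂ} (hf : ContDiff ℝ 1 f) (j : Fin n) :
    Continuous (fun z => wirt s f z j) := by
  have h : Continuous (fderiv ℝ f) := hf.continuous_fderiv one_ne_zero
  unfold wirt
  fun_prop

lemma continuousOn_wirt (s : ℂ) {Ω : Set (Cn n)} (hΩ : IsOpen Ω) {f : Cn n → ℂ}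
    (hf : ContDiffOn ℝ 1 f Ω) (j : Fin n) : ContinuousOn (fun z => wirt s f z j) Ω := by
  have h : ContinuousOn (fderiv ℝ f) Ω := hf.continuousOn_fderiv_of_isOpen hΩ le_rfl
  unfold wirt
  fun_prop

lemma wirt_eq_zero_of_notMem_tsupport {s : ℂ} {f : Cn n → ℂ} {z : Cn n} (h : z ∉ tsupport f)
    (j : Fin n) : wirt s f z j = 0 := by
  simp [wirt, fderiv_of_notMem_tsupport (𝕜 := ℝ) h]

lemma tsupport_wirt_subset (s : ℂ) (f : Cn n → ℂ) (j : Fin n) :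
    tsupport (fun z => wirt s f z j) ⊆ tsupport f := by
  refine closure_minimal (fun z hz => ?_) isClosed_closure
  by_contra h
  exact hz (wirt_eq_zero_of_notMem_tsupport h j)

lemma hasCompactSupport_wirt (s : ℂ) {f : Cn n → ℂ} (hf : HasCompactSupport f) (j : Fin n) :
    HasCompactSupport (fun z => wirt s f z j) :=
  hf.of_isClosed_subset isClosed_closure (tsupport_wirt_subset s f j)

lemma wirt_comm (s s' : ℂ) {f : Cn n → ℂ} (hf : ContDiff ℝ 2 f) (z : Cn n) (j k : Fin n) :
    wirt s (fun y => wirt s' f y j) z k = wirt s' (fun y => wirt s f y k) z j := by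
  have hd : DifferentiableAt ℝ (fderiv ℝ f) z :=
    ((hf.fderiv_right (m := 1) (by norm_num)).differentiable one_ne_zero) z
  have hsym : IsSymmSndFDerivAt ℝ f z := hf.contDiffAt.isSymmSndFDerivAt (by simp)
  have key : ∀ (s : ℂ) (j : Fin n) (u : Cn n), fderiv ℝ (fun y => wirt s f y j) z u =
      (1 / 2) * (fderiv ℝ (fderiv ℝ f) z u (e n j) +
        s * fderiv ℝ (fderiv ℝ f) z u (Complex.I • e n j)) := by
    intro s j u
    have h1 : ∀ v : Cn n, HasFDerivAt (fun y => fderiv ℝ f y v)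
        ((fderiv ℝ (fderiv ℝ f) z).flip v) z := fun v => by
      simpa using hd.hasFDerivAt.clm_apply (hasFDerivAt_const v z)
    have h2 := ((h1 (e n j)).add ((h1 (I • e n j)).const_mul s)).const_mul (1 / 2 : ℂ)
    have h3 := h2.fderiv
    simp only [wirt]
    erw [h3]
    simp [mul_add]
  simp only [wirt.eq_1 s (fun y => wirt s' f y j), wirt.eq_1 s' (fun y => wirt s f y k), key]
  rw [hsym.eq (e n k) (e n j), hsym.eq (e n k) (I • e n j), hsym.eq (I • e n k) (e n j),
    hsym.eq (I • e n k) (I • e n j)]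
  ring

lemma integral_wirt_mul (s : ℂ) {f g : Cn n → ℂ} (hf : ContDiff ℝ 1 f) (hg : ContDiff ℝ 1 g)
    (hc : HasCompactSupport g) (j : Fin n) :
    ∫ z, wirt s f z j * g z = - ∫ z, f z * wirt s g z j := by
  have hf' : Continuous (fderiv ℝ f) := hf.continuous_fderiv one_ne_zero
  have hg' : Continuous (fderiv ℝ g) := hg.continuous_fderiv one_ne_zero
  have hfc := hf.continuous
  have hgc := hg.continuous
  have i1 : ∀ u, Integrable (fun z => fderiv ℝ f z u * g z) := fun u =>
    (by fun_prop : Continuous _).integrable_of_hasCompactSupport (hc.mul_left)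
  have i2 : ∀ u, Integrable (fun z => f z * fderiv ℝ g z u) := fun u =>
    (by fun_prop : Continuous _).integrable_of_hasCompactSupport
      ((hc.fderiv_apply (𝕜 := ℝ) u).mul_left)
  have i3 : Integrable (fun z => f z * g z) :=
    (by fun_prop : Continuous _).integrable_of_hasCompactSupport (hc.mul_left)
  have key : ∀ u, ∫ z, f z * fderiv ℝ g z u = - ∫ z, fderiv ℝ f z u * g z := fun u =>
    integral_mul_fderiv_eq_neg_fderiv_mul_of_integrable (i1 u) (i2 u) i3
      (fun x _ => hf.differentiable one_ne_zero x) (fun x _ => hg.differentiable one_ne_zero x)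
  have e1 : (fun z => wirt s f z j * g z) = fun z =>
      (1 / 2) * (fderiv ℝ f z (e n j) * g z) + (1 / 2 * s) * (fderiv ℝ f z (I • e n j) * g z) := by
    ext z; simp only [wirt]; ring
  have e2 : (fun z => f z * wirt s g z j) = fun z =>
      (1 / 2) * (f z * fderiv ℝ g z (e n j)) + (1 / 2 * s) * (f z * fderiv ℝ g z (I • e n j)) := by
    ext z; simp only [wirt]; ring
  rw [e1, e2, integral_add ((i1 _).const_mul _) ((i1 _).const_mul _),
    integral_add ((i2 _).const_mul _) ((i2 _).const_mul _)]
  simp only [integral_const_mul, key]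
  ring

/-- The formal adjoint (up to sign) of `∂/∂z̄_j` in the weighted space `L²(e^{-Φ})`. -/
def wdel (Φ : Cn n → ℝ) (w : Cn n → ℂ) (z : Cn n) (j : Fin n) : ℂ :=
  wirt (-I) w z j - wirt (-I) (fun y => (Φ y : ℂ)) z j * w z

lemma contDiff_ofReal_comp {m : WithTop ℕ∞} {f : Cn n → ℝ} (hf : ContDiff ℝ m f) :
    ContDiff ℝ m (fun y => (f y : ℂ)) := ofRealCLM.contDiff.comp hf

lemma contDiff_conj_comp {m : WithTop ℕ∞} {f : Cn n → ℂ} (hf : ContDiff ℝ m f) :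
    ContDiff ℝ m (fun y => conj (f y)) := conjCLE.contDiff.comp hf

lemma hasCompactSupport_conj_comp {f : Cn n → ℂ} (hf : HasCompactSupport f) :
    HasCompactSupport (fun y => conj (f y)) := hf.comp_left (g := fun x => conj x) (map_zero _)

lemma wirt_exp_neg (s : ℂ) {Φ : Cn n → ℝ} {z : Cn n} (hΦ : DifferentiableAt ℝ Φ z) (j : Fin n) :
    wirt s (fun y => (Real.exp (-Φ y) : ℂ)) z j =
      -(wirt s (fun y => (Φ y : ℂ)) z j * (Real.exp (-Φ z) : ℂ)) := by
  have hY : HasDerivAt (fun t : ℝ => Real.exp (-t)) (-Real.exp (-Φ z)) (Φ z) := by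
    simpa using (hasDerivAt_neg (Φ z)).exp
  rw [wirt_ofReal_comp s hY hΦ]
  push_cast
  ring

lemma wirt_mul_exp_neg {Φ : Cn n → ℝ} {w : Cn n → ℂ} {z : Cn n} (hΦ : DifferentiableAt ℝ Φ z)
    (hw : DifferentiableAt ℝ w z) (j : Fin n) :
    wirt (-I) (fun y => w y * (Real.exp (-Φ y) : ℂ)) z j =
      wdel Φ w z j * (Real.exp (-Φ z) : ℂ) := by
  rw [wirt_mul _ hw, wirt_exp_neg _ hΦ, wdel]
  · ring
  · exact ofRealCLM.differentiableAt.comp z (hΦ.neg.exp)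

lemma contDiff_one_wirt (s : ℂ) {f : Cn n → ℂ} (hf : ContDiff ℝ 2 f) (j : Fin n) :
    ContDiff ℝ 1 (fun z => wirt s f z j) :=
  contDiff_wirt (m := 1) s (by simpa [one_add_one_eq_two] using hf) j

section Identity

variable {Φ : Cn n → ℝ} {β : Fin n → Cn n → ℂ}

lemma integral_wdel_mul_conj_wdel (hΦ : ContDiff ℝ 2 Φ) (hβ : ∀ j, ContDiff ℝ 2 (β j))
    (hc : ∀ j, HasCompactSupport (β j)) (j k : Fin n) :
    ∫ z, wdel Φ (β j) z j * conj (wdel Φ (β k) z k) * (Real.exp (-Φ z) : ℂ) =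
      (∫ z, wirt I (β j) z k * conj (wirt I (β k) z j) * (Real.exp (-Φ z) : ℂ)) +
      ∫ z, wirt I (fun y => wirt (-I) (fun x => (Φ x : ℂ)) y j) z k * β j z * conj (β k z) *
        (Real.exp (-Φ z) : ℂ) := by
  have hΦd : Differentiable ℝ Φ := hΦ.differentiable two_ne_zero
  have hΦc := contDiff_ofReal_comp hΦ
  have hE : ContDiff ℝ 2 (fun y => (Real.exp (-Φ y) : ℂ)) :=
    contDiff_ofReal_comp (hΦ.neg.exp)
  have hE1 := hE.of_le one_le_two
  have hβ1 : ∀ j, ContDiff ℝ 1 (β j) := fun j => (hβ j).of_le one_le_two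
  have hβd : ∀ j, Differentiable ℝ (β j) := fun j => (hβ j).differentiable two_ne_zero
  have hwΦ : ContDiff ℝ 1 (fun y => wirt (-I) (fun x => (Φ x : ℂ)) y j) :=
    contDiff_one_wirt _ hΦc j
  have hwβ : ∀ s j k, ContDiff ℝ 1 (fun y => wirt s (β j) y k) := fun s j k =>
    contDiff_one_wirt _ (hβ j) k
  have hdel : ContDiff ℝ 1 (fun z => wdel Φ (β j) z j) := (hwβ _ j j).sub (hwΦ.mul (hβ1 j))
  have hdelc : HasCompactSupport (fun z => wdel Φ (β j) z j) :=
    (hasCompactSupport_wirt _ (hc j) j).sub ((hc j).mul_left)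
  have step1 : ∀ z, conj (wdel Φ (β k) z k) * (Real.exp (-Φ z) : ℂ) =
      wirt I (fun y => conj (β k y) * (Real.exp (-Φ y) : ℂ)) z k := by
    intro z
    have := wirt_conj I (f := fun y => β k y * (Real.exp (-Φ y) : ℂ)) (z := z)
      ((hβ1 k).mul hE1 |>.differentiable one_ne_zero z) k
    simp only [map_mul, conj_ofReal, conj_I] at this
    rw [this, wirt_mul_exp_neg (hΦd z) (hβd k z)]
    simp only [map_mul, conj_ofReal]
  have step2 : ∀ z, wirt I (fun y => wdel Φ (β j) y j) z k =
      wdel Φ (fun y => wirt I (β j) y k) z j -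
        wirt I (fun y => wirt (-I) (fun x => (Φ x : ℂ)) y j) z k * β j z := by
    intro z
    simp only [wdel]
    rw [wirt_sub _ ((hwβ _ j j).differentiable one_ne_zero z)
      ((hwΦ.mul (hβ1 j)).differentiable one_ne_zero z),
      wirt_mul _ (hwΦ.differentiable one_ne_zero z) (hβd j z), wirt_comm I (-I) (hβ j)]
    ring
  have step3 : ∀ z, wdel Φ (fun y => wirt I (β j) y k) z j * (Real.exp (-Φ z) : ℂ) =
      wirt (-I) (fun y => wirt I (β j) y k * (Real.exp (-Φ y) : ℂ)) z j := fun z =>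
    (wirt_mul_exp_neg (hΦd z) ((hwβ _ j k).differentiable one_ne_zero z) j).symm
  have hcβ : ∀ k, ContDiff ℝ 1 (fun y => conj (β k y)) := fun k => contDiff_conj_comp (hβ1 k)
  have hccβ : ∀ k, HasCompactSupport (fun y => conj (β k y)) :=
    fun k => hasCompactSupport_conj_comp (hc k)
  have i1 : Integrable (fun z => wirt (-I) (fun y => wirt I (β j) y k *
      (Real.exp (-Φ y) : ℂ)) z j * conj (β k z)) :=
    ((continuous_wirt _ ((hwβ _ j k).mul hE1) j).mul
      (hcβ k).continuous).integrable_of_hasCompactSupport ((hccβ k).mul_left)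
  have i2 : Integrable (fun z => wirt I (fun y => wirt (-I) (fun x => (Φ x : ℂ)) y j) z k *
      β j z * conj (β k z) * (Real.exp (-Φ z) : ℂ)) :=
    ((((continuous_wirt _ hwΦ k).mul (hβ1 j).continuous).mul (hcβ k).continuous).mul
      hE1.continuous).integrable_of_hasCompactSupport ((hccβ k).mul_left.mul_right)
  calc _ = ∫ z, wirt I (fun y => conj (β k y) * (Real.exp (-Φ y) : ℂ)) z k *
        wdel Φ (β j) z j := by
        refine integral_congr_ae (.of_forall fun z => ?_)
        simp only [← step1]; ring
    _ = - ∫ z, (conj (β k z) * (Real.exp (-Φ z) : ℂ)) *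
        wirt I (fun y => wdel Φ (β j) y j) z k :=
        integral_wirt_mul I ((hcβ k).mul hE1) hdel hdelc k
    _ = - ∫ z, (wirt (-I) (fun y => wirt I (β j) y k * (Real.exp (-Φ y) : ℂ)) z j *
          conj (β k z) - wirt I (fun y => wirt (-I) (fun x => (Φ x : ℂ)) y j) z k *
        β j z * conj (β k z) * (Real.exp (-Φ z) : ℂ)) := by
        congr 1
        refine integral_congr_ae (.of_forall fun z => ?_)
        simp only [← step3, step2]; ring
    _ = _ := by
        rw [integral_sub i1 i2, integral_wirt_mul _ ((hwβ _ j k).mul hE1) (hcβ k) (hccβ k)]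
        have : ∀ z, wirt (-I) (fun y => conj (β k y)) z j = conj (wirt I (β k) z j) := fun z => by
          rw [wirt_conj _ (hβd k z)]; simp
        simp only [this]
        rw [neg_sub, sub_neg_eq_add, add_comm]
        congr 1
        refine integral_congr_ae (.of_forall fun z => ?_)
        simp only
        ring

end Identity

lemma toLp_eq_sum (b : Fin n → ℂ) :
    (WithLp.toLp 2 b : Cn n) = ∑ j, ((b j).re • e n j + (b j).im • (I • e n j)) := by
  ext i
  have : ∀ j, (((b j).re • e n j + (b j).im • (I • e n j) : Cn n)) i =
      if i = j then b j else 0 := by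
    intro j
    simp only [e, PiLp.add_apply, PiLp.smul_apply, PiLp.single_apply, EuclideanSpace.single]
    split_ifs with h
    · simp
    · simp
  rw [WithLp.ofLp_sum, Finset.sum_apply]
  simp only [this]
  simp

lemma wirt_wirt_ofReal {Φ : Cn n → ℝ} {z : Cn n} (hΦ : ContDiffAt ℝ 2 Φ z) (s s' : ℂ)
    (j k : Fin n) :
    wirt s (fun y => wirt s' (fun x => (Φ x : ℂ)) y j) z k =
      (1 / 4) * (fderiv ℝ (fderiv ℝ Φ) z (e n k) (e n j) +
        s' * fderiv ℝ (fderiv ℝ Φ) z (e n k) (I • e n j) +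
        s * fderiv ℝ (fderiv ℝ Φ) z (I • e n k) (e n j) +
        s * s' * fderiv ℝ (fderiv ℝ Φ) z (I • e n k) (I • e n j)) := by
  have hd : DifferentiableAt ℝ (fderiv ℝ Φ) z :=
    (hΦ.fderiv_right (m := 1) (by norm_num)).differentiableAt one_ne_zero
  have hev : (fun y => wirt s' (fun x => (Φ x : ℂ)) y j) =ᶠ[nhds z] fun y =>
      (1 / 2 : ℂ) * ((fderiv ℝ Φ y (e n j) : ℂ) + s' * (fderiv ℝ Φ y (I • e n j) : ℂ)) := by
    filter_upwards [hΦ.eventually (by simp)] with y hy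
    have h1 : fderiv ℝ (fun y => (Φ y : ℂ)) y = ofRealCLM.comp (fderiv ℝ Φ y) :=
      (ofRealCLM.hasFDerivAt.comp y (hy.differentiableAt two_ne_zero).hasFDerivAt).fderiv
    simp [wirt, h1]
  have h1 : ∀ v : Cn n, HasFDerivAt (fun y => (fderiv ℝ Φ y v : ℂ))
      (ofRealCLM.comp ((fderiv ℝ (fderiv ℝ Φ) z).flip v)) z := fun v => by
    refine ofRealCLM.hasFDerivAt.comp z ?_
    simpa using hd.hasFDerivAt.clm_apply (hasFDerivAt_const v z)
  have h2 := (((h1 (e n j)).add ((h1 (I • e n j)).const_mul s')).const_mul (1 / 2 : ℂ)).fderiv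
  rw [wirt_congr hev, wirt]
  erw [h2]
  simp
  ring

lemma leviForm_toLp_eq {Φ : Cn n → ℝ} {z : Cn n} (hΦ : ContDiffAt ℝ 2 Φ z) (b : Fin n → ℂ) :
    LeviForm Φ z (WithLp.toLp 2 b) =
      (∑ j, ∑ k, wirt I (fun y => wirt (-I) (fun x => (Φ x : ℂ)) y j) z k * b j *
        conj (b k)).re := by
  have hsym : IsSymmSndFDerivAt ℝ Φ z := hΦ.isSymmSndFDerivAt (by simp)
  have hI : I • (WithLp.toLp 2 b : Cn n) = ∑ j, ((-(b j).im) • e n j + (b j).re • (I • e n j)) := by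
    have : I • (WithLp.toLp 2 b : Cn n) = WithLp.toLp 2 (fun j => I * b j) := by
      ext i; simp
    rw [this, toLp_eq_sum]
    simp
  simp only [LeviForm]
  rw [hI, toLp_eq_sum]
  simp only [map_sum, map_add, map_smul, sum_apply, add_apply, smul_apply, smul_eq_mul, re_sum,
    wirt_wirt_ofReal hΦ]
  simp only [Finset.mul_sum, ← Finset.sum_add_distrib]
  refine Finset.sum_congr rfl fun j _ => Finset.sum_congr rfl fun k _ => ?_
  rw [hsym.eq (e n k) (e n j), hsym.eq (e n k) (I • e n j), hsym.eq (I • e n k) (e n j),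
    hsym.eq (I • e n k) (I • e n j)]
  simp
  ring

lemma neg_half_norm_sub_sq_le_re_mul_conj (a b : ℂ) :
    -(1 / 2 * ‖a - b‖ ^ 2) ≤ (a * conj b).re := by
  rw [Complex.sq_norm, Complex.normSq_apply]
  simp only [sub_re, sub_im, mul_re, conj_re, conj_im]
  nlinarith [sq_nonneg a.re, sq_nonneg a.im, sq_nonneg b.re, sq_nonneg b.im]

/-- The Kohn–Hörmander basic estimate for compactly supported `(0,1)`-forms. -/
lemma integral_leviForm_le {Φ : Cn n → ℝ} {β : Fin n → Cn n → ℂ}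
    (hΦ : ContDiff ℝ 2 Φ) (hβ : ∀ j, ContDiff ℝ 2 (β j)) (hc : ∀ j, HasCompactSupport (β j)) :
    ∫ z, LeviForm Φ z (WithLp.toLp 2 fun j => β j z) * Real.exp (-Φ z) ≤
      ∫ z, (‖∑ j, wdel Φ (β j) z j‖ ^ 2 +
        1 / 2 * ∑ j, ∑ k, ‖wirt I (β j) z k - wirt I (β k) z j‖ ^ 2) * Real.exp (-Φ z) := by
  have hΦc := contDiff_ofReal_comp hΦ
  have hΦ1 : Continuous Φ := hΦ.continuous
  have hwΦ : ∀ j, ContDiff ℝ 1 (fun y => wirt (-I) (fun x => (Φ x : ℂ)) y j) := fun j =>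
    contDiff_one_wirt _ hΦc j
  have cw : ∀ s j k, Continuous (fun y => wirt s (β j) y k) := fun s j k =>
    (contDiff_one_wirt _ (hβ j) k).continuous
  have cb : ∀ j, Continuous (β j) := fun j => (hβ j).continuous
  have cdel : ∀ j, Continuous (fun z => wdel Φ (β j) z j) := fun j =>
    (cw _ j j).sub ((hwΦ j).continuous.mul (cb j))
  have sdel : ∀ j, HasCompactSupport (fun z => wdel Φ (β j) z j) := fun j =>
    (hasCompactSupport_wirt _ (hc j) j).sub ((hc j).mul_left)
  have sw : ∀ s j k, HasCompactSupport (fun z => wirt s (β j) z k) := fun s j k =>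
    hasCompactSupport_wirt s (hc j) k
  have cE : Continuous (fun z => (Real.exp (-Φ z) : ℂ)) := by fun_prop
  have clevi : ∀ j k, Continuous fun z =>
      wirt I (fun y => wirt (-I) (fun x => (Φ x : ℂ)) y j) z k := fun j k =>
    continuous_wirt _ (hwΦ j) k
  set A : Fin n → Fin n → Cn n → ℂ := fun j k z =>
    wdel Φ (β j) z j * conj (wdel Φ (β k) z k) * (Real.exp (-Φ z) : ℂ) with hA
  set B : Fin n → Fin n → Cn n → ℂ := fun j k z =>
    wirt I (β j) z k * conj (wirt I (β k) z j) * (Real.exp (-Φ z) : ℂ) with hB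
  set C : Fin n → Fin n → Cn n → ℂ := fun j k z =>
    wirt I (fun y => wirt (-I) (fun x => (Φ x : ℂ)) y j) z k * β j z * conj (β k z) *
        (Real.exp (-Φ z) : ℂ) with hC
  have iA : ∀ j k, Integrable (A j k) := fun j k =>
    (((cdel j).mul (continuous_conj.comp (cdel k))).mul cE).integrable_of_hasCompactSupport
      ((sdel j).mul_right.mul_right)
  have iB : ∀ j k, Integrable (B j k) := fun j k =>
    (((cw _ j k).mul (continuous_conj.comp (cw _ k j))).mul cE).integrable_of_hasCompactSupport
      ((sw _ j k).mul_right.mul_right)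
  have iC : ∀ j k, Integrable (C j k) := fun j k =>
    ((((clevi j k).mul (cb j)).mul
      (continuous_conj.comp (cb k))).mul cE).integrable_of_hasCompactSupport
      ((hc j).mul_left.mul_right.mul_right)
  have isum : ∀ {F : Fin n → Fin n → Cn n → ℂ}, (∀ j k, Integrable (F j k)) →
      Integrable (fun z => ∑ j, ∑ k, F j k z) := fun h =>
    integrable_finsetSum _ fun j _ => integrable_finsetSum _ fun k _ => h j k
  have esum : ∀ {F : Fin n → Fin n → Cn n → ℂ}, (∀ j k, Integrable (F j k)) →
      ∫ z, ∑ j, ∑ k, F j k z = ∑ j, ∑ k, ∫ z, F j k z := fun h => by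
    rw [integral_finsetSum _ fun j _ => integrable_finsetSum _ fun k _ => h j k]
    exact Finset.sum_congr rfl fun j _ => integral_finsetSum _ fun k _ => h j k
  have hid : ∫ z, ∑ j, ∑ k, A j k z = (∫ z, ∑ j, ∑ k, B j k z) + ∫ z, ∑ j, ∑ k, C j k z := by
    rw [esum iA, esum iB, esum iC, ← Finset.sum_add_distrib]
    refine Finset.sum_congr rfl fun j _ => ?_
    rw [← Finset.sum_add_distrib]
    exact Finset.sum_congr rfl fun k _ => integral_wdel_mul_conj_wdel hΦ hβ hc j k
  have hre := congrArg re hid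
  rw [add_re] at hre
  have ere : ∀ {F : Cn n → ℂ}, Integrable F → (∫ z, F z).re = ∫ z, (F z).re := fun h =>
    (reCLM.integral_comp_comm h).symm
  rw [ere (isum iA), ere (isum iB), ere (isum iC)] at hre
  have eC : ∀ z, (∑ j, ∑ k, C j k z).re =
      LeviForm Φ z (WithLp.toLp 2 fun j => β j z) * Real.exp (-Φ z) := fun z => by
    rw [leviForm_toLp_eq hΦ.contDiffAt, ← re_mul_ofReal]
    simp only [hC, Finset.sum_mul]
  have eA : ∀ z, (∑ j, ∑ k, A j k z).re = ‖∑ j, wdel Φ (β j) z j‖ ^ 2 * Real.exp (-Φ z) := by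
    intro z
    have : (‖∑ j, wdel Φ (β j) z j‖ ^ 2 : ℝ) =
        ((∑ j, wdel Φ (β j) z j) * conj (∑ j, wdel Φ (β j) z j)).re := by
      rw [mul_conj, ofReal_re, Complex.normSq_eq_norm_sq]
    rw [this, ← re_mul_ofReal, map_sum, Finset.sum_mul_sum]
    simp only [hA, Finset.sum_mul]
  have eB : ∀ z, -((1 / 2 * ∑ j, ∑ k, ‖wirt I (β j) z k - wirt I (β k) z j‖ ^ 2) *
      Real.exp (-Φ z)) ≤ (∑ j, ∑ k, B j k z).re := by
    intro z
    simp only [hB, re_sum, re_mul_ofReal]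
    simp only [← Finset.sum_mul]
    rw [← neg_mul]
    refine mul_le_mul_of_nonneg_right ?_ (Real.exp_nonneg _)
    simp only [Finset.mul_sum, ← Finset.sum_neg_distrib]
    exact Finset.sum_le_sum fun j _ => Finset.sum_le_sum fun k _ =>
      neg_half_norm_sub_sq_le_re_mul_conj _ _
  simp only [eC, eA] at hre
  have iD : Integrable fun z => (1 / 2 * ∑ j, ∑ k, ‖wirt I (β j) z k - wirt I (β k) z j‖ ^ 2) *
      Real.exp (-Φ z) := by
    simp only [Finset.mul_sum, Finset.sum_mul]
    refine integrable_finsetSum _ fun j _ => integrable_finsetSum _ fun k _ => ?_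
    have cd : Continuous fun z => wirt I (β j) z k - wirt I (β k) z j :=
      (cw _ j k).sub (cw _ k j)
    refine (by fun_prop : Continuous _).integrable_of_hasCompactSupport ?_
    refine HasCompactSupport.mul_right (HasCompactSupport.mul_left ?_)
    exact ((sw I j k).sub (sw I k j)).comp_left (g := fun x : ℂ => ‖x‖ ^ 2) (by simp)
  have hge := integral_mono iD.neg ((isum iB).re) eB
  have iA' : Integrable fun z => ‖∑ j, wdel Φ (β j) z j‖ ^ 2 * Real.exp (-Φ z) := by
    exact (isum iA).re.congr (.of_forall fun z => eA z)
  simp only [add_mul]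
  rw [integral_add iA' iD]
  simp only [Pi.neg_apply] at hge
  rw [integral_neg] at hge
  have e3 : ∫ z, RCLike.re (∑ j, ∑ k, B j k z) = ∫ z, (∑ j, ∑ k, B j k z).re := rfl
  linarith

section Mollifier

open Filter Topology ENNReal

lemma tendsto_lintegral_translate_sub_sq {b : Cn n → ℂ} (hb : MemLp b 2 volume) :
    Tendsto (fun y : Cn n => ∫⁻ x, ‖b (x - y) - b x‖ₑ ^ 2) (𝓝 0) (𝓝 0) := by
  have hmp : ∀ y : Cn n, MeasurePreserving (fun x : Cn n => x - y) volume volume := fun y =>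
    measurePreserving_sub_right volume y
  let g : C(Cn n, C(Cn n, Cn n)) := (ContinuousMap.mk (fun a : Cn n × Cn n => a.2 - a.1)
    (continuous_snd.sub continuous_fst)).curry
  set F : Lp ℂ 2 (volume : Measure (Cn n)) := hb.toLp b with hF
  have h1 : Continuous fun y : Cn n => Lp.compMeasurePreserving (g y) (hmp y) F - F :=
    ((continuous_const (y := F)).compMeasurePreservingLp g.continuous hmp (by norm_num)).sub
      continuous_const
  have e1 : ∀ y, Lp.compMeasurePreserving (g y) (hmp y) F - F =
      ((hb.comp_measurePreserving (hmp y)).sub hb).toLp _ := fun y => by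
    rw [MemLp.toLp_sub (hb.comp_measurePreserving (hmp y)) hb, hF]
    rfl
  have h2 : ∀ y, ‖Lp.compMeasurePreserving (g y) (hmp y) F - F‖ₑ ^ 2 =
      ∫⁻ x, ‖b (x - y) - b x‖ₑ ^ 2 := fun y => by
    rw [e1, Lp.enorm_toLp, eLpNorm_eq_lintegral_rpow_enorm_toReal (by norm_num) (by norm_num)]
    simp only [toReal_ofNat, one_div, ← ENNReal.rpow_natCast]
    rw [← ENNReal.rpow_mul]
    norm_num
  have h3 := ((ENNReal.continuous_pow 2).comp h1.enorm).tendsto 0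
  simp only [Function.comp_def, h2] at h3
  simpa using h3

/-- A sequence of smooth bumps shrinking to the origin. -/
def bump (n i : ℕ) : ContDiffBump (0 : Cn n) where
  rIn := 1 / (2 * (i + 1))
  rOut := 1 / (i + 1)
  rIn_pos := by positivity
  rIn_lt_rOut := by
    apply one_div_lt_one_div_of_lt <;> linarith [Nat.cast_nonneg (α := ℝ) i]

/-- A sequence of normalized smooth kernels shrinking to the origin. -/
def mker (i : ℕ) (x : Cn n) : ℝ := (bump n i).normed volume x

/-- Convolution of a kernel with a function. -/
def cv (K b : Cn n → ℂ) (x : Cn n) : ℂ := ∫ y, K (x - y) * b y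

/-- Mollification. -/
def moll (i : ℕ) (b : Cn n → ℂ) : Cn n → ℂ := cv (fun x => (mker i x : ℂ)) b

lemma contDiff_mker (i : ℕ) {m : ℕ∞} : ContDiff ℝ m (mker (n := n) i) :=
  (bump n i).contDiff_normed

lemma contDiff_ofReal_mker (i : ℕ) {m : ℕ∞} :
    ContDiff ℝ m (fun x : Cn n => (mker i x : ℂ)) := contDiff_ofReal_comp (contDiff_mker i)

lemma hasCompactSupport_mker (i : ℕ) : HasCompactSupport (mker (n := n) i) :=
  (bump n i).hasCompactSupport_normed

lemma hasCompactSupport_ofReal_mker (i : ℕ) :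
    HasCompactSupport (fun x : Cn n => (mker i x : ℂ)) :=
  (hasCompactSupport_mker i).comp_left (g := fun x : ℝ => (x : ℂ)) (by simp)

lemma mker_nonneg (i : ℕ) (x : Cn n) : 0 ≤ mker i x := (bump n i).nonneg_normed x

lemma integral_mker (i : ℕ) : ∫ x : Cn n, mker i x = 1 := (bump n i).integral_normed

lemma mker_eq_zero {i : ℕ} {x : Cn n} (h : 1 / ((i : ℝ) + 1) ≤ ‖x‖) : mker i x = 0 := by
  have : x ∉ Function.support (mker (n := n) i) := by
    rw [show Function.support (mker (n := n) i) = _ from (bump n i).support_normed_eq]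
    simpa [bump] using h
  simpa using this

lemma cv_eq_convolution (K b : Cn n → ℂ) :
    cv K b = convolution K b (ContinuousLinearMap.mul ℝ ℂ) volume := by
  ext x
  rw [convolution_eq_swap]
  rfl

lemma integrable_cv {K b : Cn n → ℂ} (hK : Continuous K) (hKc : HasCompactSupport K)
    (hb : LocallyIntegrable b) (x : Cn n) : Integrable fun y => K (x - y) * b y := by
  have h := (hKc.convolutionExists_left (ContinuousLinearMap.mul ℝ ℂ) hK hb x).integrable_swap
  exact h

lemma contDiff_cv {K b : Cn n → ℂ} {m : ℕ∞} (hK : ContDiff ℝ m K) (hKc : HasCompactSupport K)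
    (hb : LocallyIntegrable b) : ContDiff ℝ m (cv K b) := by
  rw [cv_eq_convolution]
  exact hKc.contDiff_convolution_left _ hK hb

lemma wirt_cv (s : ℂ) {K b : Cn n → ℂ} (hK : ContDiff ℝ 1 K) (hKc : HasCompactSupport K)
    (hb : LocallyIntegrable b) (x : Cn n) (j : Fin n) :
    wirt s (cv K b) x j = cv (fun y => wirt s K y j) b x := by
  have h := hKc.hasFDerivAt_convolution_left (ContinuousLinearMap.mul ℝ ℂ) hK hb x
  have hc := (hKc.fderiv ℝ).convolutionExists_left
    ((ContinuousLinearMap.mul ℝ ℂ).precompL (Cn n)) (hK.continuous_fderiv one_ne_zero) hb x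
  have key : ∀ u, fderiv ℝ (cv K b) x u = ∫ y, fderiv ℝ K (x - y) u * b y := fun u => by
    rw [cv_eq_convolution, h.fderiv, convolution_eq_swap,
      ContinuousLinearMap.integral_apply hc.integrable_swap]
    rfl
  have ic : ∀ u, Integrable fun y => fderiv ℝ K (x - y) u * b y := fun u =>
    integrable_cv (K := fun y => fderiv ℝ K y u)
      ((hK.continuous_fderiv one_ne_zero).clm_apply continuous_const)
      (hKc.fderiv_apply (𝕜 := ℝ) u) hb x
  simp only [cv, wirt.eq_1 s (cv K b), key]
  rw [← integral_const_mul, ← integral_add (ic _) ((ic _).const_mul _), ← integral_const_mul]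
  refine integral_congr_ae (.of_forall fun y => ?_)
  simp only [wirt]
  ring

lemma wirt_comp_sub_left (s : ℂ) {K : Cn n → ℂ} (hK : Differentiable ℝ K) (x y : Cn n)
    (j : Fin n) : wirt s (fun y => K (x - y)) y j = - wirt s K (x - y) j := by
  have h : fderiv ℝ (fun y => K (x - y)) y = -fderiv ℝ K (x - y) := by
    have h1 : HasFDerivAt (fun y => x - y) (-ContinuousLinearMap.id ℝ (Cn n)) y :=
      (hasFDerivAt_id y).const_sub x
    have h2 : HasFDerivAt (fun y => K (x - y))
        ((fderiv ℝ K (x - y)).comp (-ContinuousLinearMap.id ℝ (Cn n))) y :=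
      (hK (x - y)).hasFDerivAt.comp y h1
    rw [h2.fderiv]
    ext; simp
  simp only [wirt, h, neg_apply]
  ring

/-- The probability measure with density `mker i`. -/
def mmeas (n i : ℕ) : Measure (Cn n) := volume.withDensity fun y => ENNReal.ofReal (mker i y)

instance (i : ℕ) : IsProbabilityMeasure (mmeas n i) := ⟨by
  rw [mmeas, withDensity_apply _ .univ, Measure.restrict_univ,
    ← ofReal_integral_eq_lintegral_ofReal
      ((contDiff_mker i (m := 0)).continuous.integrable_of_hasCompactSupport
        (hasCompactSupport_mker i)) (.of_forall (mker_nonneg i)), integral_mker]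
  simp⟩

lemma measurable_mker (i : ℕ) : Measurable (mker (n := n) i) :=
  (contDiff_mker i (m := 0)).continuous.measurable

lemma integrable_mmeas {b : Cn n → ℂ} (hb : LocallyIntegrable b) (i : ℕ) (x : Cn n) :
    Integrable (fun y => b (x - y)) (mmeas n i) := by
  rw [mmeas, integrable_withDensity_iff_integrable_smul' (measurable_mker i).ennreal_ofReal
    (.of_forall fun _ => ENNReal.ofReal_lt_top)]
  have h := (integrable_cv (contDiff_ofReal_mker i (m := 0)).continuous
    (hasCompactSupport_ofReal_mker i) hb x).comp_sub_left x
  refine h.congr (.of_forall fun y => ?_)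
  simp [ENNReal.toReal_ofReal (mker_nonneg i y)]

lemma moll_eq_integral (i : ℕ) (b : Cn n → ℂ) (x : Cn n) :
    moll i b x = ∫ y, b (x - y) ∂(mmeas n i) := by
  rw [mmeas, integral_withDensity_eq_integral_toReal_smul (measurable_mker i).ennreal_ofReal
    (.of_forall fun _ => ENNReal.ofReal_lt_top), moll, cv,
    ← integral_sub_left_eq_self _ volume x]
  refine integral_congr_ae (.of_forall fun y => ?_)
  simp [ENNReal.toReal_ofReal (mker_nonneg i y)]

lemma moll_sub_eq_integral (i : ℕ) {b : Cn n → ℂ} (hb : LocallyIntegrable b) (x : Cn n) :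
    moll i b x - b x = ∫ y, (b (x - y) - b x) ∂(mmeas n i) := by
  rw [integral_sub (integrable_mmeas hb i x) (integrable_const _), moll_eq_integral]
  simp

lemma ae_mmeas_norm_lt (n i : ℕ) : ∀ᵐ y ∂(mmeas n i), ‖y‖ < 1 / ((i : ℝ) + 1) := by
  rw [mmeas, ae_withDensity_iff (measurable_mker i).ennreal_ofReal]
  refine .of_forall fun y hy => ?_
  by_contra h
  exact hy (by rw [mker_eq_zero (not_lt.1 h)]; simp)

lemma enorm_moll_sub_sq_le (i : ℕ) {b : Cn n → ℂ} (hb : LocallyIntegrable b) (x : Cn n) :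
    ‖moll i b x - b x‖ₑ ^ 2 ≤ ∫⁻ y, ‖b (x - y) - b x‖ₑ ^ 2 ∂(mmeas n i) := by
  rw [moll_sub_eq_integral i hb]
  have h1 := enorm_integral_le_lintegral_enorm (μ := mmeas n i) fun y => b (x - y) - b x
  rw [← eLpNorm_one_eq_lintegral_enorm] at h1
  have h2 := h1.trans (eLpNorm_le_eLpNorm_of_exponent_le (p := 1) (q := 2) (by norm_num)
    ((integrable_mmeas hb i x).sub (integrable_const _)).1)
  rw [eLpNorm_eq_lintegral_rpow_enorm_toReal (by norm_num) (by norm_num)] at h2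
  have h3 := pow_le_pow_left' h2 2
  refine h3.trans (le_of_eq ?_)
  simp only [toReal_ofNat, one_div, ← ENNReal.rpow_natCast]
  rw [← ENNReal.rpow_mul]
  norm_num

lemma tendsto_lintegral_moll_sub_sq {b : Cn n → ℂ} (hb : MemLp b 2 volume) :
    Tendsto (fun i => ∫⁻ x, ‖moll i b x - b x‖ₑ ^ 2) atTop (𝓝 0) := by
  have hbl : LocallyIntegrable b := hb.locallyIntegrable (by norm_num)
  have hae : ∀ i, AEMeasurable (fun p : Cn n × Cn n => ‖b (p.1 - p.2) - b p.1‖ₑ ^ 2)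
      (volume.prod (mmeas n i)) := fun i => by
    have hac : (volume : Measure (Cn n)).prod (mmeas n i) ≪ volume.prod volume :=
      Measure.AbsolutelyContinuous.rfl.prod (withDensity_absolutelyContinuous _ _)
    have h1 : AEStronglyMeasurable (fun p : Cn n × Cn n => b (p.1 - p.2))
        (volume.prod (mmeas n i)) :=
      (hb.1.comp_quasiMeasurePreserving
        (quasiMeasurePreserving_sub_of_right_invariant volume volume)).mono_ac hac
    exact ((h1.sub hb.1.comp_fst).enorm).pow_const 2
  refine ENNReal.tendsto_nhds_zero.2 fun ε hε => ?_
  obtain ⟨δ, hδ, hball⟩ := Metric.eventually_nhds_iff.1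
    (ENNReal.tendsto_nhds_zero.1 (tendsto_lintegral_translate_sub_sq hb) ε hε)
  filter_upwards [tendsto_one_div_add_atTop_nhds_zero_nat.eventually (gt_mem_nhds hδ)] with i hi
  calc _ ≤ ∫⁻ x, ∫⁻ y, ‖b (x - y) - b x‖ₑ ^ 2 ∂(mmeas n i) :=
        lintegral_mono fun x => enorm_moll_sub_sq_le i hbl x
    _ = ∫⁻ y, (∫⁻ x, ‖b (x - y) - b x‖ₑ ^ 2) ∂(mmeas n i) := lintegral_lintegral_swap (hae i)
    _ ≤ ∫⁻ _, ε ∂(mmeas n i) := lintegral_mono_ae (by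
        filter_upwards [ae_mmeas_norm_lt n i] with y hy
        exact hball (by simpa using hy.trans hi))
    _ = ε := by simp

lemma wirt_moll (s : ℂ) (i : ℕ) {b : Cn n → ℂ} (hb : LocallyIntegrable b) (x : Cn n)
    (j : Fin n) :
    wirt s (moll i b) x j = -∫ y, b y * wirt s (fun y => (mker i (x - y) : ℂ)) y j := by
  rw [moll, wirt_cv s (contDiff_ofReal_mker i (m := 1)) (hasCompactSupport_ofReal_mker i) hb,
    cv, ← integral_neg]
  refine integral_congr_ae (.of_forall fun y => ?_)
  simp only [wirt_comp_sub_left s (K := fun x => (mker i x : ℂ))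
    ((contDiff_ofReal_mker i (m := 1)).differentiable one_ne_zero)]
  ring

lemma moll_eq_zero {i : ℕ} {b : Cn n → ℂ} {x : Cn n}
    (h : ∀ y, ‖x - y‖ < 1 / ((i : ℝ) + 1) → b y = 0) : moll i b x = 0 := by
  refine integral_eq_zero_of_ae (.of_forall fun y => ?_)
  by_cases hy : ‖x - y‖ < 1 / ((i : ℝ) + 1)
  · simp [h y hy]
  · simp [mker_eq_zero (not_lt.1 hy)]

end Mollifier

/-- `C^m` functions compactly supported in `Ω`. -/
structure CTest (m : WithTop ℕ∞) (Ω : Set (Cn n)) (t : Cn n → ℂ) : Prop where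
  contDiff : ContDiff ℝ m t
  compact : HasCompactSupport t
  subset : tsupport t ⊆ Ω

namespace CTest

variable {m : WithTop ℕ∞} {Ω : Set (Cn n)} {t : Cn n → ℂ}

lemma of_le {m' : WithTop ℕ∞} (ht : CTest m Ω t) (h : m' ≤ m) : CTest m' Ω t :=
  ⟨ht.contDiff.of_le h, ht.compact, ht.subset⟩

lemma mono {Ω' : Set (Cn n)} (ht : CTest m Ω t) (h : Ω ⊆ Ω') : CTest m Ω' t :=
  ⟨ht.contDiff, ht.compact, ht.subset.trans h⟩

lemma continuous (ht : CTest m Ω t) : Continuous t := ht.contDiff.continuous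

lemma eq_zero (ht : CTest m Ω t) {z : Cn n} (hz : z ∉ Ω) : t z = 0 :=
  image_eq_zero_of_notMem_tsupport fun h => hz (ht.subset h)

lemma zero : CTest m Ω (0 : Cn n → ℂ) :=
  ⟨contDiff_const, HasCompactSupport.zero, by simp [tsupport]⟩

lemma star (ht : CTest m Ω t) : CTest m Ω (fun z => conj (t z)) :=
  ⟨contDiff_conj_comp ht.contDiff, hasCompactSupport_conj_comp ht.compact,
    (tsupport_comp_subset (map_zero (starRingEnd ℂ)) t).trans ht.subset⟩

lemma add {t' : Cn n → ℂ} (ht : CTest m Ω t) (ht' : CTest m Ω t') :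
    CTest m Ω (fun z => t z + t' z) :=
  ⟨ht.contDiff.add ht'.contDiff, ht.compact.add ht'.compact,
    (tsupport_add t t').trans (union_subset ht.subset ht'.subset)⟩

lemma mul_contDiffOn (ht : CTest m Ω t) (hΩ : IsOpen Ω) {F : Cn n → ℂ} (hF : ContDiffOn ℝ m F Ω) :
    CTest m Ω (fun z => t z * F z) := by
  have hsub : tsupport (fun z => t z * F z) ⊆ tsupport t := tsupport_mul_subset_left
  refine ⟨contDiff_iff_contDiffAt.2 fun z => ?_, ht.compact.mul_right, hsub.trans ht.subset⟩
  by_cases hz : z ∈ Ω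
  · exact ht.contDiff.contDiffAt.mul (hF.contDiffAt (hΩ.mem_nhds hz))
  · have h1 : (tsupport t)ᶜ ∈ nhds z :=
      (isClosed_tsupport t).isOpen_compl.mem_nhds fun h => hz (ht.subset h)
    refine (contDiffAt_const (c := (0 : ℂ))).congr_of_eventuallyEq ?_
    filter_upwards [h1] with y hy
    simp [image_eq_zero_of_notMem_tsupport hy]

lemma wirt {m : ℕ∞} (ht : CTest (m + 1) Ω t) (s : ℂ) (j : Fin n) :
    CTest m Ω (fun z => wirt s t z j) :=
  ⟨contDiff_wirt s ht.contDiff j, hasCompactSupport_wirt s ht.compact j,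
    (tsupport_wirt_subset s t j).trans ht.subset⟩

lemma wirt_one (ht : CTest 2 Ω t) (s : ℂ) (j : Fin n) :
    CTest 1 Ω (fun z => _root_.wirt s t z j) :=
  CTest.wirt (m := 1) (by simpa [one_add_one_eq_two] using ht) s j

lemma wirt_zero (ht : CTest 1 Ω t) (s : ℂ) (j : Fin n) :
    CTest 0 Ω (fun z => _root_.wirt s t z j) :=
  CTest.wirt (m := 0) (by simpa using ht) s j

lemma integrable_mul (ht : CTest m Ω t) {v : Cn n → ℂ} (hv : LocallyIntegrableOn v Ω) :
    Integrable fun z => v z * t z := by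
  have h1 : IntegrableOn v (tsupport t) := hv.integrableOn_compact_subset ht.subset ht.compact
  have h2 := h1.mul_continuousOn ht.continuous.continuousOn ht.compact
  refine (integrableOn_iff_integrable_of_support_subset ?_).1 h2
  exact (Function.support_mul_subset_right v t).trans (subset_tsupport t)

lemma setIntegral_mul (ht : CTest m Ω t) (v : Cn n → ℂ) :
    ∫ z in Ω, v z * t z = ∫ z, v z * t z :=
  setIntegral_eq_integral_of_forall_compl_eq_zero fun z hz => by simp [ht.eq_zero hz]

end CTest

section Extension

open Filter Topology

variable {Ω : Set (Cn n)}

lemma wirt_moll_of_contDiff (s : ℂ) (i : ℕ) {t : Cn n → ℂ} (ht : ContDiff ℝ 1 t) (x : Cn n)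
    (j : Fin n) : wirt s (moll i t) x j = moll i (fun y => wirt s t y j) x := by
  rw [wirt_moll s i ht.continuous.locallyIntegrable]
  have hK : ContDiff ℝ 1 (fun y : Cn n => (mker i (x - y) : ℂ)) :=
    (contDiff_ofReal_mker i (m := 1)).comp (contDiff_const.sub contDiff_id)
  have hKc : HasCompactSupport (fun y : Cn n => (mker i (x - y) : ℂ)) :=
    (hasCompactSupport_ofReal_mker i).comp_homeomorph (Homeomorph.subLeft x)
  rw [← integral_wirt_mul s ht hK hKc]
  simp only [moll, cv, mul_comm]

lemma tendsto_moll {t : Cn n → ℂ} (ht : Continuous t) (x : Cn n) :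
    Tendsto (fun i => moll i t x) atTop (𝓝 (t x)) := by
  have h := ContDiffBump.convolution_tendsto_right_of_continuous (φ := bump n) (l := atTop)
    (μ := volume) (g := t)
    (by simpa [bump] using tendsto_one_div_add_atTop_nhds_zero_nat (𝕜 := ℝ)) ht x
  refine h.congr fun i => ?_
  rw [convolution_lsmul_swap]
  simp [moll, cv, mker]

lemma norm_moll_le {t : Cn n → ℂ} {M : ℝ} (h : ∀ x, ‖t x‖ ≤ M) (i : ℕ) (x : Cn n) :
    ‖moll i t x‖ ≤ M := by
  rw [moll_eq_integral]
  simpa using norm_integral_le_of_norm_le_const (μ := mmeas n i) (f := fun y => t (x - y))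
    (.of_forall fun y => h _)

lemma exists_forall_tsupport_moll_subset (hΩ : IsOpen Ω) {t : Cn n → ℂ} (ht : CTest 0 Ω t) :
    ∃ K, IsCompact K ∧ K ⊆ Ω ∧ ∀ᶠ i : ℕ in atTop, ∀ x, x ∉ K → moll i t x = 0 := by
  obtain ⟨δ, hδ, hsub⟩ := ht.compact.exists_cthickening_subset_open hΩ ht.subset
  refine ⟨_, ht.compact.cthickening, hsub, ?_⟩
  filter_upwards [tendsto_one_div_add_atTop_nhds_zero_nat.eventually (gt_mem_nhds hδ)]
    with i hi x hx
  refine moll_eq_zero fun y hy => ?_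
  by_contra hty
  refine hx (mem_cthickening_of_dist_le x y δ _ (subset_tsupport _ hty) ?_)
  rw [dist_eq_norm]
  exact (hy.trans hi).le

/-- A weak `∂̄` equation tested against smooth functions can be tested against `C¹` functions. -/
lemma DbarEqOn.integral_mul_wirt (hΩ : IsOpen Ω) {v : Cn n → ℂ} {g : Cn n → Fin n → ℂ}
    (h : DbarEqOn Ω v g) (hv : LocallyIntegrableOn v Ω)
    (hg : ∀ j, LocallyIntegrableOn (fun z => g z j) Ω) {t : Cn n → ℂ} (ht : CTest 1 Ω t)
    (j : Fin n) : ∫ z, v z * wirt I t z j = -∫ z, g z j * t z := by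
  have conv : ∀ {w : Cn n → ℂ}, LocallyIntegrableOn w Ω → ∀ {t : Cn n → ℂ}, CTest 0 Ω t →
      Tendsto (fun i => ∫ z, w z * moll i t z) atTop (𝓝 (∫ z, w z * t z)) := by
    intro w hw t ht
    obtain ⟨K, hK, hKΩ, hev⟩ := exists_forall_tsupport_moll_subset hΩ ht
    obtain ⟨M, hM⟩ := ht.compact.exists_bound_of_continuous ht.continuous
    have hwK : IntegrableOn w K := hw.integrableOn_compact_subset hKΩ hK
    have hwi : Integrable (K.indicator w) := (integrable_indicator_iff hK.measurableSet).2 hwK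
    have hzero : ∀ x, x ∉ K → t x = 0 := fun x hx =>
      tendsto_nhds_unique (tendsto_moll ht.continuous x)
        (tendsto_const_nhds.congr' (by filter_upwards [hev] with i hi using (hi x hx).symm))
    have e1 : ∫ z, w z * t z = ∫ z, K.indicator w z * t z := by
      congr 1; ext z
      by_cases hz : z ∈ K <;> simp [hz, hzero]
    rw [e1]
    have e2 : ∀ᶠ i in atTop, ∫ z, K.indicator w z * moll i t z = ∫ z, w z * moll i t z := by
      filter_upwards [hev] with i hi
      congr 1; ext z
      by_cases hz : z ∈ K <;> simp [hz, hi]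
    refine Tendsto.congr' e2 ?_
    refine tendsto_integral_of_dominated_convergence (fun z => ‖K.indicator w z‖ * M)
      (fun i => hwi.1.mul ?_) (hwi.norm.mul_const M) (fun i => .of_forall fun z => ?_)
      (.of_forall fun z => tendsto_const_nhds.mul (tendsto_moll ht.continuous z))
    · exact (contDiff_cv (contDiff_ofReal_mker i (m := 0)) (hasCompactSupport_ofReal_mker i)
        ht.continuous.locallyIntegrable).continuous.aestronglyMeasurable
    · rw [norm_mul]
      exact mul_le_mul_of_nonneg_left (norm_moll_le hM i z) (norm_nonneg _)
  have h1 := conv hv (ht.wirt_zero I j)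
  have h2 := (conv (hg j) (ht.of_le zero_le_one)).neg
  refine tendsto_nhds_unique (h1.congr' ?_) h2
  obtain ⟨K, hK, hKΩ, hev⟩ := exists_forall_tsupport_moll_subset hΩ (ht.of_le zero_le_one)
  filter_upwards [hev] with i hi
  have hsupp : tsupport (moll i t) ⊆ K := closure_minimal
    (fun z hz => by_contra fun hzK => hz (hi z hzK)) hK.isClosed
  have htest : CTest ((⊤ : ℕ∞) : WithTop ℕ∞) Ω (moll i t) :=
    ⟨contDiff_cv (contDiff_ofReal_mker i) (hasCompactSupport_ofReal_mker i)
      ht.continuous.locallyIntegrable, hK.of_isClosed_subset isClosed_closure hsupp,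
      hsupp.trans hKΩ⟩
  have := h (moll i t) ⟨htest.contDiff, htest.compact, htest.subset⟩ j
  rw [htest.setIntegral_mul] at this
  simp only [dbar_eq_wirt, wirt_moll_of_contDiff I i ht.contDiff] at this
  rw [← this]
  refine (setIntegral_eq_integral_of_forall_compl_eq_zero fun z hz => ?_).symm
  rw [← wirt_moll_of_contDiff I i ht.contDiff, wirt_eq_zero_of_notMem_tsupport
    fun hz' => hz (htest.subset hz'), mul_zero]

end Extension

lemma memLp_two_restrict_of_integrableOn {E : Type*} [NormedAddCommGroup E] {Ω K : Set (Cn n)}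
    {w : Cn n → ℝ} {v : Cn n → E}
    (hv : AEStronglyMeasurable v (volume.restrict Ω))
    (hvi : IntegrableOn (fun z => ‖v z‖ ^ 2 * Real.exp (-w z)) Ω) (hw : ContinuousOn w Ω)
    (hK : IsCompact K) (hKΩ : K ⊆ Ω) : MemLp v 2 (volume.restrict K) := by
  rw [memLp_two_iff_integrable_sq_norm (hv.mono_set hKΩ)]
  have h1 := (hvi.mono_set hKΩ).mul_continuousOn (g' := fun z => Real.exp (w z))
    (Real.continuous_exp.comp_continuousOn (hw.mono hKΩ)) hK
  refine h1.congr_fun (fun z _ => ?_) hK.measurableSet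
  simp [mul_assoc, ← Real.exp_add]

lemma locallyIntegrableOn_of_integrableOn {E : Type*} [NormedAddCommGroup E] {Ω : Set (Cn n)}
    {w : Cn n → ℝ} {v : Cn n → E}
    (hΩ : IsOpen Ω) (hv : AEStronglyMeasurable v (volume.restrict Ω))
    (hvi : IntegrableOn (fun z => ‖v z‖ ^ 2 * Real.exp (-w z)) Ω) (hw : ContinuousOn w Ω) :
    LocallyIntegrableOn v Ω := by
  rw [locallyIntegrableOn_iff hΩ.isLocallyClosed]
  intro K hKΩ hK
  have : IsFiniteMeasure (volume.restrict K : Measure (Cn n)) := ⟨by simpa using hK.measure_lt_top⟩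
  exact (memLp_two_restrict_of_integrableOn hv hvi hw hK hKΩ).integrable
    (by norm_num)

lemma differentiableAt_complex_of_wirt_eq_zero {f : Cn n → ℂ} {z : Cn n}
    (hf : DifferentiableAt ℝ f z) (h : ∀ j, wirt I f z j = 0) : DifferentiableAt ℂ f z := by
  have hI : ∀ j, fderiv ℝ f z (I • e n j) = I * fderiv ℝ f z (e n j) := fun j => by
    have := h j
    rw [wirt] at this
    have h2 : fderiv ℝ f z (e n j) + I * fderiv ℝ f z (I • e n j) = 0 := by simpa using this
    linear_combination (-I) * h2 + (fderiv ℝ f z (I • e n j)) * I_mul_I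
  let A : Cn n →L[ℂ] ℂ := ∑ j, (fderiv ℝ f z (e n j)) • (EuclideanSpace.proj j : Cn n →L[ℂ] ℂ)
  refine (hasFDerivAt_of_restrictScalars ℝ (f' := A) hf.hasFDerivAt ?_).differentiableAt
  ext w
  have hw : w = ∑ j, ((w j).re • e n j + (w j).im • (I • e n j)) := toLp_eq_sum (fun j => w j)
  conv_rhs => rw [hw]
  simp only [map_sum, map_add, map_smul, hI]
  simp only [A, ContinuousLinearMap.coe_restrictScalars', sum_apply, smul_apply,
    PiLp.proj_apply, smul_eq_mul, real_smul]
  refine Finset.sum_congr rfl fun j _ => ?_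
  conv_lhs => rw [← re_add_im (w j)]
  ring

lemma circleAverage_comp_sub_smul {h : Cn n → ℂ} {z y : Cn n} {r : ℝ}
    (hh : DifferentiableOn ℂ h (ball z r)) (hy : ‖y‖ < r) :
    Real.circleAverage (fun ζ : ℂ => h (z - ζ • y)) 0 1 = h z := by
  have hd : DifferentiableOn ℂ (fun ζ : ℂ => h (z - ζ • y)) (closure (ball 0 |1|)) := by
    refine hh.comp (by fun_prop) fun ζ hζ => ?_
    rw [closure_ball _ (by norm_num)] at hζ
    have hζ' : ‖ζ‖ ≤ 1 := by simpa using hζ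
    simp only [mem_ball, dist_self_sub_left, norm_smul]
    nlinarith [norm_nonneg y]
  simpa using hd.diffContOnCl.circleAverage

lemma integral_radial_mul {κ : Cn n → ℝ} {h : Cn n → ℂ} {z : Cn n} {r : ℝ}
    (hκ : Continuous κ) (hκc : HasCompactSupport κ)
    (hκr : ∀ y, r ≤ ‖y‖ → κ y = 0) (hκi : ∀ (c : ℂ) y, ‖c‖ = 1 → κ (c • y) = κ y)
    (hh : Continuous h) (hd : DifferentiableOn ℂ h (ball z r)) :
    ∫ y, (κ y : ℂ) * h (z - y) = (∫ y, κ y) * h z := by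
  have rot : ∀ c : ℂ, ‖c‖ = 1 →
      ∫ y, (κ y : ℂ) * h (z - c • y) = ∫ y, (κ y : ℂ) * h (z - y) := by
    intro c hc
    have hmp : MeasurePreserving (fun y : Cn n => c • y) volume volume := by
      let L : Cn n ≃ₗᵢ[ℝ] Cn n :=
        { LinearEquiv.smulOfNeZero ℂ (Cn n) c (by rintro rfl; simp at hc) |>.restrictScalars ℝ with
          norm_map' := fun y => by simp [norm_smul, hc] }
      exact L.measurePreserving
    have hme : MeasurableEmbedding (fun y : Cn n => c • y) :=
      measurableEmbedding_const_smul₀ (by rintro rfl; simp at hc)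
    rw [← hmp.integral_comp hme (fun y => (κ y : ℂ) * h (z - y))]
    simp [hκi c _ hc]
  have hint_eq : Integrable (Function.uncurry fun (θ : ℝ) (y : Cn n) =>
      (κ y : ℂ) * h (z - circleMap 0 1 θ • y))
      ((volume.restrict (uIoc 0 (2 * Real.pi))).prod volume) := by
    have hc : Continuous (Function.uncurry fun (θ : ℝ) (y : Cn n) =>
        (κ y : ℂ) * h (z - circleMap 0 1 θ • y)) := by
      have := continuous_circleMap 0 1
      unfold Function.uncurry
      fun_prop
    have hK : IsCompact (uIcc 0 (2 * Real.pi) ×ˢ tsupport κ) := isCompact_uIcc.prod hκc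
    have h1 := hc.continuousOn.integrableOn_compact (μ := volume.prod volume) hK
    have h2 : IntegrableOn (Function.uncurry fun (θ : ℝ) (y : Cn n) =>
        (κ y : ℂ) * h (z - circleMap 0 1 θ • y)) (uIcc 0 (2 * Real.pi) ×ˢ univ)
        (volume.prod volume) := by
      refine h1.of_forall_sdiff_eq_zero (measurableSet_uIcc.prod .univ) ?_
      rintro ⟨θ, y⟩ ⟨⟨h1, -⟩, h2⟩
      have : κ y = 0 := image_eq_zero_of_notMem_tsupport fun h => h2 ⟨h1, h⟩
      simp [this]
    have h3 := h2.mono_set (prod_mono_left uIoc_subset_uIcc)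
    rwa [IntegrableOn, ← Measure.prod_restrict, Measure.restrict_univ] at h3
  have hsw := intervalIntegral_integral_swap (μ := volume) hint_eq
  have e1 : ∀ θ : ℝ, ∫ y, (κ y : ℂ) * h (z - circleMap 0 1 θ • y) =
      ∫ y, (κ y : ℂ) * h (z - y) := fun θ => rot _ (by simp)
  simp only [e1, intervalIntegral.integral_const] at hsw
  have e2 : ∀ y, ∫ θ in 0..2 * Real.pi, (κ y : ℂ) * h (z - circleMap 0 1 θ • y) =
      (2 * Real.pi) • ((κ y : ℂ) * h z) := by
    intro y
    rw [intervalIntegral.integral_const_mul]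
    by_cases hy : r ≤ ‖y‖
    · simp [hκr y hy]
    · have := circleAverage_comp_sub_smul hd (not_le.1 hy)
      rw [Real.circleAverage_def, inv_smul_eq_iff₀ (by positivity)] at this
      rw [this, mul_smul_comm]
  simp only [e2, integral_smul, sub_zero] at hsw
  have h3 := smul_right_injective ℂ (r := 2 * Real.pi) (by positivity) hsw
  rw [h3, integral_mul_const]
  congr 1
  exact integral_ofReal

/-- A normalized smooth radial kernel supported in the ball of radius `r`. -/
lemma exists_radial_kernel (n : ℕ) {r : ℝ} (hr : 0 < r) : ∃ κ : Cn n → ℝ,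
    (∀ m : ℕ∞, ContDiff ℝ m κ) ∧ HasCompactSupport κ ∧ (∀ y, r ≤ ‖y‖ → κ y = 0) ∧
    (∀ (c : ℂ) y, ‖c‖ = 1 → κ (c • y) = κ y) ∧ ∫ y, κ y = 1 := by
  let κ₀ : Cn n → ℝ := fun y => Real.smoothTransition (1 - ‖y‖ ^ 2 / r ^ 2)
  have hs : ∀ m : ℕ∞, ContDiff ℝ m κ₀ := fun m =>
    Real.smoothTransition.contDiff.comp (contDiff_const.sub ((contDiff_norm_sq ℝ).div_const _))
  have hz : ∀ y, r ≤ ‖y‖ → κ₀ y = 0 := fun y hy => by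
    refine Real.smoothTransition.zero_of_nonpos ?_
    rw [sub_nonpos, one_le_div (by positivity)]
    exact pow_le_pow_left₀ hr.le hy 2
  have hc : HasCompactSupport κ₀ := HasCompactSupport.intro (isCompact_closedBall 0 r)
    fun y hy => hz y (by simpa using (not_le.1 (by simpa using hy)).le)
  have hpos : 0 < ∫ y, κ₀ y :=
    (hs 0).continuous.integral_pos_of_hasCompactSupport_nonneg_nonzero (x := 0) hc
      (fun y => Real.smoothTransition.nonneg _) (by simp [κ₀])
  refine ⟨fun y => (∫ y, κ₀ y)⁻¹ * κ₀ y, fun m => contDiff_const.mul (hs m), hc.mul_left,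
    fun y hy => by simp [hz y hy], fun c y h => by simp [κ₀, norm_smul, h], ?_⟩
  rw [integral_const_mul, inv_mul_cancel₀ hpos.ne']

section Weyl

open Filter Topology

variable {Ω : Set (Cn n)}

lemma cv_apply_eq (K b : Cn n → ℂ) (x : Cn n) : cv K b x = ∫ y, K y * b (x - y) := by
  rw [cv_eq_convolution]; rfl

lemma tendsto_cv_moll {K b : Cn n → ℂ} (hK : Continuous K) (hKc : HasCompactSupport K)
    (hb : MemLp b 2 volume) (x : Cn n) :
    Tendsto (fun i => cv K (moll i b) x) atTop (𝓝 (cv K b x)) := by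
  have hbl : LocallyIntegrable b := hb.locallyIntegrable (by norm_num)
  have hmc : ∀ i, Continuous (moll i b) := fun i =>
    (contDiff_cv (contDiff_ofReal_mker i (m := 0)) (hasCompactSupport_ofReal_mker i) hbl).continuous
  have hK2 : MemLp (fun y => K (x - y)) 2 volume :=
    (hK.comp (continuous_const.sub continuous_id)).memLp_of_hasCompactSupport
      (hKc.comp_homeomorph (Homeomorph.subLeft x))
  rw [tendsto_iff_edist_tendsto_0]
  have h0 : Tendsto (fun i => eLpNorm (fun y => K (x - y)) 2 volume *
      (∫⁻ x, ‖moll i b x - b x‖ₑ ^ 2) ^ (1 / 2 : ℝ)) atTop (𝓝 0) := by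
    have h1 := (ENNReal.continuous_rpow_const (y := (1 / 2 : ℝ))).tendsto 0 |>.comp
      (tendsto_lintegral_moll_sub_sq hb)
    have h2 := ENNReal.Tendsto.const_mul h1 (.inr hK2.2.ne)
    simpa using h2
  refine tendsto_of_tendsto_of_tendsto_of_le_of_le tendsto_const_nhds h0 (fun _ => bot_le)
    fun i => ?_
  have hsm : AEStronglyMeasurable (fun y => moll i b y - b y) volume :=
    (hmc i).aestronglyMeasurable.sub hb.1
  simp only
  rw [edist_eq_enorm_sub, cv, cv, ← integral_sub
    (integrable_cv hK hKc (hmc i).locallyIntegrable x) (integrable_cv hK hKc hbl x)]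
  refine (enorm_integral_le_lintegral_enorm _).trans ?_
  have h3 := ENNReal.lintegral_mul_le_Lp_mul_Lq volume Real.HolderConjugate.two_two
    hK2.1.enorm hsm.enorm
  rw [eLpNorm_eq_lintegral_rpow_enorm_toReal (by norm_num) (by norm_num)]
  refine le_trans (le_of_eq ?_) (h3.trans (le_of_eq ?_))
  · refine lintegral_congr fun y => ?_
    rw [← mul_sub, enorm_mul]; rfl
  · norm_num

/-- Weyl's lemma on a ball. -/
lemma exists_holomorphic_ball {w : Cn n → ℂ} {x : Cn n} {r : ℝ} (hr : 0 < r)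
    (hw : MemLp w 2 (volume.restrict (closedBall x (3 * r))))
    (h : ∀ t : Cn n → ℂ, CTest ((⊤ : ℕ∞) : WithTop ℕ∞) (ball x (3 * r)) t → ∀ j,
      ∫ z, w z * wirt I t z j = 0) :
    ∃ g : Cn n → ℂ, DifferentiableOn ℂ g (ball x r) ∧ w =ᵐ[volume.restrict (ball x r)] g := by
  obtain ⟨κ, hκs, hκc, hκr, hκi, hκ1⟩ := exists_radial_kernel n hr
  set W := (closedBall x (3 * r)).indicator w with hWdef
  have hW : MemLp W 2 volume := (memLp_indicator_iff_restrict measurableSet_closedBall).2 hw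
  have hWl : LocallyIntegrable W := hW.locallyIntegrable (by norm_num)
  have hWt : ∀ t : Cn n → ℂ, CTest ((⊤ : ℕ∞) : WithTop ℕ∞) (ball x (3 * r)) t → ∀ j,
      ∫ z, W z * wirt I t z j = 0 := by
    intro t ht j
    rw [← h t ht j]
    refine integral_congr_ae (.of_forall fun z => ?_)
    by_cases hz : z ∈ closedBall x (3 * r)
    · simp [hWdef, hz]
    · have : wirt I t z j = 0 := wirt_eq_zero_of_notMem_tsupport
        (fun h => hz (ball_subset_closedBall (ht.subset h))) j
      simp [this]
  have hol : ∀ {K : Cn n → ℝ} {ε R : ℝ}, (∀ m : ℕ∞, ContDiff ℝ m K) → HasCompactSupport K →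
      (∀ y, ε ≤ ‖y‖ → K y = 0) → R + ε < 3 * r →
      DifferentiableOn ℂ (cv (fun y => (K y : ℂ)) W) (ball x R) := by
    intro K ε R hK hKc hKε hR z hz
    have hKcc : HasCompactSupport (fun y => (K y : ℂ)) :=
      hKc.comp_left (g := fun x : ℝ => (x : ℂ)) (by simp)
    refine DifferentiableAt.differentiableWithinAt ?_
    refine differentiableAt_complex_of_wirt_eq_zero
      ((contDiff_cv (contDiff_ofReal_comp (hK 1)) hKcc hWl).differentiable one_ne_zero z)
      fun j => ?_
    have ht : CTest ((⊤ : ℕ∞) : WithTop ℕ∞) (ball x (3 * r)) (fun y => (K (z - y) : ℂ)) := by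
      refine ⟨contDiff_ofReal_comp ((hK ⊤).comp (contDiff_const.sub contDiff_id)),
        hKcc.comp_homeomorph (Homeomorph.subLeft z), ?_⟩
      refine (closure_minimal (t := closedBall z ε) (fun y hy => ?_) isClosed_closedBall).trans
        (closedBall_subset_ball' ?_)
      · by_contra hyz
        refine hy ?_
        have : ε ≤ ‖z - y‖ := by
          rw [mem_closedBall, dist_comm, dist_eq_norm] at hyz
          exact (not_le.1 hyz).le
        simp [hKε _ this]
      · rw [mem_ball] at hz
        linarith
    have h2 := hWt _ ht j
    rw [wirt_cv I (contDiff_ofReal_comp (hK 1)) hKcc hWl, cv]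
    simp only [wirt_comp_sub_left I (K := fun y => (K y : ℂ))
      ((contDiff_ofReal_comp (hK 1)).differentiable one_ne_zero)] at h2
    simp only [mul_neg, integral_neg, neg_eq_zero] at h2
    rw [← h2]
    exact integral_congr_ae (.of_forall fun y => mul_comm _ _)
  refine ⟨cv (fun y => (κ y : ℂ)) W, hol hκs hκc hκr (by linarith), ?_⟩
  have hae : ∀ᵐ z, Tendsto (fun i => moll i W z) atTop (𝓝 (W z)) := by
    have h1 := ContDiffBump.ae_convolution_tendsto_right_of_locallyIntegrable (φ := bump n)
      (l := atTop) (K := 2) (μ := volume)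
      (by simpa [bump] using tendsto_one_div_add_atTop_nhds_zero_nat (𝕜 := ℝ))
      (.of_forall fun i => by simp only [bump]; field_simp; rfl) hWl
    filter_upwards [h1] with z hz
    refine hz.congr fun i => ?_
    rw [convolution_lsmul_swap]
    simp [moll, cv, mker]
  refine (ae_restrict_iff' measurableSet_ball).2 ?_
  filter_upwards [hae] with z hz hzb
  have hwW : w z = W z := by
    have : z ∈ closedBall x (3 * r) := by
      rw [mem_ball] at hzb; rw [mem_closedBall]; linarith
    simp [hWdef, this]
  rw [hwW]
  refine tendsto_nhds_unique hz ((tendsto_cv_moll (contDiff_ofReal_comp (hκs 0)).continuous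
    (hκc.comp_left (g := fun x : ℝ => (x : ℂ)) (by simp)) hW z).congr' ?_)
  filter_upwards [tendsto_one_div_add_atTop_nhds_zero_nat.eventually (gt_mem_nhds hr)] with i hi
  have hd : DifferentiableOn ℂ (moll i W) (ball x (2 * r)) :=
    hol (fun _ => contDiff_mker i) (hasCompactSupport_mker i) (fun y hy => mker_eq_zero hy)
      (by linarith)
  have hmc : Continuous (moll i W) :=
    (contDiff_cv (contDiff_ofReal_mker i (m := 0)) (hasCompactSupport_ofReal_mker i)
      hWl).continuous
  rw [cv_apply_eq, integral_radial_mul (hκs 0).continuous hκc hκr hκi hmc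
    (hd.mono (ball_subset_ball' ?_)), hκ1]
  · simp
  · rw [mem_ball] at hzb; linarith

/-- **Weyl's lemma** for the `∂̄` operator. -/
lemma exists_holomorphic_of_weak {w : Cn n → ℂ} (hΩ : IsOpen Ω)
    (hw : ∀ K ⊆ Ω, IsCompact K → MemLp w 2 (volume.restrict K))
    (h : ∀ t : Cn n → ℂ, CTest ((⊤ : ℕ∞) : WithTop ℕ∞) Ω t → ∀ j,
      ∫ z, w z * wirt I t z j = 0) :
    ∃ g : Cn n → ℂ, DifferentiableOn ℂ g Ω ∧ w =ᵐ[volume.restrict Ω] g := by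
  have hloc : ∀ x : Cn n, ∃ r : ℝ, ∃ g : Cn n → ℂ, x ∈ Ω → 0 < r ∧ ball x r ⊆ Ω ∧
      DifferentiableOn ℂ g (ball x r) ∧ w =ᵐ[volume.restrict (ball x r)] g := by
    intro x
    by_cases hx : x ∈ Ω
    · obtain ⟨ε, hε, hsub⟩ := Metric.nhds_basis_closedBall.mem_iff.1 (hΩ.mem_nhds hx)
      have hε3 : 3 * (ε / 3) = ε := by ring
      obtain ⟨g, hg⟩ := exists_holomorphic_ball (w := w) (x := x) (r := ε / 3) (by positivity)
        (by rw [hε3]; exact hw _ hsub (isCompact_closedBall x ε))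
        (fun t ht => h t (ht.mono (by rw [hε3]; exact ball_subset_closedBall.trans hsub)))
      refine ⟨ε / 3, g, fun _ => ⟨by positivity, ?_, hg⟩⟩
      exact (ball_subset_closedBall.trans (closedBall_subset_closedBall (by linarith))).trans hsub
    · exact ⟨0, 0, fun h => absurd h hx⟩
  choose r g hg using hloc
  have heq : ∀ x ∈ Ω, EqOn (fun z => g z z) (g x) (ball x (r x)) := by
    intro x hx z hz
    have hzΩ : z ∈ Ω := (hg x hx).2.1 hz
    have h1 := ae_restrict_of_ae_restrict_of_subset inter_subset_right (hg x hx).2.2.2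
      (s := ball z (r z) ∩ ball x (r x))
    have h2 := ae_restrict_of_ae_restrict_of_subset inter_subset_left (hg z hzΩ).2.2.2
      (s := ball z (r z) ∩ ball x (r x))
    have h3 : g z =ᵐ[volume.restrict (ball z (r z) ∩ ball x (r x))] g x := by
      filter_upwards [h1, h2] with y hy1 hy2 using hy2.symm.trans hy1
    exact Measure.eqOn_open_of_ae_eq h3 (isOpen_ball.inter isOpen_ball)
      ((hg z hzΩ).2.2.1.continuousOn.mono inter_subset_left)
      ((hg x hx).2.2.1.continuousOn.mono inter_subset_right)
      ⟨mem_ball_self (hg z hzΩ).1, hz⟩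
  refine ⟨fun z => g z z, fun x hx => ?_, ?_⟩
  · have hb : ball x (r x) ∈ 𝓝 x := ball_mem_nhds x (hg x hx).1
    refine (((hg x hx).2.2.1.differentiableAt hb).congr_of_eventuallyEq ?_).differentiableWithinAt
    filter_upwards [hb] with z hz using heq x hx hz
  · refine (ae_restrict_iff' hΩ.measurableSet).2 (ae_iff.2 ?_)
    refine measure_null_of_locally_null _ fun x hx => ?_
    simp only [mem_ofPred_eq, Classical.not_imp] at hx
    have hb : ball x (r x) ∈ 𝓝 x := ball_mem_nhds x (hg x hx.1).1
    refine ⟨_ ∩ ball x (r x), inter_mem self_mem_nhdsWithin (mem_nhdsWithin_of_mem_nhds hb), ?_⟩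
    have h1 := ae_iff.1 ((ae_restrict_iff' measurableSet_ball).1 (hg x hx.1).2.2.2)
    refine measure_mono_null (fun z hz => ?_) h1
    simp only [mem_inter_iff, mem_ofPred_eq, Classical.not_imp] at hz ⊢
    exact ⟨hz.2, by rw [← heq x hx.1 hz.2]; exact hz.1.2⟩

end Weyl

/-- The squared norm `Σ_j |∂f/∂z_j|²` of the complex gradient of a real function. -/
def gradSq (f : Cn n → ℝ) (z : Cn n) : ℝ := ∑ j, ‖wirt (-I) (fun y => (f y : ℂ)) z j‖ ^ 2

lemma gradSq_nonneg (f : Cn n → ℝ) (z : Cn n) : 0 ≤ gradSq f z :=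
  Finset.sum_nonneg fun _ _ => sq_nonneg _

lemma gradSq_comp {Y : ℝ → ℝ} {f : Cn n → ℝ} {z : Cn n} {Y' : ℝ}
    (hY : HasDerivAt Y Y' (f z)) (hf : DifferentiableAt ℝ f z) :
    gradSq (fun y => Y (f y)) z = Y' ^ 2 * gradSq f z := by
  simp only [gradSq, wirt_ofReal_comp (-I) hY hf, norm_mul, mul_pow, norm_real, Finset.mul_sum,
    Real.norm_eq_abs, sq_abs]

lemma continuousOn_gradSq {f : Cn n → ℝ} {Ω : Set (Cn n)} (hΩ : IsOpen Ω)
    (hf : ContDiffOn ℝ 1 f Ω) : ContinuousOn (gradSq f) Ω := by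
  have := continuousOn_wirt (-I) hΩ (f := fun y => (f y : ℂ))
    (ofRealCLM.contDiff.comp_contDiffOn hf)
  unfold gradSq
  fun_prop

lemma leviForm_add {f g : Cn n → ℝ} {z : Cn n} (hf : ContDiffAt ℝ 2 f z)
    (hg : ContDiffAt ℝ 2 g z) (w : Cn n) :
    LeviForm (fun y => f y + g y) z w = LeviForm f z w + LeviForm g z w := by
  have h1 : fderiv ℝ (fun y => f y + g y) =ᶠ[nhds z] fun y => fderiv ℝ f y + fderiv ℝ g y := by
    filter_upwards [hf.eventually (by simp), hg.eventually (by simp)] with y hy hy'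
    exact fderiv_fun_add (hy.differentiableAt (by simp)) (hy'.differentiableAt (by simp))
  have h2 : fderiv ℝ (fderiv ℝ (fun y => f y + g y)) z =
      fderiv ℝ (fderiv ℝ f) z + fderiv ℝ (fderiv ℝ g) z := by
    rw [h1.fderiv_eq]
    exact fderiv_fun_add ((hf.fderiv_right (m := 1) (by norm_num)).differentiableAt (by simp))
      ((hg.fderiv_right (m := 1) (by norm_num)).differentiableAt (by simp))
  simp only [LeviForm, h2, add_apply]
  ring

lemma leviForm_comp_eq {Y Y₁ : ℝ → ℝ} {Y₂ : ℝ} {f : Cn n → ℝ} {z : Cn n}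
    (hf : ContDiffAt ℝ 2 f z) (hY : ∀ᶠ t in nhds (f z), HasDerivAt Y (Y₁ t) t)
    (hY₁ : HasDerivAt Y₁ Y₂ (f z)) (w : Cn n) :
    LeviForm (fun y => Y (f y)) z w = Y₁ (f z) * LeviForm f z w +
      Y₂ / 4 * (fderiv ℝ f z w ^ 2 + fderiv ℝ f z (I • w) ^ 2) := by
  have h1 : fderiv ℝ (fun y => Y (f y)) =ᶠ[nhds z] fun y => Y₁ (f y) • fderiv ℝ f y := by
    filter_upwards [hf.eventually (by simp), hf.continuousAt.eventually hY] with y hy hy'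
    exact (hy'.comp_hasFDerivAt y (hy.differentiableAt (by simp)).hasFDerivAt).fderiv
  have h2 : HasFDerivAt (fun y => Y₁ (f y) • fderiv ℝ f y)
      (Y₁ (f z) • fderiv ℝ (fderiv ℝ f) z + (Y₂ • fderiv ℝ f z).smulRight (fderiv ℝ f z)) z :=
    (hY₁.comp_hasFDerivAt z (hf.differentiableAt (by simp)).hasFDerivAt).smul
      ((hf.fderiv_right (m := 1) (by norm_num)).differentiableAt (by simp)).hasFDerivAt
  simp only [LeviForm, h1.fderiv_eq, h2.fderiv, add_apply, smul_apply, smul_eq_mul,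
    ContinuousLinearMap.smulRight_apply]
  ring

lemma mul_leviForm_le_comp {Y Y₁ : ℝ → ℝ} {Y₂ : ℝ} {f : Cn n → ℝ} {z : Cn n}
    (hf : ContDiffAt ℝ 2 f z) (hY : ∀ t, HasDerivAt Y (Y₁ t) t)
    (hY₁ : HasDerivAt Y₁ Y₂ (f z)) (hY₂ : 0 ≤ Y₂) (w : Cn n) :
    Y₁ (f z) * LeviForm f z w ≤ LeviForm (fun y => Y (f y)) z w := by
  rw [leviForm_comp_eq hf (.of_forall hY) hY₁]
  have : 0 ≤ Y₂ / 4 * (fderiv ℝ f z w ^ 2 + fderiv ℝ f z (I • w) ^ 2) := by positivity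
  linarith

lemma mul_le_intervalIntegral {f : ℝ → ℝ} (hf : Continuous f) (hf0 : ∀ t, 0 ≤ f t)
    {R a b t c : ℝ} (hRa : R ≤ a) (hab : a ≤ b) (hbt : b ≤ t) (h : ∀ s, a ≤ s → s ≤ b → c ≤ f s) :
    (b - a) * c ≤ ∫ s in R..t, f s := by
  calc (b - a) * c = ∫ _ in a..b, c := by simp
    _ ≤ ∫ s in a..b, f s := intervalIntegral.integral_mono_on hab (by simp)
        (hf.intervalIntegrable _ _) fun s hs => h s hs.1 hs.2
    _ ≤ ∫ s in R..t, f s := intervalIntegral.integral_mono_interval hRa hab hbt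
        (.of_forall hf0) (hf.intervalIntegrable _ _)

/-- A convex increasing `C²` function vanishing on `(-∞, R]` which composed with an exhaustion
dominates a given continuous function away from a sublevel set. -/
lemma exists_convex_majorant {Ω : Set (Cn n)} {ρ F : Cn n → ℝ}
    (hρ : ∀ c, IsCompact {z ∈ Ω | ρ z ≤ c}) (hF : ContinuousOn F Ω) (R : ℝ) :
    ∃ Y Y₁ Y₂ : ℝ → ℝ, ContDiff ℝ 2 Y ∧ (∀ t, HasDerivAt Y (Y₁ t) t) ∧
      (∀ t, HasDerivAt Y₁ (Y₂ t) t) ∧ (∀ t, 0 ≤ Y t) ∧ (∀ t, 0 ≤ Y₁ t) ∧ (∀ t, 0 ≤ Y₂ t) ∧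
      (∀ t ≤ R, Y t = 0) ∧ (∀ t ≤ R, Y₁ t = 0) ∧
      ∀ z ∈ Ω, R + 1 ≤ ρ z → F z ≤ Y (ρ z) ∧ F z ≤ Y₁ (ρ z) := by
  obtain ⟨q, hq⟩ := exists_continuous_forall_mem_convex_of_local_const
    (t := fun s : ℝ => {c : ℝ | 0 ≤ c ∧ ∀ z ∈ Ω, ρ z ≤ s + 1 → 32 * F z ≤ c})
    (fun s x hx y hy a b ha hb hab => by
      refine ⟨add_nonneg (mul_nonneg ha hx.1) (mul_nonneg hb hy.1), fun z hz hzs => ?_⟩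
      have h1 := mul_le_mul_of_nonneg_left (hx.2 z hz hzs) ha
      have h2 := mul_le_mul_of_nonneg_left (hy.2 z hz hzs) hb
      simp only [smul_eq_mul]
      calc 32 * F z = a * (32 * F z) + b * (32 * F z) := by rw [← add_mul, hab, one_mul]
        _ ≤ _ := add_le_add h1 h2)
    (fun s => by
      obtain ⟨c, hc⟩ := (hρ (s + 2)).bddAbove_image (hF.mono (sep_subset _ _))
      refine ⟨max (32 * c) 0, ?_⟩
      filter_upwards [gt_mem_nhds (show s < s + 1 by linarith)] with y hy
      refine ⟨le_max_right _ _, fun z hz hzs => le_max_of_le_left ?_⟩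
      have : F z ≤ c := hc ⟨z, ⟨hz, by linarith⟩, rfl⟩
      linarith)
  let Y₂ : ℝ → ℝ := fun t => max (t - R) 0 * q t
  have hY₂c : Continuous Y₂ := by fun_prop
  have hY₂0 : ∀ t, 0 ≤ Y₂ t := fun t => mul_nonneg (le_max_right _ _) (hq t).1
  let Y₁ : ℝ → ℝ := fun t => ∫ s in R..t, Y₂ s
  have hY₁d : ∀ t, HasDerivAt Y₁ (Y₂ t) t := fun t =>
    (hY₂c.integral_hasStrictDerivAt R t).hasDerivAt
  have hY₁c : Continuous Y₁ := continuous_iff_continuousAt.2 fun t => (hY₁d t).continuousAt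
  let Y : ℝ → ℝ := fun t => ∫ s in R..t, Y₁ s
  have hYd : ∀ t, HasDerivAt Y (Y₁ t) t := fun t => hY₁c.integral_hasStrictDerivAt R t |>.hasDerivAt
  have hY₁z : ∀ t ≤ R, Y₁ t = 0 := fun t ht => by
    refine intervalIntegral.integral_zero_ae (.of_forall fun s hs => ?_)
    rw [uIoc_of_ge ht] at hs
    simp [Y₂, max_eq_right (sub_nonpos.2 hs.2)]
  have hYz : ∀ t ≤ R, Y t = 0 := fun t ht => by
    refine intervalIntegral.integral_zero_ae (.of_forall fun s hs => ?_)
    rw [uIoc_of_ge ht] at hs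
    exact hY₁z s hs.2
  have hY₁0 : ∀ t, 0 ≤ Y₁ t := fun t => by
    rcases le_total t R with h | h
    · exact (hY₁z t h).ge
    · exact intervalIntegral.integral_nonneg h fun s _ => hY₂0 s
  have hY0 : ∀ t, 0 ≤ Y t := fun t => by
    rcases le_total t R with h | h
    · exact (hYz t h).ge
    · exact intervalIntegral.integral_nonneg h fun s _ => hY₁0 s
  have hY₁C : ContDiff ℝ 1 Y₁ := by
    rw [contDiff_one_iff_deriv]
    refine ⟨fun t => (hY₁d t).differentiableAt, ?_⟩
    rwa [show deriv Y₁ = Y₂ from funext fun t => (hY₁d t).deriv]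
  refine ⟨Y, Y₁, Y₂, ?_, hYd, hY₁d, hY0, hY₁0, hY₂0, hYz, hY₁z, fun z hz hzR => ?_⟩
  · rw [← one_add_one_eq_two, contDiff_succ_iff_deriv]
    refine ⟨fun t => (hYd t).differentiableAt, by simp, ?_⟩
    rwa [show deriv Y = Y₁ from funext fun t => (hYd t).deriv]
  · set t := ρ z
    rcases le_total (F z) 0 with hF0 | hF0
    · exact ⟨hF0.trans (hY0 t), hF0.trans (hY₁0 t)⟩
    have hY₁l : ∀ s, t - 1 / 4 ≤ s → 4 * F z ≤ Y₁ s := by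
      intro s hs
      have := mul_le_intervalIntegral hY₂c hY₂0 (R := R) (a := t - 1 / 2) (b := t - 1 / 4) (t := s)
        (c := 16 * F z) (by linarith) (by linarith) hs fun x hx1 hx2 => by
          have h1 := (hq x).2 z hz (by linarith)
          have h2 : 1 / 2 ≤ max (x - R) 0 := le_max_of_le_left (by linarith)
          simp only [Y₂]
          nlinarith [(hq x).1]
      simp only [Y₁]
      linarith
    refine ⟨?_, by linarith [hY₁l t (by linarith)]⟩
    have := mul_le_intervalIntegral hY₁c hY₁0 (R := R) (a := t - 1 / 4) (b := t) (t := t)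
      (c := 4 * F z) (by linarith) (by linarith) le_rfl fun x hx1 hx2 => hY₁l x hx1
    simp only [Y]
    linarith

lemma exists_abs_deriv_smoothTransition_le : ∃ C, ∀ t, |deriv Real.smoothTransition t| ≤ C := by
  have hc : Continuous (deriv Real.smoothTransition) :=
    Real.smoothTransition.contDiff.continuous_deriv (n := 1) le_rfl
  obtain ⟨C, hC⟩ := (isCompact_Icc (a := (0 : ℝ)) (b := 1)).exists_bound_of_continuousOn
    hc.continuousOn
  refine ⟨C, fun t => ?_⟩
  by_cases ht : t ∈ Icc (0 : ℝ) 1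
  · exact hC t ht
  have h0 : deriv Real.smoothTransition t = 0 := by
    rcases lt_or_ge t 0 with h | h
    · refine (Filter.EventuallyEq.deriv_eq (f := fun _ => (0 : ℝ)) ?_).trans (deriv_const _ _)
      filter_upwards [gt_mem_nhds h] with s hs
      exact Real.smoothTransition.zero_of_nonpos (le_of_lt hs)
    · have h1 : 1 < t := not_le.1 fun h' => ht ⟨h, h'⟩
      refine (Filter.EventuallyEq.deriv_eq (f := fun _ => (1 : ℝ)) ?_).trans (deriv_const _ _)
      filter_upwards [lt_mem_nhds h1] with s hs
      exact Real.smoothTransition.one_of_one_le (le_of_lt hs)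
  rw [h0, abs_zero]
  exact (norm_nonneg _).trans (hC 0 (by simp))

/-- The cutoff function equal to `1` on `{ρ ≤ s}` and supported in `{ρ ≤ 2s}`. -/
def cutoff (Ω : Set (Cn n)) (ρ : Cn n → ℝ) (s : ℝ) : Cn n → ℝ :=
  Ω.indicator fun z => Real.smoothTransition (2 - ρ z / s)

section cutoff

variable {Ω : Set (Cn n)} {ρ : Cn n → ℝ} {s : ℝ}

lemma cutoff_nonneg (z : Cn n) : 0 ≤ cutoff Ω ρ s z :=
  indicator_nonneg (fun _ _ => Real.smoothTransition.nonneg _) z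

lemma cutoff_le_one (z : Cn n) : cutoff Ω ρ s z ≤ 1 :=
  indicator_le' (fun _ _ => Real.smoothTransition.le_one _) (fun _ _ => zero_le_one) z

lemma cutoff_eq_one (hs : 0 < s) {z : Cn n} (hz : z ∈ Ω) (h : ρ z ≤ s) : cutoff Ω ρ s z = 1 := by
  rw [cutoff, indicator_of_mem hz]
  refine Real.smoothTransition.one_of_one_le ?_
  have := (div_le_one hs).2 h
  linarith

lemma cutoff_eq_zero (hs : 0 < s) {z : Cn n} (h : z ∈ Ω → 2 * s ≤ ρ z) : cutoff Ω ρ s z = 0 := by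
  by_cases hz : z ∈ Ω
  · rw [cutoff, indicator_of_mem hz]
    refine Real.smoothTransition.zero_of_nonpos ?_
    rw [sub_nonpos, le_div_iff₀ hs]
    exact h hz
  · exact indicator_of_notMem hz _

lemma cutoff_eventuallyEq (hΩ : IsOpen Ω) {z : Cn n} (hz : z ∈ Ω) :
    cutoff Ω ρ s =ᶠ[nhds z] fun z => Real.smoothTransition (2 - ρ z / s) := by
  filter_upwards [hΩ.mem_nhds hz] with y hy
  rw [cutoff, indicator_of_mem hy]

lemma tsupport_cutoff_subset (hρ : ∀ c, IsCompact {z ∈ Ω | ρ z ≤ c}) (hs : 0 < s) :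
    tsupport (fun z => (cutoff Ω ρ s z : ℂ)) ⊆ {z ∈ Ω | ρ z ≤ 2 * s} := by
  refine closure_minimal (fun z hz => ?_) (hρ _).isClosed
  by_contra h
  refine hz ?_
  simp only [ofReal_eq_zero]
  exact cutoff_eq_zero hs fun hzΩ => (not_le.1 fun h' => h ⟨hzΩ, h'⟩).le

lemma ctest_cutoff (hΩ : IsOpen Ω) (hρC : ContDiffOn ℝ 2 ρ Ω)
    (hρ : ∀ c, IsCompact {z ∈ Ω | ρ z ≤ c}) (hs : 0 < s) :
    CTest 2 Ω (fun z => (cutoff Ω ρ s z : ℂ)) := by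
  have h := tsupport_cutoff_subset hρ hs
  refine ⟨contDiff_iff_contDiffAt.2 fun z => ?_, (hρ _).of_isClosed_subset (isClosed_tsupport _) h,
    h.trans (sep_subset _ _)⟩
  by_cases hz : z ∈ Ω
  · have h1 : ContDiffAt ℝ 2 (fun z => (Real.smoothTransition (2 - ρ z / s) : ℂ)) z :=
      ofRealCLM.contDiff.contDiffAt.comp z (Real.smoothTransition.contDiffAt.comp z
        (contDiffAt_const.sub ((hρC.contDiffAt (hΩ.mem_nhds hz)).div_const s)))
    refine h1.congr_of_eventuallyEq ?_
    filter_upwards [cutoff_eventuallyEq (ρ := ρ) (s := s) hΩ hz] with y hy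
    rw [hy]
  · refine (contDiffAt_const (c := (0 : ℂ))).congr_of_eventuallyEq ?_
    filter_upwards [(isClosed_tsupport (fun z => (cutoff Ω ρ s z : ℂ))).isOpen_compl.mem_nhds
      fun h' => hz (h h').1] with y hy
    exact image_eq_zero_of_notMem_tsupport (f := fun z => (cutoff Ω ρ s z : ℂ)) hy

lemma gradSq_congr {f g : Cn n → ℝ} {z : Cn n} (h : f =ᶠ[nhds z] g) : gradSq f z = gradSq g z := by
  unfold gradSq
  have h' : (fun y => (f y : ℂ)) =ᶠ[nhds z] fun y => (g y : ℂ) := h.fun_comp ofReal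
  simp only [wirt_congr h']

lemma exists_gradSq_cutoff_le : ∃ C, 0 ≤ C ∧ ∀ {Ω : Set (Cn n)} {ρ : Cn n → ℝ} {s : ℝ},
    IsOpen Ω → ContDiffOn ℝ 2 ρ Ω → 0 < s → ∀ z ∈ Ω, gradSq (cutoff Ω ρ s) z ≤
      C / s ^ 2 * gradSq ρ z ∧ (ρ z < s → gradSq (cutoff Ω ρ s) z = 0) := by
  obtain ⟨C, hC⟩ := exists_abs_deriv_smoothTransition_le
  have hC0 : 0 ≤ C := (abs_nonneg _).trans (hC 0)
  refine ⟨C ^ 2, by positivity, fun {Ω ρ s} hΩ hρC hs z hz => ⟨?_, fun h => ?_⟩⟩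
  · have hd : DifferentiableAt ℝ ρ z := (hρC.contDiffAt (hΩ.mem_nhds hz)).differentiableAt (by simp)
    have h1 : HasDerivAt (fun t => Real.smoothTransition (2 - t / s))
        (deriv Real.smoothTransition (2 - ρ z / s) * (-(1 / s))) (ρ z) := by
      have h2 : HasDerivAt Real.smoothTransition (deriv Real.smoothTransition (2 - ρ z / s))
          (2 - ρ z / s) := ((Real.smoothTransition.contDiff (n := 1)).differentiable
            (by simp) _).hasDerivAt
      exact h2.comp (ρ z) (((hasDerivAt_id (ρ z)).div_const s).const_sub 2)
    rw [gradSq_congr (cutoff_eventuallyEq hΩ hz), gradSq_comp h1 hd]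
    refine mul_le_mul_of_nonneg_right ?_ (gradSq_nonneg _ _)
    rw [mul_pow, neg_sq, div_pow, one_pow, mul_one_div]
    refine div_le_div_of_nonneg_right ?_ (sq_nonneg s)
    rw [← sq_abs]
    exact pow_le_pow_left₀ (abs_nonneg _) (hC _) 2
  · have h1 : cutoff Ω ρ s =ᶠ[nhds z] fun _ => 1 := by
      filter_upwards [hΩ.mem_nhds hz, (hρC.continuousOn.continuousAt (hΩ.mem_nhds hz)).eventually
        (gt_mem_nhds h)] with y hy hy'
      exact cutoff_eq_one hs hy (le_of_lt hy')
    rw [gradSq_congr h1]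
    simp [gradSq, wirt]

end cutoff

/-- Weights adapted to an exhaustion `ρ`, agreeing with `Φ` on `{ρ ≤ R}`. -/
lemma exists_weights {Ω : Set (Cn n)} (hΩ : IsOpen Ω) {ρ : Cn n → ℝ} (hρC : ContDiffOn ℝ 2 ρ Ω)
    (hρ : ∀ c, IsCompact {z ∈ Ω | ρ z ≤ c}) (hρL : ∀ z ∈ Ω, ∀ w, ‖w‖ ^ 2 ≤ LeviForm ρ z w)
    {Φ : Cn n → ℝ} (hΦ : ContDiffOn ℝ 2 Φ Ω) {c : ℝ}
    (hL : ∀ z ∈ Ω, ∀ w, c * ‖w‖ ^ 2 ≤ LeviForm Φ z w) (R : ℝ) :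
    ∃ (Φ' ψ : Cn n → ℝ) (C : ℝ), ContDiffOn ℝ 2 Φ' Ω ∧ ContDiffOn ℝ 2 ψ Ω ∧ 0 ≤ C ∧
      (∀ z ∈ Ω, ρ z ≤ R → Φ' z = Φ z ∧ ψ z = 0) ∧
      (∀ z ∈ Ω, Φ z ≤ Φ' z - ψ z) ∧
      (∀ z ∈ Ω, ∀ w, (c * Real.exp (ψ z) + 4 * gradSq ψ z) * ‖w‖ ^ 2 ≤ LeviForm Φ' z w) ∧
      ∀ s : ℝ, 0 < s → R + 2 ≤ s → ∀ z ∈ Ω,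
        gradSq (cutoff Ω ρ s) z ≤ C / s ^ 2 * Real.exp (ψ z) := by
  have hρd : ∀ z ∈ Ω, ContDiffAt ℝ 2 ρ z := fun z hz => hρC.contDiffAt (hΩ.mem_nhds hz)
  have hNρ : ContinuousOn (gradSq ρ) Ω := continuousOn_gradSq hΩ (hρC.of_le (by norm_num))
  obtain ⟨Y, Y₁, Y₂, hY, hYd, hYd', hY0, hY₁0, hY₂0, hYz, hY₁z, hYF⟩ :=
    exists_convex_majorant hρ hNρ (R + 1)
  have hψC : ContDiffOn ℝ 2 (fun z => Y (ρ z)) Ω := hY.comp_contDiffOn hρC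
  have hNψ : ∀ z ∈ Ω, gradSq (fun z => Y (ρ z)) z = Y₁ (ρ z) ^ 2 * gradSq ρ z := fun z hz =>
    gradSq_comp (hYd _) ((hρd z hz).differentiableAt (by simp))
  have hF : ContinuousOn (fun z => 4 * gradSq (fun z => Y (ρ z)) z +
      |c| * (Real.exp (Y (ρ z)) - 1) + Y (ρ z)) Ω := by
    have h1 := continuousOn_gradSq hΩ (hψC.of_le (by norm_num))
    have h2 := hψC.continuousOn
    exact ((continuousOn_const.mul h1).add (continuousOn_const.mul
      ((Real.continuous_exp.comp_continuousOn h2).sub continuousOn_const))).add h2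
  obtain ⟨X, X₁, X₂, hX, hXd, hXd', hX0, hX₁0, hX₂0, hXz, hX₁z, hXF⟩ :=
    exists_convex_majorant hρ hF R
  obtain ⟨C, hC0, hC⟩ := exists_gradSq_cutoff_le (n := n)
  have hXC : ContDiffOn ℝ 2 (fun z => X (ρ z)) Ω := hX.comp_contDiffOn hρC
  have hexp : ∀ z, 0 ≤ Real.exp (Y (ρ z)) - 1 := fun z => by
    have := Real.add_one_le_exp (Y (ρ z)); have := hY0 (ρ z); linarith
  refine ⟨fun z => Φ z + X (ρ z), fun z => Y (ρ z), C, hΦ.add hXC, hψC, hC0, fun z hz h => ?_,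
    fun z hz => ?_, fun z hz w => ?_, fun s hs hRs z hz => ?_⟩
  · exact ⟨by simp [hXz _ h], hYz _ (by linarith)⟩
  · rcases le_total (R + 1) (ρ z) with h | h
    · have h1 := (hXF z hz h).1
      have h2 := gradSq_nonneg (fun z => Y (ρ z)) z
      have h3 := mul_nonneg (abs_nonneg c) (hexp z)
      linarith
    · have := hYz _ h
      have := hX0 (ρ z)
      simp only
      linarith
  · rw [leviForm_add (hΦ.contDiffAt (hΩ.mem_nhds hz)) (hXC.contDiffAt (hΩ.mem_nhds hz))]
    have h1 := mul_leviForm_le_comp (hρd z hz) hXd (hXd' _) (hX₂0 _) w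
    have h2 := mul_le_mul_of_nonneg_left (hρL z hz w) (hX₁0 (ρ z))
    have h3 := hL z hz w
    have h4 : c * Real.exp (Y (ρ z)) + 4 * gradSq (fun z => Y (ρ z)) z ≤ c + X₁ (ρ z) := by
      rcases le_total (R + 1) (ρ z) with h | h
      · have h4 := (hXF z hz h).2
        have h5 := mul_le_mul_of_nonneg_right (le_abs_self c) (hexp z)
        have := hY0 (ρ z)
        linarith
      · have := hX₁0 (ρ z)
        simp only [hNψ z hz, hYz _ h, hY₁z _ h]
        norm_num
        exact this
    have h5 := mul_le_mul_of_nonneg_right h4 (sq_nonneg ‖w‖)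
    linarith
  · rcases lt_or_ge (ρ z) s with h | h
    · rw [(hC hΩ hρC hs z hz).2 h]
      positivity
    · refine (hC hΩ hρC hs z hz).1.trans ?_
      gcongr
      have h1 := (hYF z hz (by linarith)).1
      have := Real.add_one_le_exp (Y (ρ z))
      linarith

section TendstoL2

open Filter Topology

lemma norm_toLp_sq {X E : Type*} [MeasurableSpace X] {μ : Measure X} [NormedAddCommGroup E]
    [InnerProductSpace ℂ E] {f : X → E} (hf : MemLp f 2 μ) :
    ‖hf.toLp f‖ ^ 2 = ∫ x, ‖f x‖ ^ 2 ∂μ := by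
  have h1 : ((‖hf.toLp f‖ ^ 2 : ℝ) : ℂ) = ∫ x, ((‖f x‖ ^ 2 : ℝ) : ℂ) ∂μ := by
    have h2 := inner_self_eq_norm_sq_to_K (𝕜 := ℂ) (hf.toLp f)
    rw [L2.inner_def] at h2
    rw [ofReal_pow]
    refine h2.symm.trans (integral_congr_ae ?_)
    filter_upwards [hf.coeFn_toLp] with x hx
    rw [hx, inner_self_eq_norm_sq_to_K]
    simp
  rw [integral_complex_ofReal] at h1
  exact_mod_cast h1

/-- Convergence in `L²(ℂⁿ)`. -/
structure TendstoL2 (f : ℕ → Cn n → ℂ) (g : Cn n → ℂ) : Prop where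
  memLp : ∀ i, MemLp (f i) 2 volume
  memLp_lim : MemLp g 2 volume
  tendsto : Tendsto (fun i => (memLp i).toLp (f i)) atTop (𝓝 (memLp_lim.toLp g))

namespace TendstoL2

variable {f f' : ℕ → Cn n → ℂ} {g g' : Cn n → ℂ}

lemma zero : TendstoL2 (fun _ _ => 0) (fun _ : Cn n => 0) :=
  ⟨fun _ => MemLp.zero, MemLp.zero, tendsto_const_nhds⟩

lemma add (h : TendstoL2 f g) (h' : TendstoL2 f' g') :
    TendstoL2 (fun i z => f i z + f' i z) (fun z => g z + g' z) :=
  ⟨fun i => (h.memLp i).add (h'.memLp i), h.memLp_lim.add h'.memLp_lim,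
    h.tendsto.add h'.tendsto⟩

lemma sub (h : TendstoL2 f g) (h' : TendstoL2 f' g') :
    TendstoL2 (fun i z => f i z - f' i z) (fun z => g z - g' z) :=
  ⟨fun i => (h.memLp i).sub (h'.memLp i), h.memLp_lim.sub h'.memLp_lim,
    h.tendsto.sub h'.tendsto⟩

lemma sum {ι : Type*} (s : Finset ι) {f : ι → ℕ → Cn n → ℂ} {g : ι → Cn n → ℂ}
    (h : ∀ j, TendstoL2 (f j) (g j)) :
    TendstoL2 (fun i z => ∑ j ∈ s, f j i z) (fun z => ∑ j ∈ s, g j z) := by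
  classical
  induction s using Finset.induction_on with
  | empty => simpa using zero
  | insert a s ha ih => simpa [Finset.sum_insert ha] using (h a).add ih

lemma mul_bounded (h : TendstoL2 f g) {W : Cn n → ℂ} (hW : AEStronglyMeasurable W volume)
    {M : ℝ} (hM : ∀ z, ‖W z‖ ≤ M) : TendstoL2 (fun i z => f i z * W z) (fun z => g z * W z) := by
  have hmem : ∀ {u : Cn n → ℂ}, MemLp u 2 volume → MemLp (fun z => u z * W z) 2 volume :=
    fun {u} hu => hu.of_le_mul (hu.1.mul hW) (.of_forall fun z => by
      rw [norm_mul, mul_comm]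
      exact mul_le_mul_of_nonneg_right (hM z) (norm_nonneg _))
  refine ⟨fun i => hmem (h.memLp i), hmem h.memLp_lim, ?_⟩
  rw [Lp.tendsto_Lp_iff_tendsto_eLpNorm'']
  have h1 := (Lp.tendsto_Lp_iff_tendsto_eLpNorm'' _ h.memLp _ h.memLp_lim).1 h.tendsto
  have h2 := ENNReal.Tendsto.const_mul (a := ENNReal.ofReal M) h1 (.inr ENNReal.ofReal_ne_top)
  rw [mul_zero] at h2
  refine tendsto_of_tendsto_of_tendsto_of_le_of_le tendsto_const_nhds h2 (fun _ => bot_le)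
    fun i => eLpNorm_le_mul_eLpNorm_of_ae_le_mul (.of_forall fun z => ?_) 2
  simp only [Pi.sub_apply]
  rw [← sub_mul, norm_mul, mul_comm]
  exact mul_le_mul_of_nonneg_right (hM z) (norm_nonneg _)

lemma tendsto_integral (h : TendstoL2 f g) {W : Cn n → ℝ} (hW : Continuous W)
    {M : ℝ} (hM : ∀ z, W z ≤ M) (hW0 : ∀ z, 0 ≤ W z) :
    Tendsto (fun i => ∫ z, W z * ‖f i z‖ ^ 2) atTop (𝓝 (∫ z, W z * ‖g z‖ ^ 2)) := by
  have h1 := h.mul_bounded (W := fun z => (√(W z) : ℂ)) (M := √M)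
    (continuous_ofReal.comp (Real.continuous_sqrt.comp hW)).aestronglyMeasurable fun z => by
      rw [norm_real, Real.norm_eq_abs, abs_of_nonneg (Real.sqrt_nonneg _)]
      exact Real.sqrt_le_sqrt (hM z)
  have h2 := (h1.tendsto.norm).pow 2
  simp only [norm_toLp_sq] at h2
  have e1 : ∀ (u : Cn n → ℂ) z, ‖u z * (√(W z) : ℂ)‖ ^ 2 = W z * ‖u z‖ ^ 2 := fun u z => by
    rw [norm_mul, norm_real, Real.norm_eq_abs, mul_pow, sq_abs, Real.sq_sqrt (hW0 z), mul_comm]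
  simpa only [e1] using h2

lemma integrable_mul_sq {u : Cn n → ℂ} (hu : MemLp u 2 volume) {W : Cn n → ℝ} (hW : Continuous W)
    {M : ℝ} (hM : ∀ z, |W z| ≤ M) : Integrable (fun z => W z * ‖u z‖ ^ 2) :=
  hu.integrable_norm_pow (by norm_num) |>.bdd_mul hW.aestronglyMeasurable (.of_forall hM)

end TendstoL2

lemma hasCompactSupport_moll {b : Cn n → ℂ} {K : Set (Cn n)} (hK : IsCompact K)
    (hbK : ∀ z ∉ K, b z = 0) (i : ℕ) : HasCompactSupport (moll i b) := by
  refine HasCompactSupport.intro (hK.cthickening (r := 1 / ((i : ℝ) + 1))) fun x hx => ?_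
  refine moll_eq_zero fun y hy => hbK y fun hyK => hx ?_
  rw [← dist_eq_norm] at hy
  exact thickening_subset_cthickening _ _ (mem_thickening_iff.2 ⟨y, hyK, hy⟩)

lemma contDiff_moll {b : Cn n → ℂ} (hb : LocallyIntegrable b) {m : ℕ∞} (i : ℕ) :
    ContDiff ℝ m (moll i b) :=
  contDiff_cv (contDiff_ofReal_mker i) (hasCompactSupport_ofReal_mker i) hb

lemma tendstoL2_moll {b : Cn n → ℂ} (hb : MemLp b 2 volume) {K : Set (Cn n)} (hK : IsCompact K)
    (hbK : ∀ z ∉ K, b z = 0) : TendstoL2 (fun i => moll i b) b := by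
  have h1 : ∀ i, MemLp (moll i b) 2 volume := fun i =>
    (contDiff_moll (m := 0) (hb.locallyIntegrable (by norm_num))
      i).continuous.memLp_of_hasCompactSupport (hasCompactSupport_moll hK hbK i)
  refine ⟨h1, hb, ?_⟩
  rw [Lp.tendsto_Lp_iff_tendsto_eLpNorm'']
  have h2 := (ENNReal.continuous_rpow_const (y := (1 / 2 : ℝ))).tendsto 0 |>.comp
    (tendsto_lintegral_moll_sub_sq hb)
  rw [ENNReal.zero_rpow_of_pos (by norm_num)] at h2
  refine h2.congr fun i => ?_
  rw [eLpNorm_eq_lintegral_rpow_enorm_toReal (by norm_num) (by norm_num)]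
  simp

end TendstoL2

section WeakEstimate

open Filter Topology

variable {Φ m : Cn n → ℝ} {K U : Set (Cn n)} {b : Fin n → Cn n → ℂ} {h : Cn n → ℂ}
  {G : Fin n → Fin n → Cn n → ℂ}

lemma sum_wirt_moll (hb : ∀ j, MemLp (b j) 2 volume)
    (hdiv : ∀ t : Cn n → ℂ, CTest ((⊤ : ℕ∞) : WithTop ℕ∞) univ t →
      ∫ z, ∑ j, b j z * wirt (-I) t z j = -∫ z, h z * t z) (i : ℕ) (x : Cn n) :
    ∑ j, wirt (-I) (moll i (b j)) x j = moll i h x := by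
  have ht : CTest ((⊤ : ℕ∞) : WithTop ℕ∞) univ (fun y => (mker i (x - y) : ℂ)) :=
    ⟨(contDiff_ofReal_mker i (m := ⊤)).comp (contDiff_const.sub contDiff_id),
      (hasCompactSupport_ofReal_mker i).comp_homeomorph (Homeomorph.subLeft x), subset_univ _⟩
  have hbl : ∀ j, LocallyIntegrable (b j) := fun j => (hb j).locallyIntegrable (by norm_num)
  simp only [fun j => wirt_moll (-I) i (hbl j) x j, Finset.sum_neg_distrib]
  rw [← integral_finsetSum _ fun j _ => ((ht.of_le (m' := 1) (by simp)).wirt_zero (-I) j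
    ).integrable_mul ((hbl j).locallyIntegrableOn _), hdiv _ ht, neg_neg]
  exact integral_congr_ae (.of_forall fun y => mul_comm _ _)

lemma wirt_moll_sub (hb : ∀ j, MemLp (b j) 2 volume)
    (hcurl : ∀ t : Cn n → ℂ, CTest ((⊤ : ℕ∞) : WithTop ℕ∞) univ t → ∀ j k,
      ∫ z, (b j z * wirt I t z k - b k z * wirt I t z j) = -∫ z, G j k z * t z)
    (i : ℕ) (x : Cn n) (j k : Fin n) :
    wirt I (moll i (b j)) x k - wirt I (moll i (b k)) x j = moll i (G j k) x := by
  have ht : CTest ((⊤ : ℕ∞) : WithTop ℕ∞) univ (fun y => (mker i (x - y) : ℂ)) :=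
    ⟨(contDiff_ofReal_mker i (m := ⊤)).comp (contDiff_const.sub contDiff_id),
      (hasCompactSupport_ofReal_mker i).comp_homeomorph (Homeomorph.subLeft x), subset_univ _⟩
  have hbl : ∀ j, LocallyIntegrable (b j) := fun j => (hb j).locallyIntegrable (by norm_num)
  have hi : ∀ j k, Integrable fun y => b j y * wirt I (fun y => (mker i (x - y) : ℂ)) y k :=
    fun j k => ((ht.of_le (m' := 1) (by simp)).wirt_zero I k
    ).integrable_mul ((hbl j).locallyIntegrableOn _)
  have h1 := hcurl _ ht j k
  rw [integral_sub (hi j k) (hi k j)] at h1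
  rw [wirt_moll I i (hbl j), wirt_moll I i (hbl k), moll, cv]
  have h2 : ∫ y, (mker i (x - y) : ℂ) * G j k y = ∫ y, G j k y * (mker i (x - y) : ℂ) :=
    integral_congr_ae (.of_forall fun y => mul_comm _ _)
  rw [h2]
  linear_combination -h1

/-- The basic estimate for compactly supported `L²` forms with distributional derivatives
in `L²`. -/
lemma integral_mul_normSq_le (hΦ : ContDiff ℝ 2 Φ) (hΦc : HasCompactSupport Φ)
    (hm : Continuous m) (hmc : HasCompactSupport m) (hm0 : ∀ z, 0 ≤ m z)
    (hK : IsCompact K) (hU : IsOpen U) (hKU : K ⊆ U)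
    (hL : ∀ z ∈ U, ∀ w, m z * ‖w‖ ^ 2 ≤ LeviForm Φ z w)
    (hb : ∀ j, MemLp (b j) 2 volume) (hbK : ∀ j, ∀ z ∉ K, b j z = 0)
    (hh : MemLp h 2 volume) (hhK : ∀ z ∉ K, h z = 0)
    (hG : ∀ j k, MemLp (G j k) 2 volume) (hGK : ∀ j k, ∀ z ∉ K, G j k z = 0)
    (hdiv : ∀ t : Cn n → ℂ, CTest ((⊤ : ℕ∞) : WithTop ℕ∞) univ t →
      ∫ z, ∑ j, b j z * wirt (-I) t z j = -∫ z, h z * t z)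
    (hcurl : ∀ t : Cn n → ℂ, CTest ((⊤ : ℕ∞) : WithTop ℕ∞) univ t → ∀ j k,
      ∫ z, (b j z * wirt I t z k - b k z * wirt I t z j) = -∫ z, G j k z * t z) :
    ∫ z, m z * Real.exp (-Φ z) * ∑ j, ‖b j z‖ ^ 2 ≤
      ∫ z, Real.exp (-Φ z) * (‖h z - ∑ j, b j z * wirt (-I) (fun y => (Φ y : ℂ)) z j‖ ^ 2 +
        1 / 2 * ∑ j, ∑ k, ‖G j k z‖ ^ 2) := by
  have hE : Continuous fun z => Real.exp (-Φ z) := Real.continuous_exp.comp hΦ.continuous.neg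
  obtain ⟨CΦ, hCΦ⟩ := hΦ.continuous.bounded_above_of_compact_support hΦc
  have hEb : ∀ z, Real.exp (-Φ z) ≤ Real.exp CΦ := fun z =>
    Real.exp_le_exp.2 ((neg_le_abs _).trans (hCΦ z))
  have hE0 : ∀ z, 0 ≤ Real.exp (-Φ z) := fun z => (Real.exp_pos _).le
  have hmE : Continuous fun z => m z * Real.exp (-Φ z) := hm.mul hE
  obtain ⟨CmE, hCmE⟩ := hmE.bounded_above_of_compact_support hmc.mul_right
  have hmE0 : ∀ z, 0 ≤ m z * Real.exp (-Φ z) := fun z => mul_nonneg (hm0 z) (hE0 z)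
  have hdΦ : ∀ j, ∃ M, ∀ z, ‖wirt (-I) (fun y => (Φ y : ℂ)) z j‖ ≤ M := fun j =>
    (contDiff_one_wirt (-I) (contDiff_ofReal_comp hΦ) j).continuous.bounded_above_of_compact_support
      (hasCompactSupport_wirt (-I) (hΦc.comp_left (g := fun x : ℝ => (x : ℂ)) (by simp)) j)
  choose MΦ hMΦ using hdΦ
  have hbl : ∀ j, LocallyIntegrable (b j) := fun j => (hb j).locallyIntegrable (by norm_num)
  let β : ℕ → Fin n → Cn n → ℂ := fun i j => moll i (b j)
  have hβ : ∀ i j, ContDiff ℝ 2 (β i j) := fun i j => contDiff_moll (m := 2) (hbl j) i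
  have hβc : ∀ i j, HasCompactSupport (β i j) := fun i j => hasCompactSupport_moll hK (hbK j) i
  have Tb : ∀ j, TendstoL2 (fun i => β i j) (b j) := fun j => tendstoL2_moll (hb j) hK (hbK j)
  have TG : ∀ j k, TendstoL2 (fun i => moll i (G j k)) (G j k) := fun j k =>
    tendstoL2_moll (hG j k) hK (hGK j k)
  have TD : TendstoL2
      (fun i z => moll i h z - ∑ j, β i j z * wirt (-I) (fun y => (Φ y : ℂ)) z j)
      (fun z => h z - ∑ j, b j z * wirt (-I) (fun y => (Φ y : ℂ)) z j) :=
    (tendstoL2_moll hh hK hhK).sub (TendstoL2.sum _ fun j => (Tb j).mul_bounded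
      (contDiff_one_wirt (-I) (contDiff_ofReal_comp hΦ) j).continuous.aestronglyMeasurable (hMΦ j))
  have iE : ∀ {u : Cn n → ℂ}, MemLp u 2 volume →
      Integrable (fun z => Real.exp (-Φ z) * ‖u z‖ ^ 2) := fun hu =>
    TendstoL2.integrable_mul_sq hu hE (M := Real.exp CΦ)
      fun z => by rw [abs_of_nonneg (hE0 z)]; exact hEb z
  have imE : ∀ {u : Cn n → ℂ}, MemLp u 2 volume →
      Integrable (fun z => m z * Real.exp (-Φ z) * ‖u z‖ ^ 2) := fun hu =>
    TendstoL2.integrable_mul_sq hu hmE hCmE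
  have eL : ∀ b : Fin n → Cn n → ℂ, (∀ j, MemLp (b j) 2 volume) →
      ∫ z, m z * Real.exp (-Φ z) * ∑ j, ‖b j z‖ ^ 2 =
        ∑ j, ∫ z, m z * Real.exp (-Φ z) * ‖b j z‖ ^ 2 := fun b hb => by
    rw [← integral_finsetSum _ fun j _ => imE (hb j)]
    simp only [Finset.mul_sum]
  have eR : ∀ (D : Cn n → ℂ) (G : Fin n → Fin n → Cn n → ℂ), MemLp D 2 volume →
      (∀ j k, MemLp (G j k) 2 volume) →
      ∫ z, Real.exp (-Φ z) * (‖D z‖ ^ 2 + 1 / 2 * ∑ j, ∑ k, ‖G j k z‖ ^ 2) =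
        (∫ z, Real.exp (-Φ z) * ‖D z‖ ^ 2) +
          1 / 2 * ∑ j, ∑ k, ∫ z, Real.exp (-Φ z) * ‖G j k z‖ ^ 2 := fun D G hD hG => by
    simp only [← integral_finsetSum _ fun k _ => iE (hG _ k)]
    rw [← integral_finsetSum _ fun j _ => integrable_finsetSum _ fun k _ => iE (hG j k),
      ← integral_const_mul, ← integral_add (iE hD) ((integrable_finsetSum _ fun j _ =>
        integrable_finsetSum _ fun k _ => iE (hG j k)).const_mul _)]
    refine integral_congr_ae (.of_forall fun z => ?_)
    simp only [Finset.mul_sum, mul_add]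
    congr 1
    refine Finset.sum_congr rfl fun j _ => Finset.sum_congr rfl fun k _ => by ring
  have hlimL : Tendsto (fun i => ∫ z, m z * Real.exp (-Φ z) * ∑ j, ‖β i j z‖ ^ 2) atTop
      (𝓝 (∫ z, m z * Real.exp (-Φ z) * ∑ j, ‖b j z‖ ^ 2)) := by
    rw [eL b hb]
    simp only [fun i => eL (β i) fun j => (Tb j).memLp i]
    exact tendsto_finsetSum _ fun j _ => (Tb j).tendsto_integral hmE
      (fun z => (le_abs_self _).trans (hCmE z)) hmE0
  have hlimR := (TD.tendsto_integral hE hEb hE0).add ((tendsto_finsetSum Finset.univ fun j _ =>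
    tendsto_finsetSum Finset.univ fun k _ => (TG j k).tendsto_integral hE hEb hE0).const_mul
      (1 / 2))
  rw [eR _ _ TD.memLp_lim hG]
  refine le_of_tendsto_of_tendsto hlimL hlimR ?_
  obtain ⟨δ, hδ, hδU⟩ := hK.exists_thickening_subset_open hU hKU
  filter_upwards [tendsto_one_div_add_atTop_nhds_zero_nat.eventually (gt_mem_nhds hδ)] with i hi
  rw [← eR _ _ (TD.memLp i) fun j k => (TG j k).memLp i]
  have hβU : ∀ j, ∀ z ∉ U, β i j z = 0 := fun j z hz => moll_eq_zero fun y hy => hbK j y fun hyK =>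
    hz (hδU (mem_thickening_iff.2 ⟨y, hyK, by rw [dist_eq_norm]; exact hy.trans hi⟩))
  refine le_trans ?_ ((integral_leviForm_le hΦ (hβ i) (hβc i)).trans (le_of_eq ?_))
  · have hcβ : Continuous fun z => (WithLp.toLp 2 fun j => β i j z : Cn n) :=
      (PiLp.continuous_toLp 2 _).comp (continuous_pi fun j => (hβ i j).continuous)
    refine integral_mono ?_ ?_ fun z => ?_
    · simp only [Finset.mul_sum]
      exact integrable_finsetSum _ fun j _ => imE ((Tb j).memLp i)
    · have hcL : Continuous fun z => LeviForm Φ z (WithLp.toLp 2 fun j => β i j z) := by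
        have h1 : Continuous (fderiv ℝ (fderiv ℝ Φ)) :=
          (hΦ.fderiv_right (m := 1) (by norm_num)).continuous_fderiv (by simp)
        unfold LeviForm
        exact continuous_const.mul (((h1.clm_apply hcβ).clm_apply hcβ).add
          ((h1.clm_apply (hcβ.const_smul I)).clm_apply (hcβ.const_smul I)))
      refine (hcL.mul hE).integrable_of_hasCompactSupport (HasCompactSupport.intro
        (hK.cthickening (r := δ)) fun z hz => ?_)
      have : (fun j => β i j z) = 0 := funext fun j => moll_eq_zero fun y hy => hbK j y fun hyK =>
        hz (thickening_subset_cthickening _ _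
          (mem_thickening_iff.2 ⟨y, hyK, by rw [dist_eq_norm]; exact hy.trans hi⟩))
      simp [this, LeviForm]
    · simp only
      rw [mul_right_comm]
      refine mul_le_mul_of_nonneg_right ?_ (hE0 z)
      by_cases hz : z ∈ U
      · have := hL z hz (WithLp.toLp 2 fun j => β i j z)
        rwa [EuclideanSpace.norm_sq_eq] at this
      · have : (fun j => β i j z) = 0 := funext fun j => hβU j z hz
        rw [this]
        simp [LeviForm, fun j => hβU j z hz]
  · refine integral_congr_ae (.of_forall fun z => ?_)
    simp only [wdel, Finset.sum_sub_distrib, β, sum_wirt_moll hb hdiv, wirt_moll_sub hb hcurl]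
    rw [mul_comm]
    simp only [mul_comm (wirt _ _ _ _) (moll _ _ _)]

end WeakEstimate

section Projection

open scoped InnerProductSpace

variable {Ω : Set (Cn n)}

lemma exists_projection_orthogonal {H : Type*} [NormedAddCommGroup H] [InnerProductSpace ℂ H]
    [CompleteSpace H] (S : Set H) (A : H) :
    ∃ B : H, (∀ s ∈ S, ⟪s, B⟫_ℂ = 0) ∧
      ∀ G : H, (∀ s ∈ S, ⟪s, G⟫_ℂ = 0) → ⟪G, A⟫_ℂ = ⟪G, B⟫_ℂ := by
  set K := (Submodule.span ℂ S).topologicalClosure with hK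
  have : CompleteSpace K := (Submodule.isClosed_topologicalClosure _).completeSpace_coe
  obtain ⟨y, hy, z, hz, rfl⟩ := K.exists_add_mem_mem_orthogonal A
  have hSK : ∀ s ∈ S, s ∈ K := fun s hs =>
    Submodule.le_topologicalClosure _ (Submodule.subset_span hs)
  refine ⟨z, fun s hs => hz s (hSK s hs), fun G hG => ?_⟩
  have hGK : G ∈ Kᗮ := by
    rw [hK, Submodule.orthogonal_closure]
    refine (Submodule.mem_orthogonal _ _).2 fun u hu => ?_
    induction hu using Submodule.span_induction with
    | mem x hx => exact hG x hx
    | zero => simp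
    | add x y _ _ hx hy => simp [inner_add_left, hx, hy]
    | smul c x _ hx => simp [inner_smul_left, hx]
  rw [inner_add_right, Submodule.inner_left_of_mem_orthogonal hy hGK, zero_add]

/-- The vector field with given components. -/
def vec (u : Fin n → Cn n → ℂ) (z : Cn n) : Cn n := WithLp.toLp 2 fun j => u j z

@[simp] lemma vec_apply (u : Fin n → Cn n → ℂ) (z : Cn n) (j : Fin n) : vec u z j = u j z := rfl

lemma memLp_vec {μ : Measure (Cn n)} {u : Fin n → Cn n → ℂ} (hu : ∀ j, MemLp (u j) 2 μ) :
    MemLp (vec u) 2 μ :=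
  MemLp.of_eval_piLp hu

lemma CTest.memLp {t : Cn n → ℂ} {m : WithTop ℕ∞} (ht : CTest m Ω t) :
    MemLp t 2 (volume.restrict Ω) :=
  (ht.continuous.memLp_of_hasCompactSupport ht.compact).restrict Ω

lemma inner_Lp_eq {μ : Measure (Cn n)} {F G : Lp (Cn n) 2 μ} {f g : Cn n → Cn n} (hF : F =ᵐ[μ] f)
    (hG : G =ᵐ[μ] g) : ⟪F, G⟫_ℂ = ∫ z, ∑ j, g z j * conj (f z j) ∂μ := by
  rw [L2.inner_def]
  refine integral_congr_ae ?_
  filter_upwards [hF, hG] with z hf hg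
  rw [hf, hg, PiLp.inner_apply]
  rfl

lemma contDiffOn_ofReal_exp {m : WithTop ℕ∞} {Θ : Cn n → ℝ} (hΘ : ContDiffOn ℝ m Θ Ω) (c : ℝ) :
    ContDiffOn ℝ m (fun z => (Real.exp (c * Θ z) : ℂ)) Ω :=
  (ofRealCLM.contDiff (n := m)).comp_contDiffOn
    (Real.contDiff_exp.comp_contDiffOn (contDiffOn_const.mul hΘ))

/-- The vector field whose orthogonality expresses the `(j, k)` component of `∂̄g = 0`. -/
def curlField (Θ : Cn n → ℝ) (w : Cn n → ℂ) (j k l : Fin n) (z : Cn n) : ℂ :=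
  ((if l = j then conj (wirt I w z k) else 0) - (if l = k then conj (wirt I w z j) else 0)) *
    (Real.exp (1 / 2 * Θ z) : ℂ)

lemma memLp_curlField (hΩ : IsOpen Ω) {Θ : Cn n → ℝ} (hΘ : ContDiffOn ℝ 2 Θ Ω) {w : Cn n → ℂ}
    (hw : CTest 2 Ω w) (j k l : Fin n) : MemLp (curlField Θ w j k l) 2 (volume.restrict Ω) := by
  have hE := contDiffOn_ofReal_exp hΘ (1 / 2)
  have h1 : ∀ k, MemLp (fun z => conj (wirt I w z k) * (Real.exp (1 / 2 * Θ z) : ℂ)) 2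
      (volume.restrict Ω) := fun k =>
    ((hw.wirt_one I k).star.mul_contDiffOn hΩ (hE.of_le one_le_two)).memLp
  have h2 : ∀ (p : Prop) [Decidable p] (k), MemLp (fun z => (if p then conj (wirt I w z k) else 0) *
      (Real.exp (1 / 2 * Θ z) : ℂ)) 2 (volume.restrict Ω) := by
    intro p _ k
    split_ifs
    · exact h1 k
    · simp
  exact ((h2 (l = j) k).sub (h2 (l = k) j)).ae_eq (.of_forall fun z => by simp [curlField, sub_mul])

lemma sum_mul_conj_curlField (Θ : Cn n → ℝ) (w : Cn n → ℂ) (j k : Fin n) (b : Fin n → ℂ)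
    (z : Cn n) : ∑ l, b l * conj (curlField Θ w j k l z) =
      (b j * wirt I w z k - b k * wirt I w z j) * (Real.exp (1 / 2 * Θ z) : ℂ) := by
  simp only [curlField, map_mul, map_sub, conj_ofReal, sub_mul, mul_sub, Finset.sum_sub_distrib]
  simp only [apply_ite conj, conj_conj, map_zero, ite_mul, mul_ite, zero_mul, mul_zero,
    Finset.sum_ite_eq', Finset.mem_univ, if_true]
  ring

lemma integral_wirt_mul_wirt_sub {w' w : Cn n → ℂ} (hw' : CTest 2 Ω w') (hw : CTest 2 Ω w)
    (j k : Fin n) :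
    ∫ z, (wirt I w' z j * wirt I w z k - wirt I w' z k * wirt I w z j) = 0 := by
  have h : ∀ j k, ∫ z, wirt I w' z j * wirt I w z k =
      -∫ z, w' z * wirt I (fun y => wirt I w y k) z j :=
    fun j k => integral_wirt_mul I (hw'.contDiff.of_le one_le_two)
      (hw.wirt_one I k).contDiff (hw.wirt_one I k).compact j
  have hi : ∀ j k, Integrable fun z => wirt I w' z j * wirt I w z k := fun j k =>
    (hw.wirt_one I k).integrable_mul
      ((hw'.wirt_one I j).continuous.locallyIntegrable (μ := volume)|>.locallyIntegrableOn Ω)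
  rw [integral_sub (hi _ _) (hi _ _), h, h]
  simp_rw [wirt_comm I I hw.contDiff _ k j, sub_self]

lemma ofReal_exp_mul (x y z : ℝ) : (Real.exp (x * z) : ℂ) * (Real.exp (y * z) : ℂ) =
    (Real.exp ((x + y) * z) : ℂ) := by
  rw [← ofReal_mul, ← Real.exp_add, add_mul]

lemma wirt_mul_exp {Θ : Cn n → ℝ} {t : Cn n → ℂ} {z : Cn n} (hΘ : DifferentiableAt ℝ Θ z)
    (ht : DifferentiableAt ℝ t z) (j : Fin n) :
    wirt (-I) (fun y => t y * (Real.exp (1 * Θ y) : ℂ)) z j =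
      (wirt (-I) t z j + t z * wirt (-I) (fun y => (Θ y : ℂ)) z j) * (Real.exp (1 * Θ z) : ℂ) := by
  have h := wirt_mul_exp_neg (Φ := fun y => -Θ y) hΘ.neg ht j
  have h2 := wirt_ofReal_comp (-I) (hasDerivAt_neg (Θ z)) hΘ j
  simp only [neg_neg, wdel] at h
  simp only [one_mul]
  rw [h, h2]
  push_cast
  ring

/-- Projection of a form `α` onto the closed forms of `L²(Ω, e^{-Θ})`. -/
lemma exists_projection_closed (hΩ : IsOpen Ω) {Θ : Cn n → ℝ} (hΘ : ContDiffOn ℝ 2 Θ Ω)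
    {α : Fin n → Cn n → ℂ} (hα : ∀ j, CTest 1 Ω (α j)) :
    ∃ a : Fin n → Cn n → ℂ,
      (∀ j, MemLp (fun z => a j z * (Real.exp (-(1 / 2) * Θ z) : ℂ)) 2 (volume.restrict Ω)) ∧
      (∀ w, CTest 2 Ω w → ∀ j k,
        ∫ z in Ω, (a j z * wirt I w z k - a k z * wirt I w z j) = 0) ∧
      (∀ t, CTest 2 Ω t →
        ∫ z in Ω, ∑ j, a j z * (wirt (-I) t z j + t z * wirt (-I) (fun y => (Θ y : ℂ)) z j) =
          -∫ z in Ω, (∑ j, wdel Θ (α j) z j) * t z) ∧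
      ∀ g : Fin n → Cn n → ℂ,
        (∀ j, MemLp (fun z => g j z * (Real.exp (-(1 / 2) * Θ z) : ℂ)) 2 (volume.restrict Ω)) →
        (∀ w, CTest 2 Ω w → ∀ j k,
          ∫ z in Ω, (g j z * wirt I w z k - g k z * wirt I w z j) = 0) →
        ∫ z in Ω, (∑ j, g j z * conj (α j z)) * (Real.exp (-Θ z) : ℂ) =
          ∫ z in Ω, (∑ j, g j z * conj (a j z)) * (Real.exp (-Θ z) : ℂ) := by
  set μ := (volume : Measure (Cn n)).restrict Ω with hμ
  have hE := contDiffOn_ofReal_exp hΘ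
  have hA : MemLp (vec fun j z => α j z * (Real.exp (-(1 / 2) * Θ z) : ℂ)) 2 μ :=
    memLp_vec fun j => ((hα j).mul_contDiffOn hΩ ((hE _).of_le one_le_two)).memLp
  obtain ⟨B, hB, hBA⟩ := exists_projection_orthogonal
    {F : Lp (Cn n) 2 μ | ∃ w j k, CTest 2 Ω w ∧ F =ᵐ[μ] vec (curlField Θ w j k)} (hA.toLp _)
  have hE1 : ∀ z, (Real.exp (1 / 2 * Θ z) : ℂ) * (Real.exp (-(1 / 2) * Θ z) : ℂ) = 1 := fun z => by
    rw [ofReal_exp_mul]; simp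
  have hE2 : ∀ z, (Real.exp (-(1 / 2) * Θ z) : ℂ) * (Real.exp (-(1 / 2) * Θ z) : ℂ) =
      (Real.exp (-Θ z) : ℂ) := fun z => by
    rw [ofReal_exp_mul]; norm_num
  have key : ∀ g : Fin n → Cn n → ℂ,
      (hg : ∀ j, MemLp (fun z => g j z * (Real.exp (-(1 / 2) * Θ z) : ℂ)) 2 μ) →
      (∀ w, CTest 2 Ω w → ∀ j k, ∫ z in Ω, (g j z * wirt I w z k - g k z * wirt I w z j) = 0) →
      ⟪(memLp_vec hg).toLp _, hA.toLp _⟫_ℂ = ⟪(memLp_vec hg).toLp _, B⟫_ℂ := by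
    intro g hg hc
    refine hBA _ ?_
    rintro s ⟨w, j, k, hw, hs⟩
    rw [inner_Lp_eq hs (memLp_vec hg).coeFn_toLp]
    simp only [vec_apply, sum_mul_conj_curlField]
    rw [← hc w hw j k]
    refine integral_congr_ae (.of_forall fun z => ?_)
    dsimp only
    linear_combination (g j z * wirt I w z k - g k z * wirt I w z j) * hE1 z
  refine ⟨fun j z => (Real.exp (1 / 2 * Θ z) : ℂ) * B z j, fun j => ?_, fun w hw j k => ?_,
    fun t ht => ?_, fun g hg hc => ?_⟩
  · refine ((Lp.memLp B).eval_piLp j).ae_eq (.of_forall fun z => ?_)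
    dsimp only
    linear_combination (- B z j) * hE1 z
  · have h := hB ((memLp_vec fun l => memLp_curlField hΩ hΘ hw j k l).toLp _)
      ⟨w, j, k, hw, MemLp.coeFn_toLp _⟩
    rw [inner_Lp_eq (MemLp.coeFn_toLp _) (.refl _ _)] at h
    simp only [vec_apply, sum_mul_conj_curlField] at h
    rw [← h]
    refine integral_congr_ae (.of_forall fun z => ?_)
    dsimp only
    ring
  · have ht' : CTest 2 Ω fun z => t z * (Real.exp (1 * Θ z) : ℂ) := ht.mul_contDiffOn hΩ (hE 1)
    have hw := ht'.star
    set w := fun z => conj (t z * (Real.exp (1 * Θ z) : ℂ)) with hwdef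
    have hg : ∀ j, MemLp (fun z => wirt I w z j * (Real.exp (-(1 / 2) * Θ z) : ℂ)) 2 μ := fun j =>
      ((hw.wirt_one I j).mul_contDiffOn hΩ ((hE _).of_le one_le_two)).memLp
    have h := key (fun j z => wirt I w z j) hg fun w' hw' j k => by
      rw [setIntegral_eq_integral_of_forall_compl_eq_zero, integral_wirt_mul_wirt_sub hw hw']
      intro z hz
      simp [(hw'.wirt_one I _).eq_zero hz]
    rw [inner_Lp_eq (MemLp.coeFn_toLp _) (MemLp.coeFn_toLp _),
      inner_Lp_eq (MemLp.coeFn_toLp _) (.refl _ _)] at h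
    have hw1 : ∀ z j, conj (wirt I w z j) =
        wirt (-I) (fun z => t z * (Real.exp (1 * Θ z) : ℂ)) z j := fun z j => by
      rw [hwdef, wirt_conj I (ht'.contDiff.differentiable two_ne_zero z), conj_conj, conj_I]
    have hE3 : ∀ z, (Real.exp (1 * Θ z) : ℂ) * (Real.exp (-Θ z) : ℂ) = 1 := fun z => by
      rw [← ofReal_mul, ← Real.exp_add]; simp
    have hE4 : ∀ z, (Real.exp (1 * Θ z) : ℂ) * (Real.exp (-(1 / 2) * Θ z) : ℂ) =
        (Real.exp (1 / 2 * Θ z) : ℂ) := fun z => by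
      rw [ofReal_exp_mul]; norm_num
    have hd : ∀ z ∈ Ω, DifferentiableAt ℝ Θ z := fun z hz =>
      (hΘ.contDiffAt (hΩ.mem_nhds hz)).differentiableAt two_ne_zero
    have e1 : ∫ z in Ω, ∑ j, (Real.exp (1 / 2 * Θ z) : ℂ) * B z j *
        (wirt (-I) t z j + t z * wirt (-I) (fun y => (Θ y : ℂ)) z j) =
        ∫ z in Ω, ∑ j, B z j * conj (wirt I w z j * (Real.exp (-(1 / 2) * Θ z) : ℂ)) := by
      refine setIntegral_congr_fun hΩ.measurableSet fun z hz => ?_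
      refine Finset.sum_congr rfl fun j _ => ?_
      rw [map_mul, hw1, conj_ofReal, wirt_mul_exp (hd z hz)
        (ht.contDiff.differentiable two_ne_zero z),
        mul_comm (_ + _), mul_assoc (Real.exp _ : ℂ), mul_comm (Real.exp _ : ℂ),
        ← hE4 z]
      ring
    have e2 : ∫ z in Ω, (∑ j, wdel Θ (α j) z j) * t z =
        -∫ z in Ω, ∑ j, α j z * (Real.exp (-(1 / 2) * Θ z) : ℂ) *
          conj (wirt I w z j * (Real.exp (-(1 / 2) * Θ z) : ℂ)) := by
      have hαE : ∀ j, CTest 1 Ω fun z => α j z * (Real.exp (-Θ z) : ℂ) := fun j =>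
        (hα j).mul_contDiffOn hΩ (by simpa using (hE (-1)).of_le one_le_two)
      have e3 : ∀ j, ∫ z in Ω, wdel Θ (α j) z j * t z = -∫ z in Ω,
          α j z * (Real.exp (-(1 / 2) * Θ z) : ℂ) *
            conj (wirt I w z j * (Real.exp (-(1 / 2) * Θ z) : ℂ)) := by
        intro j
        calc _ = ∫ z in Ω, wirt (-I) (fun z => α j z * (Real.exp (-Θ z) : ℂ)) z j *
              (t z * (Real.exp (1 * Θ z) : ℂ)) := by
              refine setIntegral_congr_fun hΩ.measurableSet fun z hz => ?_
              rw [wirt_mul_exp_neg (hd z hz) ((hα j).contDiff.differentiable one_ne_zero z)]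
              linear_combination (-wdel Θ (α j) z j * t z) * hE3 z
          _ = ∫ z, wirt (-I) (fun z => α j z * (Real.exp (-Θ z) : ℂ)) z j *
              (t z * (Real.exp (1 * Θ z) : ℂ)) := ht'.setIntegral_mul _
          _ = -∫ z, α j z * (Real.exp (-Θ z) : ℂ) *
              wirt (-I) (fun z => t z * (Real.exp (1 * Θ z) : ℂ)) z j :=
              integral_wirt_mul (-I) (hαE j).contDiff (ht'.contDiff.of_le one_le_two) ht'.compact j
          _ = -∫ z in Ω, α j z * (Real.exp (-Θ z) : ℂ) *
              wirt (-I) (fun z => t z * (Real.exp (1 * Θ z) : ℂ)) z j := by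
              rw [(ht'.wirt_one (-I) j).setIntegral_mul]
          _ = _ := by
              congr 1
              refine integral_congr_ae (.of_forall fun z => ?_)
              dsimp only
              rw [map_mul, hw1, conj_ofReal]
              linear_combination (-α j z *
                wirt (-I) (fun z => t z * (Real.exp (1 * Θ z) : ℂ)) z j) * hE2 z
      simp only [Finset.sum_mul]
      rw [integral_finsetSum, integral_finsetSum, ← Finset.sum_neg_distrib]
      · exact Finset.sum_congr rfl fun j _ => e3 j
      · intro j _
        have := (((hα j).mul_contDiffOn hΩ ((hE (-(1 / 2))).of_le one_le_two)).continuous.mul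
          (((hw.wirt_one I j).mul_contDiffOn hΩ
            ((hE (-(1 / 2))).of_le one_le_two)).star.continuous)).integrable_of_hasCompactSupport
          ((hα j).compact.mul_right.mul_right) (μ := volume)
        exact this.integrableOn
      · intro j _
        refine (ht.integrable_mul ?_).integrableOn
        refine ContinuousOn.locallyIntegrableOn ?_ hΩ.measurableSet
        refine ((hα j).wirt_zero (-I) j).continuous.continuousOn.sub
          (ContinuousOn.mul ?_ (hα j).continuous.continuousOn)
        exact continuousOn_wirt (-I) hΩ
          ((ofRealCLM.contDiff (n := 1)).comp_contDiffOn (hΘ.of_le one_le_two)) j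
    rw [e1, e2, neg_neg]
    exact h.symm
  · have h := congrArg conj (key g hg hc)
    rw [inner_conj_symm, inner_conj_symm, inner_Lp_eq (MemLp.coeFn_toLp _) (MemLp.coeFn_toLp _),
      inner_Lp_eq (.refl _ _) (MemLp.coeFn_toLp _)] at h
    simp only [vec_apply, map_mul, conj_ofReal] at h
    calc _ = _ := integral_congr_ae (.of_forall fun z => ?_)
      _ = _ := h
      _ = _ := integral_congr_ae (.of_forall fun z => ?_)
    · rw [Finset.sum_mul]
      refine Finset.sum_congr rfl fun j _ => ?_
      linear_combination (- g j z * conj (α j z)) * hE2 z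
    · dsimp only
      rw [Finset.sum_mul]
      refine Finset.sum_congr rfl fun j _ => ?_
      rw [map_mul, conj_ofReal]
      linear_combination (- g j z * conj (B z j)) * (Real.exp (-(1 / 2) * Θ z) : ℂ) * hE1 z +
        g j z * conj (B z j) * (Real.exp (1 / 2 * Θ z) : ℂ) * hE2 z

end Projection

section Core

variable {Ω : Set (Cn n)}

lemma CTest.memLp_mul {a : Cn n → ℂ} {Θ : Cn n → ℝ} {T : Cn n → ℂ} (hT : CTest 0 Ω T)
    (hΩ : IsOpen Ω)
    (hΘ : ContDiffOn ℝ 0 Θ Ω)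
    (ha : MemLp (fun z => a z * (Real.exp (-(1 / 2) * Θ z) : ℂ)) 2 (volume.restrict Ω)) :
    MemLp (fun z => a z * T z) 2 volume := by
  have hT' := hT.mul_contDiffOn hΩ (contDiffOn_ofReal_exp hΘ (1 / 2))
  obtain ⟨M, hM⟩ := hT'.compact.exists_bound_of_continuous hT'.continuous
  have h1 : MemLp (fun z => a z * T z) 2 (volume.restrict Ω) := by
    have h2 := ha.mul (p := ⊤) (q := 2) (r := 2) (memLp_top_of_bound
      (hT'.continuous.aestronglyMeasurable (μ := volume.restrict Ω)) M (.of_forall hM))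
    refine h2.ae_eq (.of_forall fun z => ?_)
    have hE : (Real.exp (1 / 2 * Θ z) : ℂ) * (Real.exp (-(1 / 2) * Θ z) : ℂ) = 1 := by
      rw [ofReal_exp_mul]; simp
    simp only [Pi.mul_apply]
    linear_combination (a z * T z) * hE
  rw [← memLp_indicator_iff_restrict hΩ.measurableSet] at h1
  refine h1.ae_eq (.of_forall fun z => ?_)
  by_cases hz : z ∈ Ω
  · simp [hz]
  · simp [hz, hT.eq_zero hz]

lemma norm_add_sum_mul_sub_sq_le (c : ℂ) (s : ℝ) (a x y : Fin n → ℂ) :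
    ‖c + ∑ j, a j * (x j - s * y j)‖ ^ 2 ≤ 2 * ‖c‖ ^ 2 +
      (4 * ∑ j, ‖x j‖ ^ 2 + 4 * s ^ 2 * ∑ j, ‖y j‖ ^ 2) * ∑ j, ‖a j‖ ^ 2 := by
  have h1 : ‖∑ j, a j * (x j - s * y j)‖ ^ 2 ≤
      (∑ j, ‖a j‖ ^ 2) * ∑ j, ‖x j - s * y j‖ ^ 2 := by
    refine (pow_le_pow_left₀ (norm_nonneg _) (norm_sum_le _ _) 2).trans ?_
    simp only [norm_mul]
    exact Finset.sum_mul_sq_le_sq_mul_sq _ _ _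
  have h2 : ∑ j, ‖x j - s * y j‖ ^ 2 ≤ 2 * ∑ j, ‖x j‖ ^ 2 + 2 * s ^ 2 * ∑ j, ‖y j‖ ^ 2 := by
    rw [Finset.mul_sum, Finset.mul_sum, ← Finset.sum_add_distrib]
    refine Finset.sum_le_sum fun j _ => ?_
    have h3 := norm_sub_le (x j) (s * y j)
    rw [norm_mul, norm_real, Real.norm_eq_abs] at h3
    have h4 := pow_le_pow_left₀ (norm_nonneg _) h3 2
    nlinarith [sq_nonneg (‖x j‖ - |s| * ‖y j‖), sq_abs s]
  have h5 : (0 : ℝ) ≤ ∑ j, ‖a j‖ ^ 2 := by positivity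
  have h6 := pow_le_pow_left₀ (norm_nonneg _) (norm_add_le c (∑ j, a j * (x j - s * y j))) 2
  nlinarith [sq_nonneg (‖c‖ - ‖∑ j, a j * (x j - s * y j)‖), mul_le_mul_of_nonneg_left h2 h5]

lemma sum_sum_norm_mul_sub_mul_sq_le (a x : Fin n → ℂ) :
    ∑ j, ∑ k, ‖a j * x k - a k * x j‖ ^ 2 ≤ 4 * (∑ j, ‖x j‖ ^ 2) * ∑ j, ‖a j‖ ^ 2 := by
  have h : ∀ j k, ‖a j * x k - a k * x j‖ ^ 2 ≤
      2 * (‖a j‖ ^ 2 * ‖x k‖ ^ 2) + 2 * (‖x j‖ ^ 2 * ‖a k‖ ^ 2) := fun j k => by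
    have h3 := norm_sub_le (a j * x k) (a k * x j)
    have h4 := pow_le_pow_left₀ (norm_nonneg _) h3 2
    rw [norm_mul, norm_mul] at h4
    nlinarith [sq_nonneg (‖a j‖ * ‖x k‖ - ‖a k‖ * ‖x j‖)]
  refine (Finset.sum_le_sum fun j _ => Finset.sum_le_sum fun k _ => h j k).trans ?_
  simp only [Finset.sum_add_distrib, ← Finset.mul_sum, ← Finset.sum_mul]
  linarith

lemma CTest.contDiff_of_ofReal {m : WithTop ℕ∞} {f : Cn n → ℝ} (hf : CTest m Ω fun z => (f z : ℂ)) :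
    ContDiff ℝ m f := by
  exact reCLM.contDiff.comp hf.contDiff

lemma CTest.hasCompactSupport_of_ofReal {m : WithTop ℕ∞} {f : Cn n → ℝ}
    (hf : CTest m Ω fun z => (f z : ℂ)) : HasCompactSupport f := by
  simpa [Function.comp_def] using hf.compact.comp_left (g := re) zero_re

lemma CTest.ofReal_mul_contDiffOn {m : WithTop ℕ∞} {f F : Cn n → ℝ}
    (hf : CTest m Ω fun z => (f z : ℂ)) (hΩ : IsOpen Ω) (hF : ContDiffOn ℝ m F Ω) :
    CTest m Ω fun z => ((f z * F z : ℝ) : ℂ) := by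
  simpa using hf.mul_contDiffOn hΩ ((ofRealCLM.contDiff (n := m)).comp_contDiffOn hF)

variable {Θ χ : Cn n → ℝ} {a : Fin n → Cn n → ℂ} {η : Cn n → ℂ}

lemma integrable_sum_mul_wirt {b : Fin n → Cn n → ℂ} (hb : ∀ j, MemLp (b j) 2 volume)
    {t : Cn n → ℂ} (ht : CTest 1 univ t) (s : ℂ) :
    Integrable fun z => ∑ j, b j z * wirt s t z j :=
  integrable_finsetSum _ fun j _ => (ht.wirt_zero s _).integrable_mul
    (((hb j).locallyIntegrable (by norm_num)).locallyIntegrableOn _)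

lemma CTest.mul_ofReal_cutoff {t : Cn n → ℂ} (hχ : CTest 2 Ω fun z => (χ z : ℂ))
    (ht : ContDiff ℝ 2 t) : CTest 2 Ω fun z => χ z * t z :=
  ⟨hχ.contDiff.mul ht, hχ.compact.mul_right, tsupport_mul_subset_left.trans hχ.subset⟩

lemma integral_sum_cutoff_mul_wirt (hΩ : IsOpen Ω) (hΘ : ContDiffOn ℝ 2 Θ Ω)
    (hχ : CTest 2 Ω fun z => (χ z : ℂ)) (hη : CTest 0 Ω η)
    (ha : ∀ j, MemLp (fun z => a j z * (Real.exp (-(1 / 2) * Θ z) : ℂ)) 2 (volume.restrict Ω))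
    (hdiv : ∀ t, CTest 2 Ω t →
      ∫ z in Ω, ∑ j, a j z * (wirt (-I) t z j + t z * wirt (-I) (fun y => (Θ y : ℂ)) z j) =
        -∫ z in Ω, η z * t z)
    {t : Cn n → ℂ} (ht : CTest ((⊤ : ℕ∞) : WithTop ℕ∞) univ t) :
    MemLp (fun z => η z * χ z + ∑ j, a j z * (wirt (-I) (fun y => (χ y : ℂ)) z j +
      χ z * wirt (-I) (fun y => (Θ y : ℂ)) z j)) 2 volume ∧
    ∫ z, ∑ j, a j z * χ z * wirt (-I) t z j =
      -∫ z, (η z * χ z + ∑ j, a j z * (wirt (-I) (fun y => (χ y : ℂ)) z j +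
        χ z * wirt (-I) (fun y => (Θ y : ℂ)) z j)) * t z := by
  have hΘ0 : ContDiffOn ℝ 0 Θ Ω := hΘ.of_le (by norm_num)
  have hw : ∀ j, ContDiffOn ℝ 0 (fun z => wirt (-I) (fun y => (Θ y : ℂ)) z j) Ω := fun j =>
    contDiffOn_zero.2 (continuousOn_wirt (-I) hΩ
      ((ofRealCLM.contDiff (n := 1)).comp_contDiffOn (hΘ.of_le one_le_two)) j)
  have hT : ∀ j, CTest 0 Ω fun z => wirt (-I) (fun y => (χ y : ℂ)) z j +
      χ z * wirt (-I) (fun y => (Θ y : ℂ)) z j := fun j =>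
    ((hχ.wirt_one (-I) j).of_le (by norm_num)).add
      ((hχ.of_le (by norm_num)).mul_contDiffOn hΩ (hw j))
  have hηχ : CTest 0 Ω fun z => η z * χ z :=
    hη.mul_contDiffOn hΩ ((hχ.of_le (by norm_num)).contDiff.contDiffOn)
  have hh : MemLp (fun z => η z * χ z + ∑ j, a j z * (wirt (-I) (fun y => (χ y : ℂ)) z j +
      χ z * wirt (-I) (fun y => (Θ y : ℂ)) z j)) 2 volume :=
    (hηχ.continuous.memLp_of_hasCompactSupport hηχ.compact).add
      (memLp_finsetSum _ fun j _ => (hT j).memLp_mul hΩ hΘ0 (ha j))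
  refine ⟨hh, ?_⟩
  have ht2 : ContDiff ℝ 2 t := ht.contDiff.of_le (WithTop.coe_le_coe.2 (le_top : (2 : ℕ∞) ≤ ⊤))
  have ht1 : CTest 1 univ t := ht.of_le (WithTop.coe_le_coe.2 (le_top : (1 : ℕ∞) ≤ ⊤))
  have hχt := hχ.mul_ofReal_cutoff ht2
  have h0 := hdiv _ hχt
  have i1 := integrable_sum_mul_wirt (b := fun j z => a j z * χ z)
    (fun j => (hχ.of_le (by norm_num)).memLp_mul hΩ hΘ0 (ha j)) ht1 (-I)
  have i2 : Integrable fun z => (η z * χ z + ∑ j, a j z * (wirt (-I) (fun y => (χ y : ℂ)) z j +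
      χ z * wirt (-I) (fun y => (Θ y : ℂ)) z j)) * t z :=
    ht1.integrable_mul ((hh.locallyIntegrable (by norm_num)).locallyIntegrableOn _)
  have i3 : Integrable fun z => η z * (χ z * t z) :=
    hχt.integrable_mul (hη.continuous.locallyIntegrable.locallyIntegrableOn _)
  have e : ∀ z, ∑ j, a j z * (wirt (-I) (fun z => χ z * t z) z j +
      χ z * t z * wirt (-I) (fun y => (Θ y : ℂ)) z j) =
      (∑ j, a j z * χ z * wirt (-I) t z j) +
        (η z * χ z + ∑ j, a j z * (wirt (-I) (fun y => (χ y : ℂ)) z j +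
          χ z * wirt (-I) (fun y => (Θ y : ℂ)) z j)) * t z - η z * (χ z * t z) := fun z => by
    rw [add_mul, Finset.sum_mul, add_sub_assoc, add_sub_assoc, add_sub_left_comm]
    rw [mul_assoc, sub_self, add_zero]
    rw [← Finset.sum_add_distrib]
    refine Finset.sum_congr rfl fun j _ => ?_
    rw [wirt_mul _ (hχ.contDiff.differentiable two_ne_zero z) (ht2.differentiable two_ne_zero z)]
    ring
  rw [setIntegral_eq_integral_of_forall_compl_eq_zero, hχt.setIntegral_mul] at h0
  · simp only [e] at h0
    have i4 : Integrable fun z => (∑ j, a j z * χ z * wirt (-I) t z j) +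
        (η z * χ z + ∑ j, a j z * (wirt (-I) (fun y => (χ y : ℂ)) z j +
          χ z * wirt (-I) (fun y => (Θ y : ℂ)) z j)) * t z := i1.add i2
    rw [integral_sub i4 i3, integral_add i1 i2] at h0
    linear_combination h0
  · intro z hz
    refine Finset.sum_eq_zero fun j _ => ?_
    rw [(hχt.wirt_one _ _).eq_zero hz, hχt.eq_zero hz]
    simp

lemma integral_cutoff_mul_wirt_sub (hΩ : IsOpen Ω) (hΘ : ContDiffOn ℝ 0 Θ Ω)
    (hχ : CTest 2 Ω fun z => (χ z : ℂ))
    (ha : ∀ j, MemLp (fun z => a j z * (Real.exp (-(1 / 2) * Θ z) : ℂ)) 2 (volume.restrict Ω))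
    (hcurl : ∀ w, CTest 2 Ω w → ∀ j k,
      ∫ z in Ω, (a j z * wirt I w z k - a k z * wirt I w z j) = 0) (j k : Fin n) :
    MemLp (fun z => a j z * wirt I (fun y => (χ y : ℂ)) z k -
      a k z * wirt I (fun y => (χ y : ℂ)) z j) 2 volume ∧
    ∀ t : Cn n → ℂ, CTest ((⊤ : ℕ∞) : WithTop ℕ∞) univ t →
      ∫ z, (a j z * χ z * wirt I t z k - a k z * χ z * wirt I t z j) =
        -∫ z, (a j z * wirt I (fun y => (χ y : ℂ)) z k -
          a k z * wirt I (fun y => (χ y : ℂ)) z j) * t z := by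
  have hG : MemLp (fun z => a j z * wirt I (fun y => (χ y : ℂ)) z k -
      a k z * wirt I (fun y => (χ y : ℂ)) z j) 2 volume :=
    (((hχ.wirt_one I k).of_le (by norm_num)).memLp_mul hΩ hΘ (ha j)).sub
      (((hχ.wirt_one I j).of_le (by norm_num)).memLp_mul hΩ hΘ (ha k))
  refine ⟨hG, fun t ht => ?_⟩
  have ht2 : ContDiff ℝ 2 t := ht.contDiff.of_le (WithTop.coe_le_coe.2 (le_top : (2 : ℕ∞) ≤ ⊤))
  have ht1 : CTest 1 univ t := ht.of_le (WithTop.coe_le_coe.2 (le_top : (1 : ℕ∞) ≤ ⊤))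
  have hχt := hχ.mul_ofReal_cutoff ht2
  have h0 := hcurl _ hχt j k
  have hb : ∀ j, MemLp (fun z => a j z * χ z) 2 volume := fun j =>
    (hχ.of_le (by norm_num)).memLp_mul hΩ hΘ (ha j)
  have i1 : ∀ j k, Integrable fun z => a j z * χ z * wirt I t z k := fun j k =>
    (ht1.wirt_zero I k).integrable_mul
      (((hb j).locallyIntegrable (by norm_num)).locallyIntegrableOn _)
  have i2 := ht1.integrable_mul ((hG.locallyIntegrable (by norm_num)).locallyIntegrableOn _)
  rw [setIntegral_eq_integral_of_forall_compl_eq_zero] at h0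
  · have e : ∀ z, a j z * wirt I (fun z => χ z * t z) z k -
        a k z * wirt I (fun z => χ z * t z) z j =
        (a j z * χ z * wirt I t z k - a k z * χ z * wirt I t z j) +
          (a j z * wirt I (fun y => (χ y : ℂ)) z k -
          a k z * wirt I (fun y => (χ y : ℂ)) z j) * t z := fun z => by
      rw [wirt_mul _ (hχ.contDiff.differentiable two_ne_zero z) (ht2.differentiable two_ne_zero z),
        wirt_mul _ (hχ.contDiff.differentiable two_ne_zero z) (ht2.differentiable two_ne_zero z)]
      ring
    simp only [e] at h0
    have i3 : Integrable fun z => a j z * χ z * wirt I t z k - a k z * χ z * wirt I t z j :=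
      (i1 j k).sub (i1 k j)
    rw [integral_add i3 i2] at h0
    linear_combination h0
  · intro z hz
    rw [(hχt.wirt_one _ _).eq_zero hz, (hχt.wirt_one _ _).eq_zero hz]
    simp

end Core

section CutoffEstimate

variable {Ω : Set (Cn n)} {Φ ψ χ ξ : Cn n → ℝ} {a : Fin n → Cn n → ℂ} {η : Cn n → ℂ}

lemma leviForm_congr {f g : Cn n → ℝ} {z : Cn n} (h : f =ᶠ[nhds z] g) (w : Cn n) :
    LeviForm f z w = LeviForm g z w := by
  simp only [LeviForm, h.fderiv.fderiv_eq]

lemma continuousOn_exp {Θ : Cn n → ℝ} (hΘ : ContinuousOn Θ Ω) (c : ℝ) :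
    ContinuousOn (fun z => Real.exp (c * Θ z)) Ω :=
  Real.continuous_exp.comp_continuousOn (continuousOn_const.mul hΘ)

lemma norm_mul_ofReal_exp_sq (x : ℂ) (t : ℝ) :
    ‖x * (Real.exp (-(1 / 2) * t) : ℂ)‖ ^ 2 = ‖x‖ ^ 2 * Real.exp (-t) := by
  rw [norm_mul, mul_pow, norm_real, Real.norm_eq_abs, abs_of_pos (Real.exp_pos _),
    ← Real.exp_nat_mul]
  congr 2
  push_cast
  ring

lemma integrableOn_normSq_mul_exp {Θ : Cn n → ℝ} {u : Cn n → ℂ}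
    (hu : MemLp (fun z => u z * (Real.exp (-(1 / 2) * Θ z) : ℂ)) 2 (volume.restrict Ω)) :
    IntegrableOn (fun z => ‖u z‖ ^ 2 * Real.exp (-Θ z)) Ω := by
  have h := hu.integrable_norm_pow (by norm_num)
  refine h.congr (.of_forall fun z => ?_)
  exact norm_mul_ofReal_exp_sq _ _

lemma integrableOn_sum_normSq_mul_exp {Θ : Cn n → ℝ}
    (ha : ∀ j, MemLp (fun z => a j z * (Real.exp (-(1 / 2) * Θ z) : ℂ)) 2 (volume.restrict Ω)) :
    IntegrableOn (fun z => (∑ j, ‖a j z‖ ^ 2) * Real.exp (-Θ z)) Ω := by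
  simp only [Finset.sum_mul]
  exact integrable_finsetSum _ fun j _ => integrableOn_normSq_mul_exp (ha j)

/-- The basic estimate for a closed form `a` cut off by `χ`. -/
lemma integral_cutoff_le (hΩ : IsOpen Ω) (hΦ : ContDiffOn ℝ 2 Φ Ω) (hψ : ContDiffOn ℝ 2 ψ Ω) {c : ℝ}
    (hc : 0 ≤ c)
    (hL : ∀ z ∈ Ω, ∀ w, (c * Real.exp (ψ z) + 4 * gradSq ψ z) * ‖w‖ ^ 2 ≤ LeviForm Φ z w)
    (hχ : CTest 2 Ω fun z => (χ z : ℂ)) (hχ0 : ∀ z, 0 ≤ χ z) (hχ1 : ∀ z, χ z ≤ 1)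
    (hξ : CTest 2 Ω fun z => (ξ z : ℂ)) (hξ0 : ∀ z, 0 ≤ ξ z)
    {U : Set (Cn n)} (hU : IsOpen U) (hχU : tsupport (fun z => (χ z : ℂ)) ⊆ U) (hUΩ : U ⊆ Ω)
    (hξU : ∀ z ∈ U, ξ z = 1) {C : ℝ}
    (hC : ∀ z ∈ Ω, gradSq χ z ≤ C * Real.exp (ψ z)) (hη : CTest 0 Ω η)
    (ha : ∀ j, MemLp (fun z => a j z * (Real.exp (-(1 / 2) * (Φ z - ψ z)) : ℂ)) 2
      (volume.restrict Ω))
    (hcurl : ∀ w, CTest 2 Ω w → ∀ j k,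
      ∫ z in Ω, (a j z * wirt I w z k - a k z * wirt I w z j) = 0)
    (hdiv : ∀ t, CTest 2 Ω t →
      ∫ z in Ω, ∑ j, a j z * (wirt (-I) t z j +
        t z * wirt (-I) (fun y => ((Φ y - ψ y : ℝ) : ℂ)) z j) = -∫ z in Ω, η z * t z) :
    c * ∫ z in Ω, χ z ^ 2 * ((∑ j, ‖a j z‖ ^ 2) * Real.exp (-(Φ z - ψ z))) ≤
      2 * (∫ z in Ω, ‖η z‖ ^ 2 * Real.exp (-Φ z)) +
        6 * C * ∫ z in Ω, (∑ j, ‖a j z‖ ^ 2) * Real.exp (-(Φ z - ψ z)) := by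
  have hΘ : ContDiffOn ℝ 2 (fun z => Φ z - ψ z) Ω := hΦ.sub hψ
  have hΘ0 : ContDiffOn ℝ 0 (fun z => Φ z - ψ z) Ω := hΘ.of_le (by norm_num)
  set m : Cn n → ℝ := fun z => c * Real.exp (ψ z) + 4 * gradSq ψ z with hm
  have hmC : ContDiffOn ℝ 0 m Ω := contDiffOn_zero.2
    ((continuousOn_const.mul (Real.continuous_exp.comp_continuousOn hψ.continuousOn)).add
      (continuousOn_const.mul (continuousOn_gradSq hΩ (hψ.of_le one_le_two))))
  have hm0 : ∀ z, 0 ≤ m z := fun z =>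
    add_nonneg (mul_nonneg hc (Real.exp_pos _).le) (mul_nonneg (by norm_num) (gradSq_nonneg _ _))
  have hξm := (hξ.of_le (show (0 : WithTop ℕ∞) ≤ 2 by norm_num)).ofReal_mul_contDiffOn hΩ hmC
  have hξΦ := hξ.ofReal_mul_contDiffOn hΩ hΦ
  have hb : ∀ j, MemLp (fun z => a j z * χ z) 2 volume := fun j =>
    (hχ.of_le (by norm_num)).memLp_mul hΩ hΘ0 (ha j)
  have hz0 : ∀ z ∉ tsupport (fun z => (χ z : ℂ)), (χ z : ℂ) = 0 := fun z hz =>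
    image_eq_zero_of_notMem_tsupport (f := fun z => (χ z : ℂ)) hz
  have hloc : ∀ z ∈ U, (fun z => ξ z * Φ z) =ᶠ[nhds z] Φ := fun z hz => by
    filter_upwards [hU.mem_nhds hz] with y hy
    rw [hξU y hy, one_mul]
  set h : Cn n → ℂ := fun z => η z * χ z + ∑ j, a j z * (wirt (-I) (fun y => (χ y : ℂ)) z j +
      χ z * wirt (-I) (fun y => ((Φ y - ψ y : ℝ) : ℂ)) z j) with hh
  set G : Fin n → Fin n → Cn n → ℂ := fun j k z => a j z * wirt I (fun y => (χ y : ℂ)) z k -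
      a k z * wirt I (fun y => (χ y : ℂ)) z j with hG
  have main := integral_mul_normSq_le (Φ := fun z => ξ z * Φ z) (m := fun z => ξ z * m z)
    (b := fun j z => a j z * χ z) (h := h) (G := G)
    hξΦ.contDiff_of_ofReal hξΦ.hasCompactSupport_of_ofReal
    hξm.contDiff_of_ofReal.continuous hξm.hasCompactSupport_of_ofReal
    (fun z => mul_nonneg (hξ0 z) (hm0 z)) hχ.compact hU hχU
    (fun z hz w => by
      rw [leviForm_congr (hloc z hz), hξU z hz, one_mul]
      exact hL z (hUΩ hz) w)
    hb (fun j z hz => by simp [hz0 z hz])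
    (integral_sum_cutoff_mul_wirt hΩ hΘ hχ hη ha hdiv CTest.zero).1
    (fun z hz => by simp [hh, hz0 z hz, wirt_eq_zero_of_notMem_tsupport hz])
    (fun j k => (integral_cutoff_mul_wirt_sub hΩ hΘ0 hχ ha hcurl j k).1)
    (fun j k z hz => by simp [hG, wirt_eq_zero_of_notMem_tsupport hz])
    (fun t ht => (integral_sum_cutoff_mul_wirt hΩ hΘ hχ hη ha hdiv ht).2)
    (fun t ht j k => (integral_cutoff_mul_wirt_sub hΩ hΘ0 hχ ha hcurl j k).2 t ht)
  set A : Cn n → ℝ := fun z => (∑ j, ‖a j z‖ ^ 2) * Real.exp (-(Φ z - ψ z)) with hA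
  have iA : IntegrableOn A Ω := integrableOn_sum_normSq_mul_exp ha
  have iχA : IntegrableOn (fun z => χ z ^ 2 * A z) Ω := by
    refine Integrable.bdd_mul (c := 1) iA
      (hχ.contDiff_of_ofReal.continuous.pow 2).aestronglyMeasurable
      (.of_forall fun z => ?_)
    rw [Real.norm_of_nonneg (sq_nonneg _)]
    exact pow_le_one₀ (hχ0 z) (hχ1 z)
  have iη : IntegrableOn (fun z => ‖η z‖ ^ 2 * Real.exp (-Φ z)) Ω :=
    integrableOn_normSq_mul_exp (hη.mul_contDiffOn hΩ
      ((contDiffOn_ofReal_exp hΦ _).of_le (by norm_num))).memLp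
  have iB := ((iη.const_mul 2).add (iA.const_mul (6 * C))).sub (iχA.const_mul c)
  set B : Cn n → ℝ := fun z => 2 * (‖η z‖ ^ 2 * Real.exp (-Φ z)) + 6 * C * A z - c * (χ z ^ 2 * A z)
    with hB
  have hBint : ∫ z in Ω, B z = 2 * (∫ z in Ω, ‖η z‖ ^ 2 * Real.exp (-Φ z)) +
        6 * C * (∫ z in Ω, A z) - c * ∫ z in Ω, χ z ^ 2 * A z := by
    rw [← integral_const_mul, ← integral_const_mul, ← integral_const_mul, ← integral_add,
      ← integral_sub]
    exacts [(iη.const_mul 2).add (iA.const_mul (6 * C)), iχA.const_mul c, iη.const_mul 2,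
      iA.const_mul (6 * C)]
  have iL : Integrable fun z => ξ z * m z * Real.exp (-(ξ z * Φ z)) * ∑ j, ‖a j z * χ z‖ ^ 2 := by
    simp only [Finset.mul_sum]
    refine integrable_finsetSum _ fun j _ => ?_
    have hW : Continuous fun z => ξ z * m z * Real.exp (-(ξ z * Φ z)) :=
      hξm.contDiff_of_ofReal.continuous.mul
        (Real.continuous_exp.comp hξΦ.contDiff_of_ofReal.continuous.neg)
    have hWc : HasCompactSupport fun z => ξ z * m z * Real.exp (-(ξ z * Φ z)) :=
      hξm.hasCompactSupport_of_ofReal.mul_right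
    obtain ⟨M, hM⟩ := hWc.exists_bound_of_continuous hW
    exact TendstoL2.integrable_mul_sq (hb j) hW hM
  have key : ∀ z, Real.exp (-(ξ z * Φ z)) *
      (‖h z - ∑ j, a j z * χ z * wirt (-I) (fun y => ((ξ y * Φ y : ℝ) : ℂ)) z j‖ ^ 2 +
        1 / 2 * ∑ j, ∑ k, ‖G j k z‖ ^ 2) ≤
      ξ z * m z * Real.exp (-(ξ z * Φ z)) * (∑ j, ‖a j z * χ z‖ ^ 2) + Ω.indicator B z := by
    intro z
    by_cases hz : z ∈ tsupport fun z => (χ z : ℂ)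
    · have hzU := hχU hz
      have hzΩ := hUΩ hzU
      have hdΦ := (hΦ.contDiffAt (hΩ.mem_nhds hzΩ)).differentiableAt two_ne_zero
      have hdψ := (hψ.contDiffAt (hΩ.mem_nhds hzΩ)).differentiableAt two_ne_zero
      have e1 : ∀ j, wirt (-I) (fun y => ((ξ y * Φ y : ℝ) : ℂ)) z j =
          wirt (-I) (fun y => (Φ y : ℂ)) z j := fun j => wirt_congr ((hloc z hzU).fun_comp ofReal) j
      have e2 : ∀ j, wirt (-I) (fun y => ((Φ y - ψ y : ℝ) : ℂ)) z j =
          wirt (-I) (fun y => (Φ y : ℂ)) z j - wirt (-I) (fun y => (ψ y : ℂ)) z j := fun j => by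
        simp only [ofReal_sub]
        exact wirt_sub (-I) (ofRealCLM.differentiableAt.comp z hdΦ)
          (ofRealCLM.differentiableAt.comp z hdψ) j
      have e3 : h z - ∑ j, a j z * χ z * wirt (-I) (fun y => ((ξ y * Φ y : ℝ) : ℂ)) z j =
          η z * χ z + ∑ j, a j z * (wirt (-I) (fun y => (χ y : ℂ)) z j -
            χ z * wirt (-I) (fun y => (ψ y : ℂ)) z j) := by
        rw [hh]
        dsimp only
        rw [add_sub_assoc, ← Finset.sum_sub_distrib]
        congr 1
        refine Finset.sum_congr rfl fun j _ => ?_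
        rw [e1, e2]
        ring
      have e4 : ∑ j, ‖wirt I (fun y => (χ y : ℂ)) z j‖ ^ 2 = gradSq χ z := by
        refine Finset.sum_congr rfl fun j _ => ?_
        rw [wirt_neg_I_ofReal (hχ.contDiff_of_ofReal.differentiable two_ne_zero z), norm_conj]
      have h1 := norm_add_sum_mul_sub_sq_le (η z * χ z) (χ z) (fun j => a j z)
        (fun j => wirt (-I) (fun y => (χ y : ℂ)) z j) (fun j => wirt (-I) (fun y => (ψ y : ℂ)) z j)
      have h2 := sum_sum_norm_mul_sub_mul_sq_le (fun j => a j z)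
        (fun j => wirt I (fun y => (χ y : ℂ)) z j)
      rw [e4] at h2
      change _ ≤ _ + (4 * gradSq χ z + 4 * χ z ^ 2 * gradSq ψ z) * _ at h1
      have e5 : ‖η z * χ z‖ ^ 2 = ‖η z‖ ^ 2 * χ z ^ 2 := by
        rw [norm_mul, mul_pow, norm_real, Real.norm_eq_abs, sq_abs]
      have e6 : ∑ j, ‖a j z * χ z‖ ^ 2 = (∑ j, ‖a j z‖ ^ 2) * χ z ^ 2 := by
        rw [Finset.sum_mul]
        refine Finset.sum_congr rfl fun j _ => ?_
        rw [norm_mul, mul_pow, norm_real, Real.norm_eq_abs, sq_abs]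
      have e7 : Real.exp (-(Φ z - ψ z)) = Real.exp (-Φ z) * Real.exp (ψ z) := by
        rw [← Real.exp_add]; congr 1; ring
      rw [e3, indicator_of_mem hzΩ, hξU z hzU, one_mul, one_mul, e6, hB, hA]
      dsimp only
      rw [e7, hm]
      dsimp only
      rw [e5] at h1
      have hS : (0 : ℝ) ≤ ∑ j, ‖a j z‖ ^ 2 := by positivity
      set S := ∑ j, ‖a j z‖ ^ 2
      have h3 : ‖η z‖ ^ 2 * χ z ^ 2 ≤ ‖η z‖ ^ 2 :=
        mul_le_of_le_one_right (sq_nonneg _) (pow_le_one₀ (hχ0 z) (hχ1 z))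
      have h4 := mul_le_mul_of_nonneg_right (hC z hzΩ) hS
      refine (mul_le_mul_of_nonneg_left (add_le_add h1
        (mul_le_mul_of_nonneg_left h2 (by norm_num))) (Real.exp_pos _).le).trans ?_
      have h5 := mul_le_mul_of_nonneg_left (add_le_add (mul_le_mul_of_nonneg_left h3 zero_le_two)
        (mul_le_mul_of_nonneg_left h4 (by norm_num : (0 : ℝ) ≤ 6))) (Real.exp_pos (-Φ z)).le
      linear_combination h5
    · have e1 : h z = 0 := by simp [hh, hz0 z hz, wirt_eq_zero_of_notMem_tsupport hz]
      have e2 : ∀ j k, G j k z = 0 := fun j k => by simp [hG, wirt_eq_zero_of_notMem_tsupport hz]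
      simp only [e1, e2, hz0 z hz, mul_zero, zero_mul, Finset.sum_const_zero, sub_zero, norm_zero,
        ne_eq, OfNat.ofNat_ne_zero, not_false_eq_true, zero_pow, add_zero, zero_add]
      refine indicator_apply_nonneg fun hzΩ => ?_
      have hC0 : 0 ≤ C := nonneg_of_mul_nonneg_left ((gradSq_nonneg _ _).trans (hC z hzΩ))
        (Real.exp_pos _)
      have hχz : χ z = 0 := ofReal_eq_zero.1 (hz0 z hz)
      rw [hB, hA]
      simp only [hχz, ne_eq, OfNat.ofNat_ne_zero, not_false_eq_true, zero_pow, zero_mul, mul_zero,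
        sub_zero]
      positivity
  have iB' : Integrable (Ω.indicator B) := (integrable_indicator_iff hΩ.measurableSet).2 iB
  have hle : (∫ z, ξ z * m z * Real.exp (-(ξ z * Φ z)) * ∑ j, ‖a j z * χ z‖ ^ 2) ≤
      (∫ z, ξ z * m z * Real.exp (-(ξ z * Φ z)) * ∑ j, ‖a j z * χ z‖ ^ 2) +
      ∫ z in Ω, B z := by
    rw [← integral_indicator hΩ.measurableSet,
      ← integral_add iL iB']
    exact main.trans (integral_mono_of_nonneg (.of_forall fun z => by positivity)
      (iL.add iB') (.of_forall key))
  linarith [(le_add_iff_nonneg_right _).1 hle]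

end CutoffEstimate

section Duality

open Filter Topology
open scoped InnerProductSpace

variable {Ω : Set (Cn n)} {Φ ρ : Cn n → ℝ}

/-- Cauchy–Schwarz inequality for forms in `L²(Ω, e^{-Θ})`. -/
lemma norm_integral_sum_mul_conj_sq_le {Θ : Cn n → ℝ} {a g : Fin n → Cn n → ℂ}
    (ha : ∀ j, MemLp (fun z => a j z * (Real.exp (-(1 / 2) * Θ z) : ℂ)) 2 (volume.restrict Ω))
    (hg : ∀ j, MemLp (fun z => g j z * (Real.exp (-(1 / 2) * Θ z) : ℂ)) 2 (volume.restrict Ω)) :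
    ‖∫ z in Ω, (∑ j, g j z * conj (a j z)) * (Real.exp (-Θ z) : ℂ)‖ ^ 2 ≤
      (∫ z in Ω, (∑ j, ‖g j z‖ ^ 2) * Real.exp (-Θ z)) *
        ∫ z in Ω, (∑ j, ‖a j z‖ ^ 2) * Real.exp (-Θ z) := by
  have hn : ∀ {b : Fin n → Cn n → ℂ}
      (hb : ∀ j, MemLp (fun z => b j z * (Real.exp (-(1 / 2) * Θ z) : ℂ)) 2 (volume.restrict Ω)),
      ‖(memLp_vec hb).toLp _‖ ^ 2 = ∫ z in Ω, (∑ j, ‖b j z‖ ^ 2) * Real.exp (-Θ z) := by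
    intro b hb
    rw [norm_toLp_sq]
    refine integral_congr_ae (.of_forall fun z => ?_)
    dsimp only
    rw [EuclideanSpace.norm_sq_eq, Finset.sum_mul]
    exact Finset.sum_congr rfl fun j _ => norm_mul_ofReal_exp_sq _ _
  have hi : ⟪(memLp_vec ha).toLp _, (memLp_vec hg).toLp _⟫_ℂ =
      ∫ z in Ω, (∑ j, g j z * conj (a j z)) * (Real.exp (-Θ z) : ℂ) := by
    rw [inner_Lp_eq (MemLp.coeFn_toLp _) (MemLp.coeFn_toLp _)]
    refine integral_congr_ae (.of_forall fun z => ?_)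
    dsimp only
    rw [Finset.sum_mul]
    refine Finset.sum_congr rfl fun j _ => ?_
    have hE : (Real.exp (-(1 / 2) * Θ z) : ℂ) * (Real.exp (-(1 / 2) * Θ z) : ℂ) =
        (Real.exp (-Θ z) : ℂ) := by
      rw [ofReal_exp_mul]; norm_num
    simp only [vec_apply, map_mul, conj_ofReal]
    linear_combination (g j z * conj (a j z)) * hE
  rw [← hi, ← hn ha, ← hn hg, ← mul_pow, mul_comm ‖(memLp_vec hg).toLp _‖]
  exact pow_le_pow_left₀ (norm_nonneg _) (norm_inner_le_norm _ _) 2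

lemma memLp_mul_exp_of_le (hΩ : IsOpen Ω) {Θ : Cn n → ℝ} (hΦ : ContinuousOn Φ Ω)
    (hΘ : ContinuousOn Θ Ω)
    (h : ∀ z ∈ Ω, Φ z ≤ Θ z) {g : Cn n → ℂ}
    (hg : MemLp (fun z => g z * (Real.exp (-(1 / 2) * Φ z) : ℂ)) 2 (volume.restrict Ω)) :
    MemLp (fun z => g z * (Real.exp (-(1 / 2) * Θ z) : ℂ)) 2 (volume.restrict Ω) := by
  have e : ∀ z, g z * (Real.exp (-(1 / 2) * Φ z) : ℂ) * (Real.exp (1 / 2 * (Φ z - Θ z)) : ℂ) =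
      g z * (Real.exp (-(1 / 2) * Θ z) : ℂ) := fun z => by
    rw [mul_assoc, ← ofReal_mul, ← Real.exp_add]
    ring_nf
  refine hg.of_le ?_ ?_
  · refine (hg.1.mul (ContinuousOn.aestronglyMeasurable ?_ hΩ.measurableSet)).congr (.of_forall e)
    exact continuous_ofReal.comp_continuousOn (continuousOn_exp (hΦ.sub hΘ) _)
  · refine (ae_restrict_iff' hΩ.measurableSet).2 (.of_forall fun z hz => ?_)
    rw [← e, norm_mul _ (ofReal _), norm_real, Real.norm_of_nonneg (Real.exp_pos _).le]
    refine mul_le_of_le_one_right (norm_nonneg _) (Real.exp_le_one_iff.2 ?_)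
    linarith [h z hz]

lemma ctest_wdel (hΩ : IsOpen Ω) (hΦ : ContDiffOn ℝ 1 Φ Ω) {t : Cn n → ℂ} (ht : CTest 1 Ω t)
    (j : Fin n) : CTest 0 Ω fun z => wdel Φ t z j := by
  have hw : ContDiffOn ℝ 0 (fun z => -wirt (-I) (fun y => (Φ y : ℂ)) z j) Ω :=
    contDiffOn_zero.2 (continuousOn_wirt (-I) hΩ
      ((ofRealCLM.contDiff (n := 1)).comp_contDiffOn hΦ) j).neg
  have h := (ht.wirt_zero (-I) j).add ((ht.of_le (by norm_num)).mul_contDiffOn hΩ hw)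
  convert h using 2 with z
  rw [wdel]
  ring

lemma CTest.sum {ι : Type*} {m : WithTop ℕ∞} (s : Finset ι) {t : ι → Cn n → ℂ}
    (ht : ∀ i, CTest m Ω (t i)) : CTest m Ω fun z => ∑ i ∈ s, t i z := by
  classical
  induction s using Finset.induction_on with
  | empty =>
    simp only [Finset.sum_empty]
    exact CTest.zero
  | insert i s hi ih => simpa [Finset.sum_insert hi] using (ht i).add ih

/-- Hörmander's estimate in dual form. -/
lemma norm_integral_sum_mul_conj_sq_le_of_closed (hΩ : IsOpen Ω) (hρC : ContDiffOn ℝ 2 ρ Ω)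
    (hρ : ∀ c, IsCompact {z ∈ Ω | ρ z ≤ c}) (hρL : ∀ z ∈ Ω, ∀ w, ‖w‖ ^ 2 ≤ LeviForm ρ z w)
    (hΦ : ContDiffOn ℝ 2 Φ Ω) {c : ℝ} (hc : 0 < c)
    (hL : ∀ z ∈ Ω, ∀ w, c * ‖w‖ ^ 2 ≤ LeviForm Φ z w)
    {α : Fin n → Cn n → ℂ} (hα : ∀ j, CTest 1 Ω (α j)) {g : Fin n → Cn n → ℂ}
    (hg : ∀ j, MemLp (fun z => g j z * (Real.exp (-(1 / 2) * Φ z) : ℂ)) 2 (volume.restrict Ω))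
    (hcurl : ∀ w, CTest 2 Ω w → ∀ j k,
      ∫ z in Ω, (g j z * wirt I w z k - g k z * wirt I w z j) = 0) :
    ‖∫ z in Ω, (∑ j, g j z * conj (α j z)) * (Real.exp (-Φ z) : ℂ)‖ ^ 2 ≤
      2 / c * (∫ z in Ω, (∑ j, ‖g j z‖ ^ 2) * Real.exp (-Φ z)) *
        ∫ z in Ω, ‖∑ j, wdel Φ (α j) z j‖ ^ 2 * Real.exp (-Φ z) := by
  obtain ⟨R, hR⟩ : ∃ R, ∀ j, ∀ z ∈ tsupport (α j), ρ z < R := by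
    obtain ⟨R, hR⟩ := (isCompact_iUnion fun j => (hα j).compact).exists_bound_of_continuousOn
      (hρC.continuousOn.mono (iUnion_subset fun j => (hα j).subset))
    refine ⟨R + 1, fun j z hz => ?_⟩
    have := hR z (mem_iUnion.2 ⟨j, hz⟩)
    linarith [(abs_le.1 this).2]
  obtain ⟨Φ', ψ, C, hΦ', hψ, hC0, heq, hle, hLΦ', hgrad⟩ := exists_weights hΩ hρC hρ hρL hΦ hL R
  set Θ : Cn n → ℝ := fun z => Φ' z - ψ z with hΘdef
  have hΘ : ContDiffOn ℝ 2 Θ Ω := hΦ'.sub hψ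
  have hV : IsOpen {z ∈ Ω | ρ z < R} := hρC.continuousOn.isOpen_inter_preimage hΩ isOpen_Iio
  have hΘΦ : ∀ j, ∀ z ∈ tsupport (α j), Θ =ᶠ[𝓝 z] Φ := fun j z hz => by
    filter_upwards [hV.mem_nhds ⟨(hα j).subset hz, hR j z hz⟩] with y hy
    have := heq y hy.1 hy.2.le
    simp [hΘdef, this.1, this.2]
  have hwdel : ∀ z j, wdel Θ (α j) z j = wdel Φ (α j) z j := fun z j => by
    by_cases hz : z ∈ tsupport (α j)
    · have : wirt (-I) (fun y => (Θ y : ℂ)) z j = wirt (-I) (fun y => (Φ y : ℂ)) z j :=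
        wirt_congr ((hΘΦ j z hz).fun_comp ofReal) j
      rw [wdel, wdel, this]
    · simp [wdel, image_eq_zero_of_notMem_tsupport hz]
  set η : Cn n → ℂ := fun z => ∑ j, wdel Φ (α j) z j with hη
  have hηt : CTest 0 Ω η := CTest.sum _ fun j => ctest_wdel hΩ (hΦ.of_le one_le_two) (hα j) j
  have hηΦ : ∀ z ∈ Ω, ‖η z‖ ^ 2 * Real.exp (-Φ' z) = ‖η z‖ ^ 2 * Real.exp (-Φ z) := by
    intro z hz
    by_cases h : ∃ j, z ∈ tsupport (α j)
    · obtain ⟨j, hj⟩ := h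
      rw [(heq z hz (hR j z hj).le).1]
    · have : η z = 0 := Finset.sum_eq_zero fun j _ => by
        have hz : z ∉ tsupport (α j) := fun h' => h ⟨j, h'⟩
        simp [wdel, image_eq_zero_of_notMem_tsupport hz, wirt_eq_zero_of_notMem_tsupport hz]
      simp [this]
  obtain ⟨a, ha, hacurl, hadiv, hag⟩ := exists_projection_closed hΩ hΘ hα
  simp only [hwdel] at hadiv
  set A : Cn n → ℝ := fun z => (∑ j, ‖a j z‖ ^ 2) * Real.exp (-Θ z) with hA
  have iA : IntegrableOn A Ω := integrableOn_sum_normSq_mul_exp ha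
  have hcut : ∀ ν : ℝ, 0 < ν → R + 2 ≤ ν → c * ∫ z in Ω, cutoff Ω ρ ν z ^ 2 * A z ≤
      2 * (∫ z in Ω, ‖η z‖ ^ 2 * Real.exp (-Φ z)) + 6 * (C / ν ^ 2) * ∫ z in Ω, A z := by
    intro ν hν hRν
    have hν' : 0 < 2 * ν + 1 := by linarith
    rw [← setIntegral_congr_fun hΩ.measurableSet hηΦ]
    exact integral_cutoff_le hΩ hΦ' hψ hc.le hLΦ' (ctest_cutoff hΩ hρC hρ hν)
      cutoff_nonneg cutoff_le_one (ctest_cutoff hΩ hρC hρ hν') cutoff_nonneg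
      (hρC.continuousOn.isOpen_inter_preimage hΩ (isOpen_Iio (a := 2 * ν + 1)))
      ((tsupport_cutoff_subset hρ hν).trans fun z hz => ⟨hz.1, by
        have := hz.2
        simp only [mem_preimage, mem_Iio]
        linarith⟩) inter_subset_left
      (fun z hz => cutoff_eq_one hν' hz.1 (le_of_lt hz.2)) (hgrad ν hν hRν) hηt ha hacurl hadiv
  have hlim : c * ∫ z in Ω, A z ≤ 2 * ∫ z in Ω, ‖η z‖ ^ 2 * Real.exp (-Φ z) := by
    have hev : ∀ᶠ ν : ℕ in atTop, (0 : ℝ) < ν ∧ R + 2 ≤ ν :=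
      (tendsto_natCast_atTop_atTop.eventually_gt_atTop 0).and
        (tendsto_natCast_atTop_atTop.eventually_ge_atTop (R + 2))
    have h1 : Tendsto (fun ν : ℕ => ∫ z in Ω, cutoff Ω ρ ν z ^ 2 * A z) atTop
        (𝓝 (∫ z in Ω, A z)) := by
      refine tendsto_integral_filter_of_dominated_convergence A ?_ ?_ iA ?_
      · filter_upwards [hev] with ν hν
        have := (ctest_cutoff hΩ hρC hρ hν.1).contDiff_of_ofReal.continuous
        exact (this.pow 2).aestronglyMeasurable.mul iA.1
      · refine .of_forall fun ν => .of_forall fun z => ?_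
        have hA0 : 0 ≤ A z := by positivity
        have h0 : 0 ≤ cutoff Ω ρ ν z := cutoff_nonneg z
        have h1 : cutoff Ω ρ ν z ≤ 1 := cutoff_le_one z
        rw [Real.norm_of_nonneg (by positivity)]
        exact mul_le_of_le_one_left hA0 (pow_le_one₀ h0 h1)
      · refine (ae_restrict_iff' hΩ.measurableSet).2 (.of_forall fun z hz => ?_)
        refine tendsto_const_nhds.congr' ?_
        filter_upwards [hev, tendsto_natCast_atTop_atTop.eventually_ge_atTop (ρ z)] with ν hν hz'
        rw [cutoff_eq_one hν.1 hz hz', one_pow, one_mul]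
    have h2 : Tendsto (fun ν : ℕ => 2 * (∫ z in Ω, ‖η z‖ ^ 2 * Real.exp (-Φ z)) +
        6 * (C / (ν : ℝ) ^ 2) * ∫ z in Ω, A z) atTop
        (𝓝 (2 * (∫ z in Ω, ‖η z‖ ^ 2 * Real.exp (-Φ z)) + 6 * 0 * ∫ z in Ω, A z)) :=
      tendsto_const_nhds.add ((((tendsto_const_nhds (x := C)).div_atTop
        ((tendsto_pow_atTop two_ne_zero).comp tendsto_natCast_atTop_atTop)).const_mul
          6).mul_const _)
    have := le_of_tendsto_of_tendsto (h1.const_mul c) h2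
      (hev.mono fun ν hν => hcut ν hν.1 hν.2)
    simpa using this
  have hint_eq : ∫ z in Ω, (∑ j, g j z * conj (α j z)) * (Real.exp (-Φ z) : ℂ) =
      ∫ z in Ω, (∑ j, g j z * conj (α j z)) * (Real.exp (-Θ z) : ℂ) := by
    refine integral_congr_ae (.of_forall fun z => ?_)
    dsimp only
    rw [Finset.sum_mul, Finset.sum_mul]
    refine Finset.sum_congr rfl fun j _ => ?_
    by_cases hz : z ∈ tsupport (α j)
    · rw [(hΘΦ j z hz).eq_of_nhds]
    · simp [image_eq_zero_of_notMem_tsupport hz]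
  have hgΘ := fun j => memLp_mul_exp_of_le hΩ hΦ.continuousOn hΘ.continuousOn hle (hg j)
  rw [hint_eq, hag g hgΘ hcurl]
  refine (norm_integral_sum_mul_conj_sq_le ha hgΘ).trans ?_
  have h1 : ∫ z in Ω, (∑ j, ‖g j z‖ ^ 2) * Real.exp (-Θ z) ≤
      ∫ z in Ω, (∑ j, ‖g j z‖ ^ 2) * Real.exp (-Φ z) := by
    refine setIntegral_mono_on (integrableOn_sum_normSq_mul_exp hgΘ)
      (integrableOn_sum_normSq_mul_exp hg) hΩ.measurableSet fun z hz => ?_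
    have := hle z hz
    gcongr
  have h2 : ∫ z in Ω, A z ≤ 2 / c * ∫ z in Ω, ‖η z‖ ^ 2 * Real.exp (-Φ z) := by
    rw [div_mul_eq_mul_div, le_div_iff₀ hc]
    linarith
  calc _ ≤ _ := mul_le_mul h1 h2 (integral_nonneg fun z => by positivity)
        (integral_nonneg fun z => by positivity)
    _ = _ := by ring

end Duality

section Minimal

open Filter Topology
open scoped InnerProductSpace

variable {Ω : Set (Cn n)} {Φ ρ : Cn n → ℝ}

lemma norm_sq_le_of_inner_le {H : Type*} [NormedAddCommGroup H] [InnerProductSpace ℂ H]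
    [CompleteSpace H] (N : Submodule ℂ H) {U : H} (hU : ∀ W ∈ Nᗮ, ⟪W, U⟫_ℂ = 0) {K : ℝ} (hK : 0 ≤ K)
    (h : ∀ F ∈ N, ‖⟪F, U⟫_ℂ‖ ^ 2 ≤ K * ‖F‖ ^ 2) : ‖U‖ ^ 2 ≤ K := by
  have hUN : U ∈ closure (N : Set H) := by
    rw [← Submodule.topologicalClosure_coe, ← Submodule.orthogonal_orthogonal_eq_closure]
    exact (Submodule.mem_orthogonal _ _).2 hU
  have hcl : IsClosed {F : H | ‖⟪F, U⟫_ℂ‖ ^ 2 ≤ K * ‖F‖ ^ 2} :=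
    isClosed_le (by fun_prop) (by fun_prop)
  have hUU : ‖⟪U, U⟫_ℂ‖ ^ 2 ≤ K * ‖U‖ ^ 2 := closure_minimal (fun F hF => h F hF) hcl hUN
  rw [inner_self_eq_norm_sq_to_K, norm_pow, RCLike.norm_ofReal, abs_norm] at hUU
  rcases eq_or_ne U 0 with rfl | h0
  · simpa using hK
  · have : 0 < ‖U‖ ^ 2 := by positivity
    nlinarith

lemma contDiffOn_ofReal_exp_neg {m : WithTop ℕ∞} (hΦ : ContDiffOn ℝ m Φ Ω) :
    ContDiffOn ℝ m (fun z => (Real.exp (-Φ z) : ℂ)) Ω := by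
  simpa using contDiffOn_ofReal_exp hΦ (-1)

/-- The defining property of the formal adjoint of `∂̄` in `L²(e^{-Φ})`. -/
lemma wirt_conj_mul_exp_neg {a : Cn n → ℂ} {z : Cn n} (hΦ : DifferentiableAt ℝ Φ z)
    (ha : DifferentiableAt ℝ a z) (j : Fin n) :
    wirt I (fun y => conj (a y) * (Real.exp (-Φ y) : ℂ)) z j =
      conj (wdel Φ a z j) * (Real.exp (-Φ z) : ℂ) := by
  have hE : DifferentiableAt ℝ (fun y => (Real.exp (-Φ y) : ℂ)) z :=
    ofRealCLM.differentiableAt.comp z hΦ.neg.exp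
  have := wirt_conj I (f := fun y => a y * (Real.exp (-Φ y) : ℂ)) (ha.mul hE) j
  simp only [map_mul, conj_ofReal] at this
  rw [this, conj_I, wirt_mul_exp_neg hΦ ha, map_mul, conj_ofReal]

lemma DbarEqOn.integral_mul_conj_wdel (hΩ : IsOpen Ω) (hΦ : ContDiffOn ℝ 1 Φ Ω) {v : Cn n → ℂ}
    {g : Cn n → Fin n → ℂ} (h : DbarEqOn Ω v g) (hv : LocallyIntegrableOn v Ω)
    (hg : ∀ j, LocallyIntegrableOn (fun z => g z j) Ω) {α : Fin n → Cn n → ℂ}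
    (hα : ∀ j, CTest 1 Ω (α j)) :
    ∫ z in Ω, v z * conj (∑ j, wdel Φ (α j) z j) * (Real.exp (-Φ z) : ℂ) =
      -∫ z in Ω, (∑ j, g z j * conj (α j z)) * (Real.exp (-Φ z) : ℂ) := by
  have ht : ∀ j, CTest 1 Ω fun z => conj (α j z) * (Real.exp (-Φ z) : ℂ) := fun j =>
    (hα j).star.mul_contDiffOn hΩ (contDiffOn_ofReal_exp_neg hΦ)
  have e1 : ∀ z ∈ Ω, v z * conj (∑ j, wdel Φ (α j) z j) * (Real.exp (-Φ z) : ℂ) =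
      ∑ j, v z * wirt I (fun y => conj (α j y) * (Real.exp (-Φ y) : ℂ)) z j := fun z hz => by
    rw [map_sum, Finset.mul_sum, Finset.sum_mul]
    refine Finset.sum_congr rfl fun j _ => ?_
    rw [wirt_conj_mul_exp_neg ((hΦ.contDiffAt (hΩ.mem_nhds hz)).differentiableAt one_ne_zero)
      ((hα j).contDiff.differentiable one_ne_zero z), mul_assoc]
  have e2 : ∀ z, (∑ j, g z j * conj (α j z)) * (Real.exp (-Φ z) : ℂ) =
      ∑ j, g z j * (conj (α j z) * (Real.exp (-Φ z) : ℂ)) := fun z => by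
    simp only [Finset.sum_mul, mul_assoc]
  rw [setIntegral_congr_fun hΩ.measurableSet e1]
  simp only [e2]
  rw [integral_finsetSum _ fun j _ => (((ht j).wirt_zero I j).integrable_mul hv).restrict,
    integral_finsetSum _ fun j _ => (((ht j).of_le zero_le_one).integrable_mul (hg j)).restrict,
    ← Finset.sum_neg_distrib]
  refine Finset.sum_congr rfl fun j _ => ?_
  rw [((ht j).wirt_zero I j).setIntegral_mul v, (ht j).setIntegral_mul fun z => g z j]
  exact h.integral_mul_wirt hΩ hv hg (ht j) j

lemma DbarEqOn.integral_curl (hΩ : IsOpen Ω) {v : Cn n → ℂ} {g : Cn n → Fin n → ℂ}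
    (h : DbarEqOn Ω v g) (hv : LocallyIntegrableOn v Ω)
    (hg : ∀ j, LocallyIntegrableOn (fun z => g z j) Ω) {w : Cn n → ℂ} (hw : CTest 2 Ω w)
    (j k : Fin n) : ∫ z in Ω, (g z j * wirt I w z k - g z k * wirt I w z j) = 0 := by
  have hi : ∀ j k, Integrable (fun z => g z j * wirt I w z k) (volume.restrict Ω) := fun j k =>
    ((hw.wirt_one I k).integrable_mul (hg j)).restrict
  have he : ∀ j k, ∫ z in Ω, g z j * wirt I w z k =
      -∫ z, v z * wirt I (fun y => wirt I w y k) z j := fun j k => by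
    rw [(hw.wirt_one I k).setIntegral_mul fun z => g z j,
      h.integral_mul_wirt hΩ hv hg (hw.wirt_one I k) j, neg_neg]
  rw [integral_sub (hi _ _) (hi _ _), he, he]
  simp_rw [wirt_comm I I hw.contDiff _ k j, sub_self]

lemma wdel_add {a b : Cn n → ℂ} {z : Cn n} (ha : DifferentiableAt ℝ a z)
    (hb : DifferentiableAt ℝ b z) (j : Fin n) :
    wdel Φ (fun y => a y + b y) z j = wdel Φ a z j + wdel Φ b z j := by
  simp only [wdel, wirt_add (-I) ha hb]
  ring

lemma wdel_const_mul {a : Cn n → ℂ} {z : Cn n} (ha : DifferentiableAt ℝ a z) (c : ℂ) (j : Fin n) :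
    wdel Φ (fun y => c * a y) z j = c * wdel Φ a z j := by
  simp only [wdel, wirt_const_mul (-I) c ha]
  ring

/-- The forms `e^{-Φ/2} ∂̄*α`, with `∂̄*` the formal adjoint of `∂̄` in `L²(e^{-Φ})` and `α` a test
form, as a subspace of the unweighted `L²(Ω)`. -/
def adjointRange (hΩ : IsOpen Ω) (Φ : Cn n → ℝ) : Submodule ℂ (Lp ℂ 2 (volume.restrict Ω)) where
  carrier := {F | ∃ α : Fin n → Cn n → ℂ, (∀ j, CTest 1 Ω (α j)) ∧ F =ᵐ[volume.restrict Ω]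
    fun z => (∑ j, wdel Φ (α j) z j) * (Real.exp (-(1 / 2) * Φ z) : ℂ)}
  zero_mem' := ⟨fun _ => 0, fun _ => CTest.zero, by
    filter_upwards [Lp.coeFn_zero ℂ 2 (volume.restrict Ω)] with z hz
    rw [hz]
    simp [wdel, wirt]⟩
  add_mem' := by
    rintro F G ⟨α, hα, hF⟩ ⟨β, hβ, hG⟩
    refine ⟨fun j z => α j z + β j z, fun j => (hα j).add (hβ j), ?_⟩
    filter_upwards [Lp.coeFn_add F G, hF, hG] with z hz hF hG
    rw [hz, Pi.add_apply, hF, hG, ← add_mul, ← Finset.sum_add_distrib]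
    simp only [wdel_add ((hα _).contDiff.differentiable one_ne_zero z)
      ((hβ _).contDiff.differentiable one_ne_zero z)]
  smul_mem' := by
    rintro c F ⟨α, hα, hF⟩
    refine ⟨fun j z => c * α j z, fun j => ?_, ?_⟩
    · simpa only [mul_comm c] using (hα j).mul_contDiffOn hΩ contDiffOn_const
    · filter_upwards [Lp.coeFn_smul c F, hF] with z hz hF
      rw [hz, Pi.smul_apply, hF, smul_eq_mul, ← mul_assoc, Finset.mul_sum]
      simp only [wdel_const_mul ((hα _).contDiff.differentiable one_ne_zero z)]

lemma memLp_mul_exp (hΩ : IsOpen Ω) (hΦ : ContinuousOn Φ Ω) {t : Cn n → ℂ} (ht : CTest 0 Ω t) :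
    MemLp (fun z => t z * (Real.exp (-(1 / 2) * Φ z) : ℂ)) 2 (volume.restrict Ω) :=
  (ht.mul_contDiffOn hΩ (contDiffOn_ofReal_exp (contDiffOn_zero.2 hΦ) _)).memLp

lemma exists_holomorphic_of_mem_adjointRange_orthogonal (hΩ : IsOpen Ω) (hΦ : ContDiffOn ℝ 2 Φ Ω)
    {W : Lp ℂ 2 (volume.restrict Ω)} (hW : W ∈ (adjointRange hΩ Φ)ᗮ) :
    ∃ h : Cn n → ℂ, DifferentiableOn ℂ h Ω ∧
      W =ᵐ[volume.restrict Ω] fun z => h z * (Real.exp (-(1 / 2) * Φ z) : ℂ) := by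
  set w : Cn n → ℂ := fun z => W z * (Real.exp (1 / 2 * Φ z) : ℂ) with hw
  have hΦc := hΦ.continuousOn
  have hEE : ∀ z, (Real.exp (1 / 2 * Φ z) : ℂ) * (Real.exp (-(1 / 2) * Φ z) : ℂ) = 1 := fun z => by
    rw [ofReal_exp_mul]; simp
  have hE2 : ∀ z, (Real.exp (1 / 2 * Φ z) : ℂ) * (Real.exp (-Φ z) : ℂ) =
      (Real.exp (-(1 / 2) * Φ z) : ℂ) := fun z => by
    rw [← ofReal_mul, ← Real.exp_add]; ring_nf
  have hwm : AEStronglyMeasurable w (volume.restrict Ω) :=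
    (Lp.aestronglyMeasurable W).mul (ContinuousOn.aestronglyMeasurable
      (continuous_ofReal.comp_continuousOn (continuousOn_exp hΦc _)) hΩ.measurableSet)
  have hwi : IntegrableOn (fun z => ‖w z‖ ^ 2 * Real.exp (-Φ z)) Ω := by
    refine ((memLp_two_iff_integrable_sq_norm (Lp.aestronglyMeasurable W)).1 (Lp.memLp W)).congr
      (.of_forall fun z => ?_)
    dsimp only
    rw [← norm_mul_ofReal_exp_sq, hw]
    dsimp only
    rw [mul_assoc, hEE, mul_one]
  obtain ⟨h, hh, hwh⟩ := exists_holomorphic_of_weak hΩ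
    (fun K hKΩ hK => memLp_two_restrict_of_integrableOn hwm hwi hΦc hK hKΩ) fun t ht j => by
      have ht1 : CTest 1 Ω t := ht.of_le (by exact_mod_cast le_top)
      set a : Cn n → ℂ := fun z => conj (t z) * (Real.exp (1 * Φ z) : ℂ) with ha
      have hat : CTest 1 Ω a :=
        ht1.star.mul_contDiffOn hΩ (contDiffOn_ofReal_exp (hΦ.of_le one_le_two) 1)
      have hat' : CTest 0 Ω fun z => wdel Φ a z j := ctest_wdel hΩ (hΦ.of_le one_le_two) hat j
      have hm := memLp_mul_exp hΩ hΦc hat'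
      have hmem : hm.toLp _ ∈ adjointRange hΩ Φ := by
        classical
        refine ⟨fun i => if i = j then a else fun _ => 0, fun i => ?_, ?_⟩
        · beta_reduce
          split_ifs
          exacts [hat, CTest.zero]
        · filter_upwards [hm.coeFn_toLp] with z hz
          rw [hz, Finset.sum_eq_single j]
          · simp
          · intro i _ hi
            simp [hi, wdel, wirt]
          · simp
      have hta : t = fun y => conj (a y) * (Real.exp (-Φ y) : ℂ) := by
        ext y
        rw [ha]
        dsimp only
        rw [map_mul, conj_conj, conj_ofReal, mul_assoc, ← ofReal_mul, ← Real.exp_add]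
        simp
      have h0 := (Submodule.mem_orthogonal _ _).1 hW _ hmem
      rw [L2.inner_def] at h0
      rw [← (ht1.wirt_zero I j).setIntegral_mul, ← h0]
      refine integral_congr_ae ?_
      filter_upwards [hm.coeFn_toLp, ae_restrict_mem hΩ.measurableSet] with z hz hzΩ
      have hd : wirt I t z j = conj (wdel Φ a z j) * (Real.exp (-Φ z) : ℂ) := by
        conv_lhs => rw [hta]
        exact wirt_conj_mul_exp_neg ((hΦ.contDiffAt (hΩ.mem_nhds hzΩ)).differentiableAt two_ne_zero)
          (hat.contDiff.differentiable one_ne_zero z) j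
      rw [hz, RCLike.inner_apply, map_mul, conj_ofReal, hd, ← hE2, hw]
      ring
  refine ⟨h, hh, ?_⟩
  filter_upwards [hwh] with z hz
  rw [← hz, hw]
  dsimp only
  rw [mul_assoc, hEE, mul_one]

/-- Hörmander's `L²` estimate: a solution of `∂̄u = g` orthogonal to the holomorphic functions in
`L²(Ω, e^{-Φ})` is controlled by `g`. -/
theorem integral_normSq_mul_exp_le_of_dbarEqOn (hΩ : IsOpen Ω) (hρC : ContDiffOn ℝ 2 ρ Ω)
    (hρ : ∀ c, IsCompact {z ∈ Ω | ρ z ≤ c}) (hρL : ∀ z ∈ Ω, ∀ w, ‖w‖ ^ 2 ≤ LeviForm ρ z w)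
    (hΦ : ContDiffOn ℝ 2 Φ Ω) {c : ℝ} (hc : 0 < c)
    (hL : ∀ z ∈ Ω, ∀ w, c * ‖w‖ ^ 2 ≤ LeviForm Φ z w) {u : Cn n → ℂ} {g : Cn n → Fin n → ℂ}
    (hu : MemLp (fun z => u z * (Real.exp (-(1 / 2) * Φ z) : ℂ)) 2 (volume.restrict Ω))
    (hum : AEStronglyMeasurable u (volume.restrict Ω))
    (hg : ∀ j, MemLp (fun z => g z j * (Real.exp (-(1 / 2) * Φ z) : ℂ)) 2 (volume.restrict Ω))
    (hgm : ∀ j, AEStronglyMeasurable (fun z => g z j) (volume.restrict Ω))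
    (h : DbarEqOn Ω u g) (ho : OrthToHolo Ω Φ u) :
    ∫ z in Ω, ‖u z‖ ^ 2 * Real.exp (-Φ z) ≤
      2 / c * ∫ z in Ω, (∑ j, ‖g z j‖ ^ 2) * Real.exp (-Φ z) := by
  have hΦc := hΦ.continuousOn
  have hul := locallyIntegrableOn_of_integrableOn hΩ hum (integrableOn_normSq_mul_exp hu) hΦc
  have hgl := fun j =>
    locallyIntegrableOn_of_integrableOn hΩ (hgm j) (integrableOn_normSq_mul_exp (hg j)) hΦc
  have hE : ∀ z, (Real.exp (-(1 / 2) * Φ z) : ℂ) * (Real.exp (-(1 / 2) * Φ z) : ℂ) =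
      (Real.exp (-Φ z) : ℂ) := fun z => by
    rw [ofReal_exp_mul]; norm_num
  have hn : ‖hu.toLp _‖ ^ 2 = ∫ z in Ω, ‖u z‖ ^ 2 * Real.exp (-Φ z) := by
    simp only [norm_toLp_sq, norm_mul_ofReal_exp_sq]
  rw [← hn]
  refine norm_sq_le_of_inner_le (adjointRange hΩ Φ) (fun W hW => ?_)
    (mul_nonneg (by positivity) (integral_nonneg fun z => by positivity)) ?_
  · obtain ⟨H, hH, hWH⟩ := exists_holomorphic_of_mem_adjointRange_orthogonal hΩ hΦ hW
    have hHm : MemL2 Ω Φ H := ⟨hH.continuousOn.aestronglyMeasurable hΩ.measurableSet,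
      integrableOn_normSq_mul_exp ((Lp.memLp W).ae_eq hWH)⟩
    rw [L2.inner_def, ← ho H hH hHm]
    refine integral_congr_ae ?_
    filter_upwards [hWH, hu.coeFn_toLp] with z h1 h2
    rw [h1, h2, RCLike.inner_apply, map_mul, conj_ofReal, ← hE]
    ring
  · rintro F ⟨α, hα, hF⟩
    have hηt : CTest 0 Ω fun z => ∑ j, wdel Φ (α j) z j :=
      CTest.sum _ fun j => ctest_wdel hΩ (hΦ.of_le one_le_two) (hα j) j
    have hm := memLp_mul_exp hΩ hΦc hηt
    have hFm : F = hm.toLp _ := Lp.ext (hF.trans hm.coeFn_toLp.symm)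
    have hFn : ‖F‖ ^ 2 = ∫ z in Ω, ‖∑ j, wdel Φ (α j) z j‖ ^ 2 * Real.exp (-Φ z) := by
      simp only [hFm, norm_toLp_sq, norm_mul_ofReal_exp_sq]
    have hin : ⟪F, hu.toLp _⟫_ℂ =
        -∫ z in Ω, (∑ j, g z j * conj (α j z)) * (Real.exp (-Φ z) : ℂ) := by
      rw [← h.integral_mul_conj_wdel hΩ (hΦ.of_le one_le_two) hul hgl hα, L2.inner_def]
      refine integral_congr_ae ?_
      filter_upwards [hF, hu.coeFn_toLp] with z h1 h2
      rw [h1, h2, RCLike.inner_apply, map_mul, conj_ofReal, ← hE]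
      ring
    rw [hin, norm_neg, hFn]
    exact norm_integral_sum_mul_conj_sq_le_of_closed hΩ hρC hρ hρL hΦ hc hL hα hg
      fun w hw j k => h.integral_curl hΩ hul hgl hw j k

end Minimal

section Weight

open scoped InnerProductSpace

lemma hasFDerivAt_norm_sub_sq (a z : Cn n) :
    HasFDerivAt (fun y : Cn n => ‖y - a‖ ^ 2) (2 • innerSL ℝ (z - a)) z := by
  simpa using ((hasFDerivAt_id z).sub_const a).norm_sq

lemma contDiff_norm_sub_sq {m : WithTop ℕ∞} (a : Cn n) :
    ContDiff ℝ m fun y : Cn n => ‖y - a‖ ^ 2 :=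
  (contDiff_id.sub contDiff_const).norm_sq ℝ

lemma leviForm_norm_sub_sq (a z w : Cn n) : LeviForm (fun y => ‖y - a‖ ^ 2) z w = ‖w‖ ^ 2 := by
  have h1 : fderiv ℝ (fun y : Cn n => ‖y - a‖ ^ 2) = fun z => 2 • innerSL ℝ (z - a) :=
    funext fun z => (hasFDerivAt_norm_sub_sq a z).fderiv
  have h2 : HasFDerivAt (fun z : Cn n => 2 • innerSL ℝ (z - a)) (2 • innerSL ℝ) z :=
    ((innerSL ℝ).hasFDerivAt.comp z ((hasFDerivAt_id z).sub_const a)).const_smul 2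
  have h3 : ∀ w : Cn n, (2 • innerSL ℝ : Cn n →L[ℝ] Cn n →L[ℝ] ℝ) w w = 2 * ‖w‖ ^ 2 := fun w => by
    rw [← real_inner_self_eq_norm_sq, two_mul, ← two_nsmul]
    rfl
  rw [LeviForm, h1, h2.fderiv, h3, h3, norm_smul, norm_I]
  ring

lemma wirt_norm_sub_sq (a z : Cn n) (j : Fin n) :
    wirt (-I) (fun y => ((‖y - a‖ ^ 2 : ℝ) : ℂ)) z j = conj (z j - a j) := by
  have h : fderiv ℝ (fun y : Cn n => ((‖y - a‖ ^ 2 : ℝ) : ℂ)) z =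
      ofRealCLM.comp (2 • innerSL ℝ (z - a)) :=
    (ofRealCLM.hasFDerivAt.comp z (hasFDerivAt_norm_sub_sq a z)).fderiv
  have h1 : ∀ x : Cn n, ⟪x, e n j⟫_ℝ = (x j).re := fun x => by
    simp [e, PiLp.inner_apply, Complex.inner, apply_ite re]
  have h2 : ∀ x : Cn n, ⟪x, I • e n j⟫_ℝ = (x j).im := fun x => by
    simp [e, PiLp.inner_apply, Complex.inner, apply_ite re]
  simp only [wirt, h, ContinuousLinearMap.comp_apply, smul_apply, nsmul_eq_mul,
    innerSL_apply_apply, h1, h2, ofRealCLM_apply]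
  apply Complex.ext <;> simp [neg_add_eq_sub]

lemma gradSq_norm_sub_sq (a z : Cn n) : gradSq (fun y => ‖y - a‖ ^ 2) z = ‖z - a‖ ^ 2 := by
  rw [EuclideanSpace.norm_sq_eq]
  simp only [gradSq, wirt_norm_sub_sq, RCLike.norm_conj, PiLp.sub_apply]

/-- A smooth substitute for the weight `√k |z - a|`. -/
def agmonWeight (k : ℝ) (a z : Cn n) : ℝ := √(1 + k * ‖z - a‖ ^ 2)

variable {k : ℝ} {a : Cn n}

lemma agmonWeight_nonneg (k : ℝ) (a z : Cn n) : 0 ≤ agmonWeight k a z := Real.sqrt_nonneg _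

lemma contDiff_agmonWeight {m : WithTop ℕ∞} (hk : 0 ≤ k) (a : Cn n) :
    ContDiff ℝ m (agmonWeight k a) :=
  (contDiff_const.add (contDiff_const.mul (contDiff_norm_sub_sq a))).sqrt fun z => by positivity

lemma sqrt_mul_norm_le_agmonWeight (hk : 0 ≤ k) (z : Cn n) : √k * ‖z - a‖ ≤ agmonWeight k a z := by
  refine Real.le_sqrt_of_sq_le ?_
  rw [mul_pow, Real.sq_sqrt hk]
  linarith

lemma agmonWeight_le (hk : 0 ≤ k) (z : Cn n) : agmonWeight k a z ≤ √k * ‖z - a‖ + 1 := by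
  refine Real.sqrt_le_iff.2 ⟨by positivity, ?_⟩
  have h1 : (√k * ‖z - a‖) ^ 2 = k * ‖z - a‖ ^ 2 := by rw [mul_pow, Real.sq_sqrt hk]
  have h2 : 0 ≤ √k * ‖z - a‖ := by positivity
  nlinarith

lemma hasDerivAt_sqrt_one_add_mul {t : ℝ} (h : 0 < 1 + k * t) :
    HasDerivAt (fun t => √(1 + k * t)) (k / (2 * √(1 + k * t))) t := by
  simpa using (((hasDerivAt_id t).const_mul k).const_add 1).sqrt h.ne'

lemma gradSq_agmonWeight_le (hk : 0 ≤ k) (z : Cn n) : gradSq (agmonWeight k a) z ≤ k / 4 := by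
  have hq : 0 < 1 + k * ‖z - a‖ ^ 2 := by positivity
  have := gradSq_comp (hasDerivAt_sqrt_one_add_mul hq)
    ((contDiff_norm_sub_sq (m := 1) a).differentiable one_ne_zero z)
  unfold agmonWeight
  rw [this, gradSq_norm_sub_sq, div_pow, mul_pow, Real.sq_sqrt hq.le, div_mul_eq_mul_div,
    div_le_div_iff₀ (by positivity) (by positivity)]
  nlinarith [sq_nonneg ‖z - a‖]

lemma le_leviForm_neg_agmonWeight (hk : 0 ≤ k) (z w : Cn n) :
    -(k / 2) * ‖w‖ ^ 2 ≤ LeviForm (fun y => -agmonWeight k a y) z w := by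
  have hq : 0 < 1 + k * ‖z - a‖ ^ 2 := by positivity
  have hev : ∀ᶠ t in nhds (‖z - a‖ ^ 2), HasDerivAt (fun t => -√(1 + k * t))
      (-(k / (2 * √(1 + k * t)))) t := by
    filter_upwards [(by fun_prop : Continuous fun t => 1 + k * t).continuousAt.eventually
      (lt_mem_nhds hq)] with t ht using (hasDerivAt_sqrt_one_add_mul ht).neg
  have hs : 1 ≤ √(1 + k * ‖z - a‖ ^ 2) := Real.one_le_sqrt.2 (by
    have : 0 ≤ k * ‖z - a‖ ^ 2 := by positivity
    linarith)
  have h2 := (((hasDerivAt_sqrt_one_add_mul hq).const_mul 2).fun_inv (by positivity)).const_mul (-k)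
  simp only [neg_mul, ← div_eq_mul_inv, neg_div] at h2
  rw [show (fun y => -agmonWeight k a y) = fun y => (fun t => -√(1 + k * t)) (‖y - a‖ ^ 2) from rfl,
    leviForm_comp_eq (contDiff_norm_sub_sq a).contDiffAt hev h2, leviForm_norm_sub_sq]
  have h3 : k / (2 * √(1 + k * ‖z - a‖ ^ 2)) ≤ k / 2 :=
    div_le_div_of_nonneg_left hk two_pos (by linarith)
  have h4 := mul_le_mul_of_nonneg_right h3 (sq_nonneg ‖w‖)
  refine (le_of_le_of_eq (by linarith) (add_zero _).symm).trans (add_le_add_right ?_ _)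
  refine mul_nonneg (div_nonneg ?_ (by norm_num)) (by positivity)
  rw [mul_neg, neg_neg]
  positivity

end Weight

section Agmon

variable {Ω : Set (Cn n)}

lemma DbarEqOn.mul_contDiff (hΩ : IsOpen Ω) {v F : Cn n → ℂ} {f : Cn n → Fin n → ℂ}
    (h : DbarEqOn Ω v f) (hv : LocallyIntegrableOn v Ω)
    (hf : ∀ j, LocallyIntegrableOn (fun z => f z j) Ω) (hF : ContDiff ℝ 1 F) :
    DbarEqOn Ω (fun z => v z * F z) fun z j => f z j * F z + v z * wirt I F z j := by
  intro t ht j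
  have ht1 : CTest 1 Ω t := ⟨ht.1.of_le (by exact_mod_cast le_top), ht.2.1, ht.2.2⟩
  have hFt := ht1.mul_contDiffOn hΩ hF.contDiffOn
  have hwt : CTest 0 Ω fun z => t z * wirt I F z j :=
    (ht1.of_le zero_le_one).mul_contDiffOn hΩ
      (contDiffOn_zero.2 (continuous_wirt I hF j).continuousOn)
  have i1 : Integrable (fun z => v z * wirt I (fun y => t y * F y) z j) (volume.restrict Ω) :=
    ((hFt.wirt_zero I j).integrable_mul hv).restrict
  have i2 : Integrable (fun z => v z * (t z * wirt I F z j)) (volume.restrict Ω) :=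
    (hwt.integrable_mul hv).restrict
  have i3 : Integrable (fun z => f z j * (t z * F z)) (volume.restrict Ω) :=
    ((hFt.of_le zero_le_one).integrable_mul (hf j)).restrict
  have e1 : ∀ z, v z * F z * dbar t z j =
      v z * wirt I (fun y => t y * F y) z j - v z * (t z * wirt I F z j) := fun z => by
    rw [dbar_eq_wirt, wirt_mul I (ht1.contDiff.differentiable one_ne_zero z)
      (hF.differentiable one_ne_zero z)]
    ring
  have e2 : ∀ z, (f z j * F z + v z * wirt I F z j) * t z =
      f z j * (t z * F z) + v z * (t z * wirt I F z j) := fun z => by ring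
  simp only [e1, e2]
  rw [integral_sub i1 i2, integral_add i3 i2, (hFt.wirt_zero I j).setIntegral_mul v,
    (hFt.of_le zero_le_one).setIntegral_mul fun z => f z j, h.integral_mul_wirt hΩ hv hf hFt j]
  ring

lemma MemL2.memLp (hΩ : IsOpen Ω) {w : Cn n → ℝ} {v : Cn n → ℂ} (hw : ContinuousOn w Ω)
    (hv : MemL2 Ω w v) :
    MemLp (fun z => v z * (Real.exp (-(1 / 2) * w z) : ℂ)) 2 (volume.restrict Ω) := by
  have hm : AEStronglyMeasurable (fun z => v z * (Real.exp (-(1 / 2) * w z) : ℂ))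
      (volume.restrict Ω) := hv.1.mul (ContinuousOn.aestronglyMeasurable
    (continuous_ofReal.comp_continuousOn (continuousOn_exp hw _)) hΩ.measurableSet)
  refine (memLp_two_iff_integrable_sq_norm hm).2 ?_
  simp only [norm_mul_ofReal_exp_sq]
  exact hv.2

lemma isCompact_sep_add_norm_sq_le {ρ : Cn n → ℝ} (hρC : ContinuousOn ρ Ω)
    (hρ : ∀ c, IsCompact {z ∈ Ω | ρ z ≤ c}) (c : ℝ) :
    IsCompact {z ∈ Ω | ρ z + ‖z - 0‖ ^ 2 ≤ c} := by
  have h : {z ∈ Ω | ρ z + ‖z - 0‖ ^ 2 ≤ c} =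
      {z ∈ Ω | ρ z ≤ c} ∩ (fun z => ρ z + ‖z - 0‖ ^ 2) ⁻¹' Iic c := by
    ext z
    simp only [mem_inter_iff, mem_preimage, mem_Iic]
    refine ⟨fun hz => ⟨⟨hz.1, ?_⟩, hz.2⟩, fun hz => ⟨hz.1.1, hz.2⟩⟩
    have := hz.2
    nlinarith [sq_nonneg ‖z - 0‖]
  rw [h]
  refine (hρ c).of_isClosed_subset (ContinuousOn.preimage_isClosed_of_isClosed ?_
    (hρ c).isClosed isClosed_Iic) inter_subset_left
  have := hρC.mono (sep_subset Ω fun z => ρ z ≤ c)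
  fun_prop

lemma leviForm_const_mul_sub_agmonWeight {φ : Cn n → ℝ} {z w a : Cn n} {k c : ℝ} (hk : 0 ≤ k)
    (hφ : ContDiffAt ℝ 2 φ z) (h : c * ‖w‖ ^ 2 ≤ LeviForm φ z w) :
    k * (c - 1 / 2) * ‖w‖ ^ 2 ≤ LeviForm (fun y => k * φ y + -agmonWeight k a y) z w := by
  have h1 : LeviForm (fun y => k * φ y) z w = k * LeviForm φ z w := by
    rw [leviForm_comp_eq (Y := fun t => k * t) (Y₁ := fun _ => k) hφ
      (.of_forall fun t => by simpa using (hasDerivAt_id t).const_mul k) (hasDerivAt_const _ _)]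
    ring
  rw [leviForm_add (contDiffAt_const.mul hφ) (contDiff_agmonWeight hk a).neg.contDiffAt, h1]
  have := le_leviForm_neg_agmonWeight (a := a) hk z w
  nlinarith [mul_le_mul_of_nonneg_left h hk]

/-- The Agmon estimate for the smooth weight. -/
lemma integral_mul_exp_neg_agmonWeight_le (hΩ : IsOpen Ω) (hP : Pseudoconvex Ω) {φ : Cn n → ℝ}
    (hφ : ContDiffOn ℝ 2 φ Ω) (hL : ∀ z ∈ Ω, ∀ w, 5 * ‖w‖ ^ 2 ≤ LeviForm φ z w) {k : ℝ} (hk : 0 < k)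
    (a : Cn n) {f : Cn n → Fin n → ℂ} (hfm : ∀ j, MemL2 Ω (fun z => k * φ z) fun z => f z j)
    {v : Cn n → ℂ} (hv : MinimalSolution Ω (fun z => k * φ z) f v) :
    ∫ z in Ω, ‖v z‖ ^ 2 * Real.exp (-(k * φ z + agmonWeight k a z)) ≤
      8 / (7 * k) * ∫ z in Ω, formNormSq f z * Real.exp (-(k * φ z + agmonWeight k a z)) := by
  obtain ⟨ρ, hρC, hρ, hρL⟩ := hP
  obtain ⟨hv2, hdb, ho⟩ := hv
  set ψ : Cn n → ℝ := agmonWeight k a with hψ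
  have hψC : ∀ {m : WithTop ℕ∞}, ContDiff ℝ m ψ := contDiff_agmonWeight hk.le a
  have hψ0 : ∀ z, 0 ≤ ψ z := agmonWeight_nonneg k a
  have hφc : ContinuousOn (fun z => k * φ z) Ω := continuousOn_const.mul hφ.continuousOn
  have hψc : ContinuousOn ψ Ω := (hψC (m := 0)).continuous.continuousOn
  set Φ : Cn n → ℝ := fun z => k * φ z + -ψ z with hΦ
  set Θ : Cn n → ℝ := fun z => k * φ z + ψ z with hΘ
  have hΘc : ContinuousOn Θ Ω := hφc.add hψc
  have hΘle : ∀ z ∈ Ω, k * φ z ≤ Θ z := fun z _ => le_add_of_nonneg_right (hψ0 z)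
  have hvΘ := memLp_mul_exp_of_le hΩ hφc hΘc hΘle (hv2.memLp hΩ hφc)
  have hfΘ := fun j => memLp_mul_exp_of_le hΩ hφc hΘc hΘle ((hfm j).memLp hΩ hφc)
  set F : Cn n → ℂ := fun z => (Real.exp (-ψ z) : ℂ) with hF
  have hFC : ContDiff ℝ 1 F := contDiffOn_univ.1 (contDiffOn_ofReal_exp_neg hψC.contDiffOn)
  have hwF : ∀ z j, wirt I F z j = -(wirt I (fun y => (ψ y : ℂ)) z j * F z) := fun z j =>
    wirt_exp_neg I ((hψC (m := 1)).differentiable one_ne_zero z) j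
  have hFE : ∀ z, F z * (Real.exp (-(1 / 2) * Φ z) : ℂ) = (Real.exp (-(1 / 2) * Θ z) : ℂ) := by
    intro z
    rw [hF, hΦ, hΘ, ← ofReal_mul, ← Real.exp_add]
    ring_nf
  have hwψ : ∀ z, ∑ j, ‖wirt I (fun y => (ψ y : ℂ)) z j‖ ^ 2 ≤ k / 4 := fun z => by
    refine le_trans (le_of_eq ?_) (gradSq_agmonWeight_le (a := a) hk.le z)
    refine Finset.sum_congr rfl fun j _ => ?_
    rw [wirt_neg_I_ofReal ((hψC (m := 1)).differentiable one_ne_zero z), RCLike.norm_conj]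
  have hwj : ∀ j z, ‖wirt I (fun y => (ψ y : ℂ)) z j‖ ≤ √(k / 4) := fun j z =>
    Real.le_sqrt_of_sq_le ((Finset.single_le_sum (fun j _ => sq_nonneg
      ‖wirt I (fun y => (ψ y : ℂ)) z j‖) (Finset.mem_univ j)).trans (hwψ z))
  have hwc : ∀ j, Continuous fun z => wirt I (fun y => (ψ y : ℂ)) z j := fun j =>
    continuous_wirt I (contDiff_ofReal_comp hψC) j
  have hvw : ∀ j, MemLp (fun z => wirt I (fun y => (ψ y : ℂ)) z j *
      (v z * (Real.exp (-(1 / 2) * Θ z) : ℂ))) 2 (volume.restrict Ω) := fun j =>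
    hvΘ.of_le_mul ((hwc j).aestronglyMeasurable.mul hvΘ.1) (.of_forall fun z => by
      rw [norm_mul]
      exact mul_le_mul_of_nonneg_right (hwj j z) (norm_nonneg _))
  set g : Cn n → Fin n → ℂ := fun z j => f z j * F z + v z * wirt I F z j with hg
  have hgE : ∀ z j, g z j * (Real.exp (-(1 / 2) * Φ z) : ℂ) =
      f z j * (Real.exp (-(1 / 2) * Θ z) : ℂ) - wirt I (fun y => (ψ y : ℂ)) z j *
        (v z * (Real.exp (-(1 / 2) * Θ z) : ℂ)) := fun z j => by
    rw [← hFE, hg]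
    dsimp only
    rw [hwF]
    ring
  have huE : ∀ z, v z * F z * (Real.exp (-(1 / 2) * Φ z) : ℂ) =
      v z * (Real.exp (-(1 / 2) * Θ z) : ℂ) := fun z => by rw [mul_assoc, hFE]
  have hu : MemLp (fun z => v z * F z * (Real.exp (-(1 / 2) * Φ z) : ℂ)) 2 (volume.restrict Ω) := by
    simpa only [huE] using hvΘ
  have hgL : ∀ j, MemLp (fun z => g z j * (Real.exp (-(1 / 2) * Φ z) : ℂ)) 2
      (volume.restrict Ω) := fun j => by
    simp only [hgE]
    exact (hfΘ j).sub (hvw j)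
  have hFm : AEStronglyMeasurable F (volume.restrict Ω) := hFC.continuous.aestronglyMeasurable
  have hgm : ∀ j, AEStronglyMeasurable (fun z => g z j) (volume.restrict Ω) := fun j =>
    ((hfm j).1.mul hFm).add (hv2.1.mul (continuous_wirt I hFC j).aestronglyMeasurable)
  have hgdb : DbarEqOn Ω (fun z => v z * F z) g := hdb.mul_contDiff hΩ
    (locallyIntegrableOn_of_integrableOn hΩ hv2.1 hv2.2 hφc)
    (fun j => locallyIntegrableOn_of_integrableOn hΩ (hfm j).1 (hfm j).2 hφc) hFC
  have huo : OrthToHolo Ω Φ fun z => v z * F z := by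
    intro h hh hhm
    have hhm' : MemL2 Ω (fun z => k * φ z) h := by
      refine ⟨hhm.1, integrableOn_normSq_mul_exp (memLp_mul_exp_of_le hΩ (hφc.add hψc.neg) hφc
        (fun z _ => ?_) (hhm.memLp hΩ (hφc.add hψc.neg)))⟩
      change k * φ z + -ψ z ≤ k * φ z
      linarith [hψ0 z]
    rw [← ho h hh hhm']
    refine integral_congr_ae (.of_forall fun z => ?_)
    have : F z * (Real.exp (-Φ z) : ℂ) = (Real.exp (-(k * φ z)) : ℂ) := by
      rw [hF, hΦ, ← ofReal_mul, ← Real.exp_add]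
      ring_nf
    dsimp only
    rw [← this]
    ring
  have hΦC : ContDiffOn ℝ 2 Φ Ω := (contDiffOn_const.mul hφ).add hψC.neg.contDiffOn
  have key := integral_normSq_mul_exp_le_of_dbarEqOn (ρ := fun z => ρ z + ‖z - 0‖ ^ 2)
    (c := k * (5 - 1 / 2)) hΩ
    (hρC.add (contDiff_norm_sub_sq 0).contDiffOn)
    (isCompact_sep_add_norm_sq_le hρC.continuousOn hρ) (fun z hz w => by
      rw [leviForm_add (hρC.contDiffAt (hΩ.mem_nhds hz)) (contDiff_norm_sub_sq 0).contDiffAt,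
        leviForm_norm_sub_sq]
      linarith [hρL z hz w]) hΦC (by linarith) (fun z hz w =>
      leviForm_const_mul_sub_agmonWeight hk.le (hφ.contDiffAt (hΩ.mem_nhds hz)) (hL z hz w))
    hu (hv2.1.mul hFm) hgL hgm hgdb huo
  simp only [← norm_mul_ofReal_exp_sq, Finset.sum_mul, huE, hgE, formNormSq] at key ⊢
  have iv := hvΘ.integrable_norm_pow two_ne_zero
  have jf : Integrable (fun z => ∑ j, ‖f z j * (Real.exp (-(1 / 2) * Θ z) : ℂ)‖ ^ 2)
      (volume.restrict Ω) :=
    integrable_finsetSum _ fun j _ => (hfΘ j).integrable_norm_pow two_ne_zero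
  have jg : Integrable (fun z => ∑ j, ‖f z j * (Real.exp (-(1 / 2) * Θ z) : ℂ) -
      wirt I (fun y => (ψ y : ℂ)) z j * (v z * (Real.exp (-(1 / 2) * Θ z) : ℂ))‖ ^ 2)
      (volume.restrict Ω) :=
    integrable_finsetSum _ fun j _ => ((hfΘ j).sub (hvw j)).integrable_norm_pow two_ne_zero
  have hle := integral_mono jg ((jf.const_mul 2).add (iv.const_mul (k / 2))) fun z => by
    dsimp only [Pi.add_apply]
    have h1 : ∀ x y : ℂ, ‖x - y‖ ^ 2 ≤ 2 * ‖x‖ ^ 2 + 2 * ‖y‖ ^ 2 := fun x y => by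
      have := pow_le_pow_left₀ (norm_nonneg _) (norm_sub_le x y) 2
      nlinarith [sq_nonneg (‖x‖ - ‖y‖)]
    refine (Finset.sum_le_sum fun j _ => h1 _ _).trans ?_
    rw [Finset.sum_add_distrib, ← Finset.mul_sum, ← Finset.mul_sum]
    refine add_le_add_right ?_ _
    simp only [norm_mul (wirt _ _ _ _), mul_pow, ← Finset.sum_mul]
    nlinarith [mul_le_mul_of_nonneg_right (hwψ z)
      (sq_nonneg ‖v z * (Real.exp (-(1 / 2) * Θ z) : ℂ)‖)]
  rw [integral_add' (jf.const_mul 2) (iv.const_mul (k / 2)), integral_const_mul,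
    integral_const_mul] at hle
  have h2 := key.trans (mul_le_mul_of_nonneg_left hle (by positivity))
  rw [div_mul_eq_mul_div, le_div_iff₀ (by positivity)] at h2 ⊢
  linarith

end Agmon

/-- **Theorem 2.1** (Agmon-type estimate via the Donnelly–Fefferman trick). Assume
`i∂∂̄φ ≥ 5β`. There is a dimensional constant `C` such that for all `k ≥ 1` and all
`a ∈ ℂⁿ`, the `L²(Ω, e^{-kφ})`-minimal solution `v` of `∂̄v = f` satisfies
`∫ |v|² e^{-kφ - √k|z-a|} ≤ (C/k) ∫ |f|² e^{-kφ - √k|z-a|}`. -/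
theorem agmon_estimate (n : ℕ) :
    ∃ C > 0, ∀ Ω : Set (Cn n), IsOpen Ω → Pseudoconvex Ω →
      ∀ φ : Cn n → ℝ, ContDiffOn ℝ 2 φ Ω →
        (∀ z ∈ Ω, ∀ w : Cn n, 5 * ‖w‖ ^ 2 ≤ LeviForm φ z w) →
      ∀ k : ℝ, 1 ≤ k → ∀ a : Cn n,
      ∀ f : Cn n → Fin n → ℂ, SmoothFormOn Ω f → DbarClosedOn Ω f →
        IntegrableOn (fun z => formNormSq f z * Real.exp (-(k * φ z))) Ω volume →
      ∀ v : Cn n → ℂ, MinimalSolution Ω (fun z => k * φ z) f v →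
        ∫ z in Ω, ‖v z‖ ^ 2 * Real.exp (-(k * φ z) - Real.sqrt k * ‖z - a‖) ≤
          (C / k) * ∫ z in Ω, formNormSq f z *
            Real.exp (-(k * φ z) - Real.sqrt k * ‖z - a‖) := by
  refine ⟨8 / 7 * Real.exp 1, by positivity, ?_⟩
  intro Ω hΩ hP φ hφ hL k hk a f hf _ hfi v hv
  have hk0 : 0 < k := by linarith
  have hφc : ContinuousOn (fun z => k * φ z) Ω := continuousOn_const.mul hφ.continuousOn
  have hfm : ∀ j, MemL2 Ω (fun z => k * φ z) fun z => f z j := fun j => by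
    have hm := (hf j).continuousOn.aestronglyMeasurable (μ := volume) hΩ.measurableSet
    refine ⟨hm, hfi.mono' ?_ (.of_forall fun z => ?_)⟩
    · exact (hm.norm.pow 2).mul
        ((Real.continuous_exp.comp_continuousOn hφc.neg).aestronglyMeasurable hΩ.measurableSet)
    · rw [Real.norm_of_nonneg (by positivity)]
      exact mul_le_mul_of_nonneg_right (Finset.single_le_sum (f := fun j => ‖f z j‖ ^ 2)
        (fun j _ => sq_nonneg _) (Finset.mem_univ j)) (Real.exp_pos _).le
  have key := integral_mul_exp_neg_agmonWeight_le hΩ hP hφ hL hk0 a hfm hv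
  have hψ := fun z => sqrt_mul_norm_le_agmonWeight (a := a) hk0.le z
  have hψ' := fun z => agmonWeight_le (a := a) hk0.le z
  have hF0 : ∀ z, 0 ≤ formNormSq f z := fun z => Finset.sum_nonneg fun j _ => sq_nonneg _
  have hψc : Continuous (agmonWeight k a) := (contDiff_agmonWeight (m := 0) hk0.le a).continuous
  have hbdd : ∀ {b W : Cn n → ℝ}, IntegrableOn (fun z => b z * Real.exp (-(k * φ z))) Ω →
      Continuous W → (∀ z, 0 ≤ W z) →
      IntegrableOn (fun z => b z * Real.exp (-(k * φ z)) * Real.exp (-W z)) Ω := by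
    intro b W hb hW hW0
    refine hb.mul_bdd (c := 1) (Real.continuous_exp.comp hW.neg).aestronglyMeasurable
      (.of_forall fun z => ?_)
    rw [Real.norm_of_nonneg (Real.exp_pos _).le, Real.exp_le_one_iff]
    linarith [hW0 z]
  have hexp : ∀ (b : ℝ) (z : Cn n) (t : ℝ), b * Real.exp (-(k * φ z)) * Real.exp (-t) =
      b * Real.exp (-(k * φ z + t)) := fun b z t => by
    rw [mul_assoc, ← Real.exp_add, ← neg_add]
  have iv : IntegrableOn (fun z => ‖v z‖ ^ 2 * Real.exp (-(k * φ z + agmonWeight k a z))) Ω := by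
    simpa only [hexp] using hbdd hv.1.2 hψc (agmonWeight_nonneg k a)
  have jf : IntegrableOn (fun z => formNormSq f z *
      Real.exp (-(k * φ z + agmonWeight k a z))) Ω := by
    simpa only [hexp] using hbdd hfi hψc (agmonWeight_nonneg k a)
  have jf' : IntegrableOn (fun z => formNormSq f z *
      Real.exp (-(k * φ z + Real.sqrt k * ‖z - a‖))) Ω := by
    simpa only [hexp] using hbdd hfi (W := fun z => Real.sqrt k * ‖z - a‖) (by fun_prop)
      fun z => by positivity
  simp only [sub_eq_add_neg (-(k * φ _)), ← neg_add]
  have h1 : ∫ z in Ω, ‖v z‖ ^ 2 * Real.exp (-(k * φ z + Real.sqrt k * ‖z - a‖)) ≤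
      Real.exp 1 * ∫ z in Ω, ‖v z‖ ^ 2 * Real.exp (-(k * φ z + agmonWeight k a z)) := by
    rw [← integral_const_mul]
    refine integral_mono_of_nonneg (.of_forall fun z => by positivity) (iv.const_mul _)
      (.of_forall fun z => ?_)
    dsimp only
    rw [mul_left_comm, ← Real.exp_add]
    gcongr
    linarith [hψ' z]
  have h2 : ∫ z in Ω, formNormSq f z * Real.exp (-(k * φ z + agmonWeight k a z)) ≤
      ∫ z in Ω, formNormSq f z * Real.exp (-(k * φ z + Real.sqrt k * ‖z - a‖)) := by
    refine integral_mono jf jf' fun z => ?_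
    have := hF0 z
    dsimp only
    gcongr
    exact hψ z
  calc _ ≤ _ := h1
    _ ≤ Real.exp 1 * (8 / (7 * k) * ∫ z in Ω, formNormSq f z *
          Real.exp (-(k * φ z + Real.sqrt k * ‖z - a‖))) :=
        mul_le_mul_of_nonneg_left (key.trans (mul_le_mul_of_nonneg_left h2 (by positivity)))
          (Real.exp_pos 1).le
    _ = _ := by field_simp
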